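/- arXiv:2109.10299 — 3 statements merged into one kernel-verified Lean document; each statement's English description precedes it below -/
import Mathlib

section
/- For every permutation π ∈ S_p, all exponent vectors in supp(𝔖_π) ⊂ ℕ^{2p} have the same coordinate sum, and supp(𝔖_π) satisfies the exchange property of discrete polymatroids (M-convexity): for any a, b ∈ supp(𝔖_π) and any index i with a_i > b_i, there exists an index j with a_j < b_j such that a − e_i + e_j ∈ supp(𝔖_π). -/
open MvPolynomial

/-- The Coxeter length of a permutation of `Fin p`, i.e. its number of inversions. -/
def permLength {p : ℕ} (π : Equiv.Perm (Fin p)) : ℕ :=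
  (Finset.univ.filter (fun q : Fin p × Fin p => q.1 < q.2 ∧ π q.2 < π q.1)).card

/-- The defining recursion for the family of double Schubert polynomials
`𝔖 : Equiv.Perm (Fin p) → ℤ[t₁,…,t_p,s₁,…,s_p]`, where the variable `X (Sum.inl i)`
plays the role of `t_{i+1}` and `X (Sum.inr j)` plays the role of `s_{j+1}`:
`𝔖 π₀ = ∏_{i+j ≤ p} (t_i - s_j)` for the longest permutation `π₀` (which is `Fin.revPerm`),
and `(t_i - t_{i+1}) ⬝ 𝔖 (𝔰_i π) = 𝔖 π - 𝔰_i ⬝ 𝔖 π` whenever `ℓ(𝔰_i π) < ℓ(π)`,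
where the simple transposition `𝔰_i` acts on polynomials by permuting the `t`-variables. -/
def IsDoubleSchubertFamily (p : ℕ)
    (𝔖 : Equiv.Perm (Fin p) → MvPolynomial (Fin p ⊕ Fin p) ℤ) : Prop :=
  (𝔖 Fin.revPerm =
      ∏ q ∈ Finset.univ.filter (fun q : Fin p × Fin p => (q.1 : ℕ) + (q.2 : ℕ) + 2 ≤ p),
        (X (Sum.inl q.1) - X (Sum.inr q.2))) ∧
  (∀ (π : Equiv.Perm (Fin p)) (i : Fin p) (h : (i : ℕ) + 1 < p),
    permLength (Equiv.swap i ⟨(i : ℕ) + 1, h⟩ * π) < permLength π →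
      (X (Sum.inl i) - X (Sum.inl ⟨(i : ℕ) + 1, h⟩)) *
          𝔖 (Equiv.swap i ⟨(i : ℕ) + 1, h⟩ * π)
        = 𝔖 π - MvPolynomial.rename (Sum.map (Equiv.swap i ⟨(i : ℕ) + 1, h⟩) id) (𝔖 π))

namespace SchubertSupport

/-! ### Order ideals of monomials and their multigraded counting series -/

/-- The cells of a `p × p` matrix. -/
abbrev Cell (p : ℕ) := Fin p × Fin p

/-- Labels for the rows (`inl`) and the columns (`inr`) of a `p × p` matrix. -/
abbrev Lab (p : ℕ) := Fin p ⊕ Fin p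

variable {p : ℕ}

/-- The weight of a cell: the sum of its row label and its column label. -/
noncomputable def cellWeight (e : Cell p) : Lab p →₀ ℕ :=
  Finsupp.single (Sum.inl e.1) 1 + Finsupp.single (Sum.inr e.2) 1

/-- The multidegree of a monomial in the matrix entries. -/
noncomputable def mdeg : (Cell p →₀ ℕ) →+ (Lab p →₀ ℕ) := Finsupp.weight cellWeight

lemma mdeg_single (e : Cell p) (k : ℕ) : mdeg (Finsupp.single e k) = k • cellWeight e := by
  simp [mdeg, Finsupp.weight_single]

lemma sum_cellWeight (e : Cell p) : (cellWeight e).degree = 2 := by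
  simp [cellWeight]

lemma degree_mdeg (x : Cell p →₀ ℕ) : (mdeg x).degree = 2 * x.degree := by
  induction x using Finsupp.induction_linear with
  | zero => simp
  | add f g hf hg => simp [hf, hg, mul_add]
  | single e k =>
    rw [mdeg_single, map_nsmul, sum_cellWeight]
    simp [mul_comm]

lemma finite_mdeg_fiber (n : Lab p →₀ ℕ) : {x : Cell p →₀ ℕ | mdeg x = n}.Finite := by
  refine (Finsupp.finite_of_degree_le (σ := Cell p) n.degree).subset fun x hx => ?_
  have := degree_mdeg x
  simp only [Set.mem_ofPred_eq] at hx ⊢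
  rw [hx] at this
  omega

/-- The multigraded counting series of a set of monomials. -/
noncomputable def countSeries (S : Set (Cell p →₀ ℕ)) : MvPowerSeries (Lab p) ℤ :=
  fun n => ({x | x ∈ S ∧ mdeg x = n}.ncard : ℤ)

lemma coeff_countSeries (S : Set (Cell p →₀ ℕ)) (n : Lab p →₀ ℕ) :
    MvPowerSeries.coeff n (countSeries S) = ({x | x ∈ S ∧ mdeg x = n}.ncard : ℤ) := rfl

lemma countSeries_union {S S' : Set (Cell p →₀ ℕ)} (h : Disjoint S S') :
    countSeries (S ∪ S') = countSeries S + countSeries S' := by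
  ext n
  rw [map_add, coeff_countSeries, coeff_countSeries, coeff_countSeries, ← Nat.cast_add,
    ← Set.ncard_union_eq (Set.disjoint_left.2 fun x hx hx' => Set.disjoint_left.1 h hx.1 hx'.1)
      ((finite_mdeg_fiber n).subset fun x hx => hx.2)
      ((finite_mdeg_fiber n).subset fun x hx => hx.2)]
  congr 2
  ext x
  simp only [Set.mem_union, Set.mem_ofPred_eq]
  tauto

lemma countSeries_translate (S : Set (Cell p →₀ ℕ)) (m : Cell p →₀ ℕ) :
    countSeries ((m + ·) '' S) = MvPowerSeries.monomial (mdeg m) 1 * countSeries S := by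
  ext n
  rw [MvPowerSeries.coeff_monomial_mul]
  split_ifs with h
  · rw [one_mul, coeff_countSeries, coeff_countSeries]
    congr 1
    refine Eq.trans ?_ (Set.ncard_image_of_injective {x | x ∈ S ∧ mdeg x = n - mdeg m}
      (add_right_injective m))
    congr 1
    ext x
    simp only [Set.mem_image, Set.mem_ofPred_eq]
    constructor
    · rintro ⟨⟨y, hy, rfl⟩, hx⟩
      refine ⟨y, ⟨hy, ?_⟩, rfl⟩
      rw [← hx, map_add, add_tsub_cancel_left]
    · rintro ⟨y, ⟨hy, hy'⟩, rfl⟩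
      exact ⟨⟨y, hy, rfl⟩, by rw [map_add, hy', add_tsub_cancel_of_le h]⟩
  · rw [coeff_countSeries]
    norm_cast
    rw [Set.ncard_eq_zero ((finite_mdeg_fiber n).subset fun x hx => hx.2)]
    ext x
    simp only [Set.mem_image, Set.mem_ofPred_eq, Set.mem_empty_iff_false, iff_false, not_and]
    rintro ⟨y, hy, rfl⟩ hx
    exact h (by rw [← hx, map_add]; exact le_self_add)

/-- The coordinate face `ℕ^F`. -/
def face (F : Finset (Cell p)) : Set (Cell p →₀ ℕ) := {x | x.support ⊆ F}

lemma mem_face {F : Finset (Cell p)} {x : Cell p →₀ ℕ} : x ∈ face F ↔ x.support ⊆ F := Iff.rfl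

/-- The Hilbert series factor `1 - x^w` of a cell. -/
noncomputable def cellFactor (e : Cell p) : MvPolynomial (Lab p) ℤ :=
  1 - MvPolynomial.monomial (cellWeight e) 1

lemma coe_sub (f g : MvPolynomial (Lab p) ℤ) :
    ((f - g : MvPolynomial (Lab p) ℤ) : MvPowerSeries (Lab p) ℤ) = f - g :=
  map_sub (MvPolynomial.coeToMvPowerSeries.ringHom (R := ℤ)) f g

lemma countSeries_face (F : Finset (Cell p)) :
    countSeries (face F) * ((∏ e ∈ F, cellFactor e : MvPolynomial (Lab p) ℤ) :
      MvPowerSeries (Lab p) ℤ) = 1 := by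
  classical
  induction F using Finset.induction_on with
  | empty =>
    simp only [Finset.prod_empty, MvPolynomial.coe_one, mul_one]
    ext n
    rw [coeff_countSeries, MvPowerSeries.coeff_one]
    have : {x : Cell p →₀ ℕ | x ∈ face ∅ ∧ mdeg x = n} = if n = 0 then {0} else ∅ := by
      ext x
      rw [Set.mem_ofPred_eq, mem_face, Finset.subset_empty, Finsupp.support_eq_empty]
      split_ifs with h
      · subst h
        simp only [Set.mem_singleton_iff, and_iff_left_iff_imp]
        rintro rfl; simp
      · simp only [Set.mem_empty_iff_false, iff_false, not_and]
        rintro rfl; simpa using Ne.symm h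
    rw [this]
    split_ifs <;> simp
  | insert e F he ih =>
    have key : face (insert e F) = face F ∪ (Finsupp.single e 1 + ·) '' face (insert e F) := by
      ext x
      simp only [Set.mem_union, Set.mem_image, mem_face]
      constructor
      · intro hx
        by_cases hxe : x e = 0
        · left
          intro a ha
          rcases Finset.mem_insert.1 (hx ha) with rfl | h
          · exact absurd hxe (Finsupp.mem_support_iff.1 ha)
          · exact h
        · right
          refine ⟨x - Finsupp.single e 1, (Finset.Subset.trans Finsupp.support_tsub hx), ?_⟩
          rw [add_tsub_cancel_of_le]
          rw [Finsupp.single_le_iff]; omega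
      · rintro (h | ⟨y, hy, rfl⟩)
        · exact h.trans (Finset.subset_insert _ _)
        · refine Finsupp.support_add.trans (Finset.union_subset ?_ hy)
          exact Finsupp.support_single_subset.trans (by simp)
    have hd : Disjoint (face F) ((Finsupp.single e 1 + ·) '' face (insert e F)) := by
      rw [Set.disjoint_left]
      rintro _ hx ⟨y, hy, rfl⟩
      exact he (hx (by simp))
    have h2 : countSeries (face (insert e F)) * (cellFactor e : MvPolynomial (Lab p) ℤ)
        = countSeries (face F) := by
      have := congrArg countSeries key
      rw [countSeries_union hd, countSeries_translate, mdeg_single, one_smul] at this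
      rw [cellFactor, coe_sub, MvPolynomial.coe_one, MvPolynomial.coe_monomial,
        mul_sub, mul_one, mul_comm _ (MvPowerSeries.monomial _ _)]
      linear_combination this
    rw [Finset.prod_insert he, MvPolynomial.coe_mul, ← mul_assoc, h2, ih]

/-! ### Leading terms along `x = 1 - t` -/

/-- The substitution `x_v ↦ 1 - T x_v`. -/
noncomputable def oneSub : MvPolynomial (Lab p) ℤ →ₐ[ℤ] Polynomial (MvPolynomial (Lab p) ℤ) :=
  MvPolynomial.aeval fun v => 1 - Polynomial.X * Polynomial.C (MvPolynomial.X v)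

/-- `F` is divisible by `T ^ c` and the coefficient of `T ^ c` is `g`. -/
def IsLow {A : Type*} [CommRing A] (c : ℕ) (F : Polynomial A) (g : A) : Prop :=
  ∃ F' : Polynomial A, F = Polynomial.X ^ c * F' ∧ F'.coeff 0 = g

namespace IsLow

variable {A : Type*} [CommRing A] {c c' : ℕ} {F G : Polynomial A} {g g' : A}

lemma add (h : IsLow c F g) (h' : IsLow c G g') : IsLow c (F + G) (g + g') := by
  obtain ⟨F', rfl, rfl⟩ := h
  obtain ⟨G', rfl, rfl⟩ := h'
  exact ⟨F' + G', by ring, by simp⟩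

lemma mul (h : IsLow c F g) (h' : IsLow c' G g') : IsLow (c + c') (F * G) (g * g') := by
  obtain ⟨F', rfl, rfl⟩ := h
  obtain ⟨G', rfl, rfl⟩ := h'
  exact ⟨F' * G', by ring, by simp [Polynomial.mul_coeff_zero]⟩

lemma of_lt (h : IsLow c' F g) (hc : c < c') : IsLow c F 0 := by
  obtain ⟨F', rfl, rfl⟩ := h
  obtain ⟨k, rfl⟩ := Nat.exists_eq_add_of_lt hc
  exact ⟨Polynomial.X ^ (k + 1) * F', by ring, by simp [pow_succ']⟩

lemma unique (h : IsLow c F g) (h' : IsLow c F g') : g = g' := by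
  obtain ⟨F', rfl, rfl⟩ := h
  obtain ⟨G', h, rfl⟩ := h'
  have := congrArg (Polynomial.coeff · c) h
  simpa [Polynomial.coeff_X_pow_mul'] using this

lemma one : IsLow 0 (1 : Polynomial A) 1 := ⟨1, by simp, by simp⟩

lemma zero : IsLow c (0 : Polynomial A) 0 := ⟨0, by simp, by simp⟩

lemma prod {ι : Type*} (s : Finset ι) (f : ι → Polynomial A) (g : ι → A)
    (h : ∀ i ∈ s, IsLow 1 (f i) (g i)) : IsLow s.card (∏ i ∈ s, f i) (∏ i ∈ s, g i) := by
  classical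
  induction s using Finset.induction_on with
  | empty => simpa using one
  | insert i s hi ih =>
    rw [Finset.prod_insert hi, Finset.prod_insert hi, Finset.card_insert_of_notMem hi, add_comm]
    exact (h i (by simp)).mul (ih fun j hj => h j (by simp [hj]))

lemma sum {ι : Type*} (s : Finset ι) (f : ι → Polynomial A) (g : ι → A)
    (h : ∀ i ∈ s, IsLow c (f i) (g i)) : IsLow c (∑ i ∈ s, f i) (∑ i ∈ s, g i) := by
  classical
  induction s using Finset.induction_on with
  | empty => simpa using zero
  | insert i s hi ih =>
    rw [Finset.sum_insert hi, Finset.sum_insert hi]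
    exact (h i (by simp)).add (ih fun j hj => h j (by simp [hj]))

end IsLow

lemma isLow_oneSub_monomial (n : Lab p →₀ ℕ) : IsLow 0 (oneSub (monomial n (1 : ℤ))) 1 := by
  refine ⟨_, by rw [pow_zero, one_mul], ?_⟩
  rw [oneSub, aeval_monomial, Finsupp.prod, map_one, one_mul, Polynomial.coeff_zero_prod]
  refine Finset.prod_eq_one fun v _ => ?_
  simp [Polynomial.coeff_zero_eq_eval_zero]

/-- The leading form `t_i + s_j` of the factor of a cell. -/
noncomputable def cellForm (e : Cell p) : MvPolynomial (Lab p) ℤ :=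
  X (Sum.inl e.1) + X (Sum.inr e.2)

lemma isLow_oneSub_cellFactor (e : Cell p) : IsLow 1 (oneSub (cellFactor e)) (cellForm e) := by
  refine ⟨Polynomial.C (cellForm e) - Polynomial.X * Polynomial.C (X (Sum.inl e.1)) *
    Polynomial.C (X (Sum.inr e.2)), ?_, by simp⟩
  have : monomial (cellWeight e) (1 : ℤ) = X (Sum.inl e.1) * X (Sum.inr e.2) := by
    simp [cellWeight, X, monomial_mul]
  rw [cellFactor, this, cellForm, map_sub, map_one, map_mul, oneSub, aeval_X, aeval_X,
    Polynomial.C_add]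
  ring

/-- `H` is a rational series with denominator `∏ (1 - x^w)` and its numerator vanishes to order
`c` at `x = 1` with leading form `g`. -/
def HasLead (H : MvPowerSeries (Lab p) ℤ) (c : ℕ) (g : MvPolynomial (Lab p) ℤ) : Prop :=
  ∃ κ : MvPolynomial (Lab p) ℤ,
    (κ : MvPowerSeries (Lab p) ℤ) = H * ((∏ e, cellFactor e : MvPolynomial (Lab p) ℤ) :
      MvPowerSeries (Lab p) ℤ) ∧ IsLow c (oneSub κ) g

namespace HasLead

variable {H H' : MvPowerSeries (Lab p) ℤ} {c c' : ℕ} {g g' : MvPolynomial (Lab p) ℤ}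

lemma zero : HasLead (0 : MvPowerSeries (Lab p) ℤ) c 0 := ⟨0, by simp, by simpa using IsLow.zero⟩

lemma add (h : HasLead H c g) (h' : HasLead H' c g') : HasLead (H + H') c (g + g') := by
  obtain ⟨κ, hκ, hl⟩ := h
  obtain ⟨κ', hκ', hl'⟩ := h'
  exact ⟨κ + κ', by rw [MvPolynomial.coe_add, hκ, hκ', add_mul], by
    rw [map_add]; exact hl.add hl'⟩

lemma monomial_mul (h : HasLead H c g) (n : Lab p →₀ ℕ) :
    HasLead (MvPowerSeries.monomial n 1 * H) c g := by
  obtain ⟨κ, hκ, hl⟩ := h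
  refine ⟨MvPolynomial.monomial n 1 * κ, ?_, ?_⟩
  · rw [MvPolynomial.coe_mul, hκ, MvPolynomial.coe_monomial, mul_assoc]
  · rw [map_mul]
    simpa using (isLow_oneSub_monomial n).mul hl

lemma of_lt (h : HasLead H c' g) (hc : c < c') : HasLead H c 0 := by
  obtain ⟨κ, hκ, hl⟩ := h
  exact ⟨κ, hκ, hl.of_lt hc⟩

lemma unique (h : HasLead H c g) (h' : HasLead H c g') : g = g' := by
  obtain ⟨κ, hκ, hl⟩ := h
  obtain ⟨κ', hκ', hl'⟩ := h'
  have : κ = κ' := MvPolynomial.coe_injective _ _ (hκ.trans hκ'.symm)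
  subst this
  exact hl.unique hl'

lemma sum {ι : Type*} (s : Finset ι) (f : ι → MvPowerSeries (Lab p) ℤ)
    (g : ι → MvPolynomial (Lab p) ℤ) (h : ∀ i ∈ s, HasLead (f i) c (g i)) :
    HasLead (∑ i ∈ s, f i) c (∑ i ∈ s, g i) := by
  classical
  induction s using Finset.induction_on with
  | empty => simpa using zero
  | insert i s hi ih =>
    rw [Finset.sum_insert hi, Finset.sum_insert hi]
    exact (h i (by simp)).add (ih fun j hj => h j (by simp [hj]))

end HasLead

/-- The leading form attached to a set of cells. -/
noncomputable def cellsForm (D : Finset (Cell p)) : MvPolynomial (Lab p) ℤ := ∏ e ∈ D, cellForm e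

lemma hasLead_cone (m : Cell p →₀ ℕ) (F : Finset (Cell p)) :
    HasLead (countSeries ((m + ·) '' face F)) Fᶜ.card (cellsForm Fᶜ) := by
  rw [countSeries_translate]
  refine HasLead.monomial_mul ⟨∏ e ∈ Fᶜ, cellFactor e, ?_, ?_⟩ _
  · rw [← Finset.prod_mul_prod_compl F, MvPolynomial.coe_mul, ← mul_assoc, countSeries_face,
      one_mul]
  · rw [map_prod]
    exact IsLow.prod _ _ _ fun e _ => isLow_oneSub_cellFactor e

instance : WellFoundedLT (LowerSet (Cell p →₀ ℕ)) := by
  rw [WellFoundedLT, isWellFounded_iff, RelEmbedding.wellFounded_iff_isEmpty]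
  refine ⟨fun f => ?_⟩
  have h : ∀ n, ∃ a, a ∈ f n ∧ a ∉ f (n + 1) := fun n => by
    have : f (n + 1) < f n := f.map_rel_iff.2 (Nat.lt_succ_self n)
    by_contra! hc
    exact this.not_ge hc
  choose a ha ha' using h
  obtain ⟨m, n, hmn, hle⟩ := wellQuasiOrdered_le a
  have hle' : f n ≤ f (m + 1) := by
    rcases (Nat.succ_le_of_lt hmn).eq_or_lt with h | h
    · rw [← h]
    · exact (show f n < f (m + 1) from f.map_rel_iff.2 h).le
  exact ha' m ((f (m + 1)).lower hle (hle' (ha n)))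

/-- A nonempty order ideal splits off a full cone. -/
lemma exists_cone (Δ : LowerSet (Cell p →₀ ℕ)) (hΔ : (Δ : Set (Cell p →₀ ℕ)).Nonempty) :
    ∃ (m : Cell p →₀ ℕ) (F : Finset (Cell p)) (Δ' : LowerSet (Cell p →₀ ℕ)),
      (Δ : Set (Cell p →₀ ℕ)) = (m + ·) '' face F ∪ Δ' ∧
      Disjoint ((m + ·) '' face F) (Δ' : Set (Cell p →₀ ℕ)) := by
  classical
  let sh : (Cell p →₀ ℕ) → LowerSet (Cell p →₀ ℕ) := fun m =>
    ⟨{x | m + x ∈ Δ}, fun a b hab ha => Δ.lower (add_le_add_right hab m) ha⟩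
  have hsh : ∀ m x, x ∈ sh m ↔ m + x ∈ Δ := fun m x => Iff.rfl
  obtain ⟨m, hm, hmin⟩ := WellFounded.has_min (InvImage.wf sh (wellFounded_lt)) _ hΔ
  have hconst : ∀ x ∈ sh m, sh (m + x) = sh m := fun x hx => by
    have hle : sh (m + x) ≤ sh m := fun y hy => by
      change y ∈ sh (m + x) at hy
      change y ∈ sh m
      rw [hsh] at hy ⊢
      exact Δ.lower (by rw [add_right_comm]; exact le_self_add) hy
    exact hle.eq_of_not_lt (hmin (m + x) hx)
  let F : Finset (Cell p) := Finset.univ.filter fun e => Finsupp.single e 1 ∈ sh m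
  have hF : ∀ e, e ∈ F ↔ Finsupp.single e 1 ∈ sh m := by simp [F]
  have hface : ∀ (n : ℕ) (x : Cell p →₀ ℕ), x.degree = n → x ∈ face F → x ∈ sh m := by
    intro n
    induction n with
    | zero =>
      intro x hx _
      rw [Finsupp.degree_eq_zero_iff] at hx
      rw [hsh, hx, add_zero]
      exact hm
    | succ n ih =>
      intro x hx hxF
      have hx0 : x ≠ 0 := by rintro rfl; simp at hx
      obtain ⟨e, he⟩ := Finsupp.support_nonempty_iff.2 hx0
      have hle : Finsupp.single e 1 ≤ x := by
        rw [Finsupp.single_le_iff]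
        exact Nat.one_le_iff_ne_zero.2 (Finsupp.mem_support_iff.1 he)
      obtain ⟨y, rfl⟩ := exists_add_of_le hle
      have hy : y ∈ sh m := by
        refine ih y ?_ ((Finsupp.support_mono le_add_self).trans hxF)
        rw [map_add, Finsupp.degree_single] at hx
        omega
      have := (hF e).1 (hxF he)
      rw [← hconst y hy, hsh, add_assoc, add_comm y] at this
      exact this
  have hface' : ∀ x, x ∈ sh m → x ∈ face F := by
    intro x hx e he
    rw [hF]
    refine (sh m).lower ?_ hx
    rw [Finsupp.single_le_iff]
    exact Nat.one_le_iff_ne_zero.2 (Finsupp.mem_support_iff.1 he)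
  refine ⟨m, F, ⟨(Δ : Set (Cell p →₀ ℕ)) \ (m + ·) '' face F, ?_⟩, ?_, ?_⟩
  · rintro x y hyx ⟨hx, hx'⟩
    refine ⟨Δ.lower hyx hx, ?_⟩
    rintro ⟨v, hv, rfl⟩
    obtain ⟨u, rfl⟩ := exists_add_of_le hyx
    exact hx' ⟨v + u, hface' _ (by rw [hsh, ← add_assoc]; exact hx), (add_assoc _ _ _).symm⟩
  · have : (m + ·) '' face F ⊆ (Δ : Set (Cell p →₀ ℕ)) := by
      rintro _ ⟨v, hv, rfl⟩
      exact hface _ v rfl hv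
    exact (Set.union_sdiff_cancel this).symm
  · exact Set.disjoint_sdiff_right

/-- The leading form of an order ideal, in terms of its maximal coordinate faces. -/
lemma hasLead_lowerSet (d : ℕ) (Δ : LowerSet (Cell p →₀ ℕ))
    (hd : ∀ F, face F ⊆ (Δ : Set (Cell p →₀ ℕ)) → Fᶜ.card ≥ d) :
    ∃ ms : Multiset (Finset (Cell p)),
      (∀ D ∈ ms, D.card = d ∧ face Dᶜ ⊆ (Δ : Set (Cell p →₀ ℕ))) ∧
      (∀ D, D.card = d → face Dᶜ ⊆ (Δ : Set (Cell p →₀ ℕ)) → D ∈ ms) ∧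
      HasLead (countSeries (Δ : Set (Cell p →₀ ℕ))) d (ms.map cellsForm).sum := by
  classical
  induction Δ using WellFoundedLT.induction with
  | ind Δ ih =>
  rcases Set.eq_empty_or_nonempty (Δ : Set (Cell p →₀ ℕ)) with h0 | h0
  · refine ⟨0, by simp, fun D _ hD => ?_, ?_⟩
    · rw [h0] at hD
      exact absurd (hD (by simp [mem_face] : (0 : Cell p →₀ ℕ) ∈ face Dᶜ)) (Set.notMem_empty _)
    · have : countSeries (Δ : Set (Cell p →₀ ℕ)) = 0 := by
        ext n
        rw [coeff_countSeries, h0]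
        simp
      rw [this]
      simpa using HasLead.zero
  obtain ⟨m, F, Δ', hΔ, hdisj⟩ := exists_cone Δ h0
  have hsub : (Δ' : Set (Cell p →₀ ℕ)) ⊆ Δ := by rw [hΔ]; exact Set.subset_union_right
  have hm : m ∉ Δ' := fun h => Set.disjoint_left.1 hdisj ⟨0, by simp [mem_face], by simp⟩ h
  have hlt : Δ' < Δ := by
    refine lt_of_le_of_ne hsub ?_
    rintro rfl
    refine hm ?_
    change m ∈ (Δ' : Set (Cell p →₀ ℕ))
    rw [hΔ]
    exact Or.inl ⟨0, by simp [mem_face], by simp⟩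
  obtain ⟨ms, h1, h2, h3⟩ := ih Δ' hlt fun F hF => hd F (hF.trans hsub)
  have hF : face F ⊆ (Δ : Set (Cell p →₀ ℕ)) := fun x hx => by
    refine Δ.lower (le_add_self : x ≤ m + x) ?_
    rw [hΔ]
    exact Or.inl ⟨x, hx, rfl⟩
  have hcs : countSeries (Δ : Set (Cell p →₀ ℕ)) =
      countSeries ((m + ·) '' face F) + countSeries (Δ' : Set (Cell p →₀ ℕ)) := by
    rw [hΔ, countSeries_union hdisj]
  have hcases : ∀ D : Finset (Cell p), D.card = d → face Dᶜ ⊆ (Δ : Set (Cell p →₀ ℕ)) →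
      D = Fᶜ ∨ face Dᶜ ⊆ (Δ' : Set (Cell p →₀ ℕ)) := by
    intro D hD hDΔ
    by_cases hDF : Dᶜ ⊆ F
    · left
      refine (Finset.eq_of_subset_of_card_le ?_ ?_).symm
      · rw [← Finset.compl_subset_compl, compl_compl]
        exact hDF
      · rw [hD]; exact hd F hF
    · right
      obtain ⟨e, he, heF⟩ := Finset.not_subset.1 hDF
      intro x hx
      refine Δ'.lower (le_add_self : x ≤ Finsupp.single e (m e + 1) + x) ?_
      have : Finsupp.single e (m e + 1) + x ∈ (Δ : Set (Cell p →₀ ℕ)) := by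
        refine hDΔ (Finsupp.support_add.trans (Finset.union_subset ?_ hx))
        exact Finsupp.support_single_subset.trans (by simpa using he)
      rw [hΔ] at this
      refine this.resolve_left ?_
      rintro ⟨y, hy, hxy⟩
      have h := DFunLike.congr_fun hxy e
      have : y e = 0 := by
        by_contra hye
        exact heF (hy (Finsupp.mem_support_iff.2 hye))
      simp only [Finsupp.coe_add, Pi.add_apply, Finsupp.single_eq_same] at h
      omega
  rw [hcs]
  rcases (hd F hF).eq_or_lt with hFd | hFd
  · refine ⟨Fᶜ ::ₘ ms, ?_, ?_, ?_⟩
    · intro D hD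
      rcases Multiset.mem_cons.1 hD with rfl | hD
      · exact ⟨hFd.symm, by rwa [compl_compl]⟩
      · exact ⟨(h1 D hD).1, (h1 D hD).2.trans hsub⟩
    · intro D hD hD'
      rw [Multiset.mem_cons]
      exact (hcases D hD hD').imp id (h2 D hD)
    · rw [Multiset.map_cons, Multiset.sum_cons]
      exact (hFd ▸ hasLead_cone m F).add h3
  · refine ⟨ms, fun D hD => ⟨(h1 D hD).1, (h1 D hD).2.trans hsub⟩, ?_, ?_⟩
    · intro D hD hD'
      refine h2 D hD ((hcases D hD hD').resolve_left ?_)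
      rintro rfl
      omega
    · have := ((hasLead_cone m F).of_lt hFd).add h3
      rwa [zero_add] at this

end SchubertSupport

namespace SchubertSupport

variable {p : ℕ}

/-! ### Relative dimensions -/

/-- The dimension of `V` modulo `N`. -/
noncomputable def relDim {A : Type*} [AddCommGroup A] [Module ℚ A] (V N : Submodule ℚ A) : ℤ :=
  (Module.finrank ℚ V : ℤ) - Module.finrank ℚ ↥(V ⊓ N)

lemma finrank_eq_add_map {A B : Type*} [AddCommGroup A] [Module ℚ A] [AddCommGroup B] [Module ℚ B]
    (V : Submodule ℚ A) [Module.Finite ℚ V] (φ : A →ₗ[ℚ] B) :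
    Module.finrank ℚ V =
      Module.finrank ℚ ↥(V ⊓ LinearMap.ker φ) + Module.finrank ℚ ↥(V.map φ) := by
  have h := (φ.domRestrict V).finrank_range_add_finrank_ker
  rw [← h, add_comm, LinearMap.range_domRestrict]
  congr 1
  rw [LinearMap.ker_domRestrict]
  have := (Submodule.equivMapOfInjective V.subtype V.injective_subtype
    ((LinearMap.ker φ).comap V.subtype)).finrank_eq
  rw [Submodule.map_comap_subtype] at this
  exact this

lemma relDim_eq_add_map {A B : Type*} [AddCommGroup A] [Module ℚ A] [AddCommGroup B] [Module ℚ B]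
    (V N : Submodule ℚ A) [Module.Finite ℚ V] (φ : A →ₗ[ℚ] B) (J : Submodule ℚ B)
    (hJ : (V ⊓ N).map φ = V.map φ ⊓ J) :
    relDim V N = relDim (V ⊓ LinearMap.ker φ) N + relDim (V.map φ) J := by
  have : Module.Finite ℚ ↥(V ⊓ N) := Submodule.finiteDimensional_inf_left V N
  have h1 := finrank_eq_add_map V φ
  have h2 := finrank_eq_add_map (V ⊓ N) φ
  rw [hJ, inf_right_comm] at h2
  unfold relDim
  rw [h1, h2]
  push_cast
  ring

lemma relDim_map {A B : Type*} [AddCommGroup A] [Module ℚ A] [AddCommGroup B] [Module ℚ B]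
    (V N : Submodule ℚ A) (φ : A →ₗ[ℚ] B) (hφ : Function.Injective φ) (N' : Submodule ℚ B)
    (h : N'.comap φ = N) : relDim (V.map φ) N' = relDim V N := by
  unfold relDim
  subst h
  rw [← (Submodule.equivMapOfInjective φ hφ V).finrank_eq,
    (Submodule.equivMapOfInjective φ hφ (V ⊓ N'.comap φ)).finrank_eq]
  have : (V ⊓ N'.comap φ).map φ = V.map φ ⊓ N' :=
    SetLike.coe_injective (Set.image_inter_preimage φ V N')
  rw [this]

/-! ### Multigraded Hilbert functions -/

/-- The coordinate ring of `p × p` matrices. -/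
abbrev MatRing (p : ℕ) := MvPolynomial (Cell p) ℚ

/-- The integral weight of a cell. -/
noncomputable def wt (e : Cell p) : Lab p → ℤ := fun v => (cellWeight e v : ℤ)

/-- The integral vector underlying a vector of natural numbers. -/
def toInt (n : Lab p →₀ ℕ) : Lab p → ℤ := fun v => (n v : ℤ)

lemma toInt_injective : Function.Injective (toInt : (Lab p →₀ ℕ) → (Lab p → ℤ)) := by
  intro a b h
  ext v
  exact Int.ofNat_inj.1 (congrFun h v)

lemma weight_wt (x : Cell p →₀ ℕ) : Finsupp.weight wt x = toInt (mdeg x) := by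
  induction x using Finsupp.induction_linear with
  | zero => ext; simp [toInt]
  | add f g hf hg => rw [map_add, hf, hg, map_add]; ext; simp [toInt]
  | single e k =>
    rw [mdeg_single, Finsupp.weight_single]
    ext v
    simp [toInt, wt]

/-- The homogeneous polynomials of multidegree `n`. -/
noncomputable abbrev gradedPiece (n : Lab p → ℤ) : Submodule ℚ (MatRing p) :=
  weightedHomogeneousSubmodule ℚ wt n

/-- The homogeneous component of multidegree `n`. -/
noncomputable abbrev comp (n : Lab p → ℤ) : MatRing p →ₗ[ℚ] MatRing p :=
  weightedHomogeneousComponent wt n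

/-- Multihomogeneous ideals. -/
def IsMultihomog (J : Ideal (MatRing p)) : Prop := ∀ f ∈ J, ∀ n, comp n f ∈ J

lemma mem_gradedPiece_iff {f : MatRing p} {n : Lab p → ℤ} :
    f ∈ gradedPiece n ↔ ∀ x ∈ f.support, toInt (mdeg x) = n := by
  simp only [mem_weightedHomogeneousSubmodule, IsWeightedHomogeneous, weight_wt, mem_support_iff]

/-- The Hilbert function of the quotient by `J`. -/
noncomputable def hilb (J : Ideal (MatRing p)) (n : Lab p → ℤ) : ℤ :=
  relDim (gradedPiece n) (J.restrictScalars ℚ)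

/-- The Hilbert series of the quotient by `J`. -/
noncomputable def hilbSeries (J : Ideal (MatRing p)) : MvPowerSeries (Lab p) ℤ :=
  fun n => hilb J (toInt n)

lemma coeff_hilbSeries (J : Ideal (MatRing p)) (n : Lab p →₀ ℕ) :
    MvPowerSeries.coeff n (hilbSeries J) = hilb J (toInt n) := rfl

lemma gradedPiece_eq_bot {n : Lab p → ℤ} {v : Lab p} (hv : n v < 0) : gradedPiece n = ⊥ := by
  rw [eq_bot_iff]
  intro f hf
  rw [mem_gradedPiece_iff] at hf
  rw [Submodule.mem_bot, ← support_eq_empty, Finset.eq_empty_iff_forall_notMem]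
  intro x hx
  have := congrFun (hf x hx) v
  simp only [toInt] at this
  omega

lemma hilb_eq_zero (J : Ideal (MatRing p)) {n : Lab p → ℤ} {v : Lab p} (hv : n v < 0) :
    hilb J n = 0 := by
  rw [hilb, gradedPiece_eq_bot hv, relDim, bot_inf_eq]
  simp

variable (m : MonomialOrder (Cell p))

/-- Bound on the monomials occurring in a graded piece. -/
lemma finite_toInt_fiber (n : Lab p → ℤ) : {x : Cell p →₀ ℕ | toInt (mdeg x) = n}.Finite := by
  by_cases h : ∃ k : Lab p →₀ ℕ, toInt k = n
  · obtain ⟨k, rfl⟩ := h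
    exact (finite_mdeg_fiber k).subset fun x hx => toInt_injective hx
  · convert Set.finite_empty
    ext x
    simp only [Set.mem_ofPred_eq, Set.mem_empty_iff_false, iff_false]
    exact fun hx => h ⟨_, hx⟩

instance (n : Lab p → ℤ) : Module.Finite ℚ (gradedPiece n) := by
  have := (finite_toInt_fiber n).fintype
  let φ : gradedPiece n →ₗ[ℚ] ({x : Cell p →₀ ℕ | toInt (mdeg x) = n} → ℚ) :=
    LinearMap.pi fun x => (lcoeff ℚ (x : Cell p →₀ ℕ)).comp (gradedPiece n).subtype
  refine Module.Finite.of_injective φ ?_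
  rw [injective_iff_map_eq_zero]
  rintro ⟨f, hf⟩ h
  rw [mem_gradedPiece_iff] at hf
  refine Subtype.ext (MvPolynomial.ext _ _ fun x => ?_)
  by_contra hx
  exact hx (congrFun h ⟨x, hf x (mem_support_iff.2 hx)⟩)

/-- The dimension of a space of polynomials is the number of its leading monomials. -/
lemma finrank_eq_ncard_degree (W : Submodule ℚ (MatRing p)) [Module.Finite ℚ W] :
    Module.finrank ℚ W = {x | ∃ f ∈ W, f ≠ 0 ∧ m.degree f = x}.ncard := by
  classical
  set S : Set (Cell p →₀ ℕ) := {x | ∃ f ∈ W, f ≠ 0 ∧ m.degree f = x} with hS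
  choose f hfW hf0 hfd using fun x : S => x.2
  have hli : LinearIndependent ℚ fun x : S => (⟨f x, hfW x⟩ : W) := by
    rw [← LinearMap.linearIndependent_iff W.subtype (by simp)]
    rw [linearIndependent_iff']
    intro s g hg
    by_contra! hne
    obtain ⟨i, his, hi⟩ := hne
    obtain ⟨y, hy, hmax⟩ := Finset.exists_max_image (s.filter fun i => g i ≠ 0)
      (fun x => m.toSyn (x : Cell p →₀ ℕ)) ⟨i, by simp [his, hi]⟩
    rw [Finset.mem_filter] at hy
    have hc := congrArg (coeff (y : Cell p →₀ ℕ)) hg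
    simp only [Function.comp_apply, Submodule.subtype_apply, coeff_sum, coeff_smul,
      coeff_zero] at hc
    rw [Finset.sum_eq_single_of_mem y hy.1] at hc
    · rw [smul_eq_mul] at hc
      rcases mul_eq_zero.1 hc with h | h
      · exact hy.2 h
      · nth_rewrite 1 [← hfd y] at h
        exact hf0 y ((m.coeff_degree_eq_zero_iff).1 h)
    · intro z hz hzy
      by_cases hgz : g z = 0
      · rw [hgz, zero_smul]
      · have := hmax z (by simp [hz, hgz])
        rw [m.coeff_eq_zero_of_lt, smul_zero]
        rw [hfd z]
        refine lt_of_le_of_ne this fun h => hzy (Subtype.ext (m.toSyn.injective h))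
  have hfin : Finite S := hli.finite
  have := Fintype.ofFinite S
  rw [← Nat.card_coe_set_eq, Nat.card_eq_fintype_card]
  refine le_antisymm ?_ hli.fintype_card_le_finrank
  let φ : W →ₗ[ℚ] (S → ℚ) := LinearMap.pi fun x => (lcoeff ℚ (x : Cell p →₀ ℕ)).comp W.subtype
  have hφ : Function.Injective φ := by
    rw [injective_iff_map_eq_zero]
    rintro ⟨g, hg⟩ h
    by_contra hne
    have hg0 : g ≠ 0 := fun h => hne (Subtype.ext h)
    have := congrFun h ⟨m.degree g, g, hg, hg0, rfl⟩
    exact m.coeff_degree_ne_zero_iff.2 hg0 this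
  simpa using LinearMap.finrank_le_finrank_of_injective hφ

/-- The standard monomials of an ideal. -/
def stdMonomials (J : Ideal (MatRing p)) : LowerSet (Cell p →₀ ℕ) where
  carrier := {x | ∀ f ∈ J, f ≠ 0 → m.degree f ≠ x}
  lower' := by
    intro x y hyx hx f hf hf0 hfy
    obtain ⟨z, rfl⟩ := exists_add_of_le hyx
    have hz : (monomial z (1 : ℚ)) ≠ 0 := by simp
    classical
    refine hx (monomial z 1 * f) (J.mul_mem_left _ hf) (mul_ne_zero hz hf0) ?_
    rw [m.degree_mul hz hf0, m.degree_monomial, if_neg one_ne_zero, hfy, add_comm]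

lemma mem_stdMonomials {J : Ideal (MatRing p)} {x : Cell p →₀ ℕ} :
    x ∈ stdMonomials m J ↔ ∀ f ∈ J, f ≠ 0 → m.degree f ≠ x := Iff.rfl

lemma hilbSeries_eq_countSeries {J : Ideal (MatRing p)} (hJ : IsMultihomog J) :
    hilbSeries J = countSeries (stdMonomials m J : Set (Cell p →₀ ℕ)) := by
  classical
  ext n
  rw [coeff_hilbSeries, coeff_countSeries, hilb, relDim]
  have hfin : Module.Finite ℚ ↥(gradedPiece (toInt n) ⊓ J.restrictScalars ℚ) :=
    Submodule.finiteDimensional_inf_left _ _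
  rw [finrank_eq_ncard_degree m, finrank_eq_ncard_degree m, sub_eq_iff_eq_add, ← Nat.cast_add,
    ← Set.ncard_union_eq ?_ ((finite_mdeg_fiber n).subset fun x hx => hx.2) ?_]
  · congr 2
    ext x
    simp only [Set.mem_ofPred_eq, Set.mem_union, Submodule.mem_inf, Submodule.restrictScalars_mem]
    constructor
    · rintro ⟨f, hf, hf0, rfl⟩
      have h1 : mdeg (m.degree f) = n :=
        toInt_injective (mem_gradedPiece_iff.1 hf _ (m.degree_mem_support hf0))
      by_cases hx : m.degree f ∈ stdMonomials m J
      · exact Or.inl ⟨hx, h1⟩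
      · right
        rw [mem_stdMonomials] at hx
        push Not at hx
        obtain ⟨g, hg, hg0, hgf⟩ := hx
        have hc : coeff (m.degree f) (comp (toInt n) g) = coeff (m.degree f) g := by
          rw [comp, coeff_weightedHomogeneousComponent, weight_wt, h1, if_pos rfl]
        have hc0 : coeff (m.degree f) (comp (toInt n) g) ≠ 0 := by
          rw [hc, ← hgf]
          exact m.coeff_degree_ne_zero_iff.2 hg0
        have hne : comp (toInt n) g ≠ 0 := fun h => hc0 (by rw [h, coeff_zero])
        refine ⟨comp (toInt n) g, ⟨weightedHomogeneousComponent_mem _ _ _, hJ g hg _⟩, hne, ?_⟩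
        refine m.toSyn.injective (le_antisymm ?_ (m.le_degree (mem_support_iff.2 hc0)))
        rw [← hgf]
        refine m.le_degree ?_
        have h2 := m.degree_mem_support hne
        rw [mem_support_iff, comp, coeff_weightedHomogeneousComponent] at h2
        rw [mem_support_iff]
        intro h3
        apply h2
        rw [h3, ite_self]
    · rintro (⟨hx, rfl⟩ | ⟨f, ⟨hf, -⟩, hf0, hfx⟩)
      · refine ⟨monomial x 1, ?_, by simp, by rw [m.degree_monomial, if_neg one_ne_zero]⟩
        rw [mem_gradedPiece_iff]
        intro y hy
        rw [Finset.mem_singleton.1 (support_monomial_subset hy)]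
      · exact ⟨f, hf, hf0, hfx⟩
  · rw [Set.disjoint_left]
    rintro x ⟨hx, -⟩ ⟨f, ⟨-, hf⟩, hf0, hfx⟩
    exact hx f hf hf0 hfx
  · refine (finite_mdeg_fiber n).subset ?_
    rintro _ ⟨f, ⟨hf, -⟩, hf0, rfl⟩
    exact toInt_injective (mem_gradedPiece_iff.1 hf _ (m.degree_mem_support hf0))

/-! ### Independent sets of variables -/

/-- The cells of `F` are algebraically independent modulo `J`. -/
def IndepMod (J : Ideal (MatRing p)) (F : Finset (Cell p)) : Prop :=
  ∀ f ∈ J, f.vars ⊆ F → f = 0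

lemma mem_face_of_vars_subset {f : MatRing p} {F : Finset (Cell p)} (h : f.vars ⊆ F)
    {x : Cell p →₀ ℕ} (hx : x ∈ f.support) : x ∈ face F := fun e he =>
  h (by rw [mem_vars_iff_mem_support]; exact ⟨x, hx, he⟩)

lemma indepMod_of_face_subset {J : Ideal (MatRing p)} {F : Finset (Cell p)}
    (h : face F ⊆ (stdMonomials m J : Set (Cell p →₀ ℕ))) : IndepMod J F := by
  intro f hf hF
  by_contra hf0
  exact h (mem_face_of_vars_subset hF (m.degree_mem_support hf0)) f hf hf0 rfl

lemma exists_linearOrder (F : Finset (Cell p)) :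
    ∃ O : LinearOrder (Cell p), ∀ a b, a ∉ F → b ∈ F → O.lt a b := by
  classical
  let key : Cell p → ℕ ×ₗ (Fin p ×ₗ Fin p) := fun e => toLex (if e ∈ F then 1 else 0, toLex e)
  have hkey : Function.Injective key := fun a b hab => by
    have := congrArg (fun x => (ofLex x).2) hab
    exact toLex.injective this
  refine ⟨LinearOrder.lift' key hkey, fun a b ha hb => ?_⟩
  change key a < key b
  rw [Prod.Lex.lt_iff]
  left
  simp [key, ha, hb]

lemma exists_face_subset {J : Ideal (MatRing p)} {F : Finset (Cell p)} (h : IndepMod J F) :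
    ∃ m : MonomialOrder.{0, 0} (Cell p), face F ⊆ (stdMonomials m J : Set (Cell p →₀ ℕ)) := by
  obtain ⟨O, hlt⟩ := exists_linearOrder F
  have : @WellFoundedGT (Cell p) O.toLT := @Finite.to_wellFoundedGT _ _ O.toPreorder
  refine ⟨MonomialOrder.lex, fun x hx f hf hf0 hfx => ?_⟩
  refine hf0 (h f hf fun e he => ?_)
  obtain ⟨y, hy, hye⟩ := (mem_vars_iff_mem_support _).1 he
  by_contra heF
  have hxe : x e = 0 := by
    by_contra hne
    exact heF (hx (Finsupp.mem_support_iff.2 hne))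
  have hle := (MonomialOrder.lex (σ := Cell p)).le_degree hy
  rw [hfx, MonomialOrder.lex_le_iff] at hle
  rcases hle.eq_or_lt with heq | hl
  · rw [toLex.injective heq] at hye
    exact Finsupp.mem_support_iff.1 hye hxe
  · obtain ⟨i, hi, hi'⟩ := (@Finsupp.Lex.lt_iff (Cell p) ℕ _ O.toLT _ _ _).1 hl
    have hiF : i ∈ F := hx (Finsupp.mem_support_iff.2 (Nat.ne_zero_of_lt hi'))
    have h3 : y e = x e := hi e (hlt e i heF hiF)
    exact Finsupp.mem_support_iff.1 hye (h3.trans hxe)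

end SchubertSupport

namespace SchubertSupport

variable {p : ℕ}

/-! ### The algebraic matroid of a prime ideal -/

/-- The coordinate functions on the quotient by `P`. -/
noncomputable def coord (P : Ideal (MatRing p)) (e : Cell p) : MatRing p ⧸ P :=
  Ideal.Quotient.mk P (X e)

lemma aeval_coord (P : Ideal (MatRing p)) (f : MatRing p) :
    aeval (coord P) f = Ideal.Quotient.mk P f := by
  have : (aeval (coord P) : MatRing p →ₐ[ℚ] MatRing p ⧸ P) = Ideal.Quotient.mkₐ ℚ P := by
    ext e
    simp [coord]
  rw [this]
  rfl

/-- The algebraic matroid of the coordinates modulo a prime ideal. -/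
noncomputable def primeMatroid (P : Ideal (MatRing p)) [P.IsPrime] : Matroid (Cell p) :=
  (AlgebraicIndependent.matroid ℚ (MatRing p ⧸ P)).comap (coord P)

variable {P : Ideal (MatRing p)} [hP : P.IsPrime]

lemma primeMatroid_ground : (primeMatroid P).E = Set.univ := by
  simp [primeMatroid]

lemma indepMod_iff (F : Finset (Cell p)) :
    IndepMod P F ↔ (primeMatroid P).Indep (F : Set (Cell p)) := by
  have h1 : (primeMatroid P).Indep (F : Set (Cell p)) ↔
      AlgebraicIndependent ℚ (fun e : (F : Set (Cell p)) => coord P e) := by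
    rw [primeMatroid, Matroid.comap_indep_iff, AlgebraicIndependent.matroid_indep_iff]
    constructor
    · rintro ⟨h, hinj⟩
      exact (algebraicIndependent_image hinj).2 h
    · intro h
      have hinj : Set.InjOn (coord P) (F : Set (Cell p)) :=
        Set.injOn_iff_injective.2 h.injective
      exact ⟨(algebraicIndependent_image hinj).1 h, hinj⟩
  rw [h1, algebraicIndependent_iff]
  have h2 : ∀ q : MvPolynomial (F : Set (Cell p)) ℚ,
      aeval (fun e : (F : Set (Cell p)) => coord P e) q = Ideal.Quotient.mk P (rename (↑) q) := by
    intro q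
    rw [← aeval_coord, aeval_rename]
    rfl
  constructor
  · intro h q hq
    rw [h2, Ideal.Quotient.eq_zero_iff_mem] at hq
    have := h _ hq (by
      classical
      refine (vars_rename _ _).trans ?_
      intro e he
      obtain ⟨a, -, rfl⟩ := Finset.mem_image.1 he
      exact a.2)
    exact rename_injective _ Subtype.val_injective (by rw [this, map_zero])
  · intro h f hf hF
    obtain ⟨q, rfl⟩ := exists_rename_eq_of_vars_subset_range f
      (Subtype.val : ↥(F : Set (Cell p)) → Cell p) Subtype.val_injective (by
        rw [Subtype.range_coe]; exact_mod_cast hF)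
    rw [h q (by rw [h2, Ideal.Quotient.eq_zero_iff_mem]; exact hf), map_zero]

lemma exists_base_finset (P : Ideal (MatRing p)) [P.IsPrime] :
    ∃ F : Finset (Cell p), (primeMatroid P).IsBase (F : Set (Cell p)) := by
  obtain ⟨B, hB⟩ := (primeMatroid P).exists_isBase
  exact ⟨B.toFinite.toFinset, by rwa [Set.Finite.coe_toFinset]⟩

lemma card_le_of_indep {F B : Finset (Cell p)} (hF : (primeMatroid P).Indep (F : Set (Cell p)))
    (hB : (primeMatroid P).IsBase (B : Set (Cell p))) : F.card ≤ B.card := by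
  obtain ⟨B', hB', hFB⟩ := hF.exists_isBase_superset
  have := hB'.ncard_eq_ncard_of_isBase hB
  rw [Set.ncard_coe_finset] at this
  rw [← this, ← Set.ncard_coe_finset]
  exact Set.ncard_le_ncard hFB B'.toFinite

lemma isBase_of_indep_card {F B : Finset (Cell p)} (hF : (primeMatroid P).Indep (F : Set (Cell p)))
    (hB : (primeMatroid P).IsBase (B : Set (Cell p))) (h : B.card ≤ F.card) :
    (primeMatroid P).IsBase (F : Set (Cell p)) := by
  obtain ⟨B', hB', hFB⟩ := hF.exists_isBase_superset
  have := hB'.ncard_eq_ncard_of_isBase hB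
  rw [Set.ncard_coe_finset] at this
  have : (F : Set (Cell p)) = B' := by
    refine Set.eq_of_subset_of_ncard_le hFB ?_ B'.toFinite
    rw [this, Set.ncard_coe_finset]
    exact h
  rwa [this]

lemma card_compl_le_iff (F B : Finset (Cell p)) : Fᶜ.card ≤ Bᶜ.card ↔ B.card ≤ F.card := by
  have h1 := F.card_add_card_compl
  have h2 := B.card_add_card_compl
  omega

/-- The leading form of the Hilbert series of a prime ideal, in terms of bases of its matroid. -/
lemma hasLead_prime (hhom : IsMultihomog P) {B : Finset (Cell p)}
    (hB : (primeMatroid P).IsBase (B : Set (Cell p))) :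
    ∃ ms : Multiset (Finset (Cell p)),
      (∀ D ∈ ms, (primeMatroid P).IsBase ((Dᶜ : Finset (Cell p)) : Set (Cell p))) ∧ Bᶜ ∈ ms ∧
      HasLead (hilbSeries P) Bᶜ.card (ms.map cellsForm).sum := by
  obtain ⟨m, hm⟩ := exists_face_subset ((indepMod_iff B).2 hB.indep)
  obtain ⟨ms, h1, h2, h3⟩ := hasLead_lowerSet Bᶜ.card (stdMonomials m P) fun F hF => by
    rw [ge_iff_le, card_compl_le_iff]
    exact card_le_of_indep ((indepMod_iff F).1 (indepMod_of_face_subset m hF)) hB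
  refine ⟨ms, fun D hD => ?_, h2 _ rfl (by rwa [compl_compl]), ?_⟩
  · obtain ⟨hc, hf⟩ := h1 D hD
    refine isBase_of_indep_card ((indepMod_iff _).1 (indepMod_of_face_subset m hf)) hB ?_
    rw [← card_compl_le_iff, compl_compl, hc]
  · rwa [hilbSeries_eq_countSeries m hhom]

lemma mem_adjoin_coord_image {J : Ideal (MatRing p)} {F : Finset (Cell p)} {r : MatRing p ⧸ J}
    (hr : r ∈ Algebra.adjoin ℚ (coord J '' F)) :
    ∃ h : MatRing p, h.vars ⊆ F ∧ Ideal.Quotient.mk J h = r := by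
  rw [Set.image_eq_range, Algebra.adjoin_range_eq_range_aeval] at hr
  obtain ⟨q, rfl⟩ := hr
  refine ⟨rename (↑) q, ?_, ?_⟩
  · classical
    refine (vars_rename _ _).trans ?_
    intro e he
    obtain ⟨a, -, rfl⟩ := Finset.mem_image.1 he
    exact a.2
  · rw [← aeval_coord, aeval_rename]
    rfl

lemma not_indepMod_of_lt {J : Ideal (MatRing p)} (hPJ : P < J) {B : Finset (Cell p)}
    (hB : (primeMatroid P).IsBase (B : Set (Cell p))) : ¬ IndepMod J B := by
  intro hJ
  obtain ⟨g, hgJ, hgP⟩ := Set.exists_of_ssubset hPJ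
  have hspan : ∀ a : MatRing p ⧸ P, IsAlgebraic (Algebra.adjoin ℚ (coord P '' B)) a := by
    have hb := ((Matroid.comap_isBase_iff).1 hB).1
    simp only [AlgebraicIndependent.matroid_e, Set.preimage_univ, Set.image_univ] at hb
    rw [AlgebraicIndependent.matroid_isBasis_iff] at hb
    intro a
    obtain ⟨f, rfl⟩ := Ideal.Quotient.mk_surjective a
    induction f using MvPolynomial.induction_on with
    | C c =>
      exact isAlgebraic_algebraMap (algebraMap ℚ (Algebra.adjoin ℚ (coord P '' B)) c)
    | add f g hf hg => rw [map_add]; exact hf.add hg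
    | mul_X f e hf => rw [map_mul]; exact hf.mul (hb.2.2 (coord P e) ⟨e, rfl⟩)
  have hg0 : Ideal.Quotient.mk P g ≠ 0 := fun h => hgP (Ideal.Quotient.eq_zero_iff_mem.1 h)
  obtain ⟨r, hr0, hr⟩ := (hspan (Ideal.Quotient.mk P g)).exists_nonzero_dvd
    (mem_nonZeroDivisors_of_ne_zero hg0)
  obtain ⟨h, hF, hh⟩ := mem_adjoin_coord_image r.2
  have hr' : Ideal.Quotient.mk P g ∣ Ideal.Quotient.mk P h := by rw [hh]; exact hr
  obtain ⟨q, hq⟩ := hr'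
  obtain ⟨q, rfl⟩ := Ideal.Quotient.mk_surjective q
  rw [← map_mul, Ideal.Quotient.eq] at hq
  have hhJ : h ∈ J := by
    have := J.add_mem (hPJ.le hq) (J.mul_mem_right q hgJ)
    rwa [sub_add_cancel] at this
  have := hJ h hhJ hF
  apply hr0
  refine Subtype.ext ?_
  rw [← hh, this, map_zero]
  rfl

/-- Ideals strictly larger than a prime ideal have vanishing leading form. -/
lemma hasLead_of_lt {J : Ideal (MatRing p)} (hhom : IsMultihomog J) (hPJ : P < J)
    {B : Finset (Cell p)} (hB : (primeMatroid P).IsBase (B : Set (Cell p))) :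
    HasLead (hilbSeries J) Bᶜ.card 0 := by
  obtain ⟨m, -⟩ := exists_face_subset ((indepMod_iff B).2 hB.indep)
  obtain ⟨ms, -, -, h3⟩ := hasLead_lowerSet (Bᶜ.card + 1) (stdMonomials m J) fun F hF => by
    by_contra! hlt
    have hFJ := indepMod_of_face_subset m hF
    have hFP : (primeMatroid P).Indep (F : Set (Cell p)) :=
      (indepMod_iff F).1 fun f hf => hFJ f (hPJ.le hf)
    refine not_indepMod_of_lt hPJ (isBase_of_indep_card hFP hB ?_) hFJ
    rw [← card_compl_le_iff]
    omega
  rw [hilbSeries_eq_countSeries m hhom]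
  exact h3.of_lt (Nat.lt_succ_self _)

end SchubertSupport

namespace SchubertSupport

variable {p : ℕ}

/-! ### Row operations -/

/-- Add `c` times row `b` to row `a`. -/
def rowAdd {A : Type*} [Ring A] (a b : Fin p) (c : A) (Z : Cell p → A) : Cell p → A :=
  fun e => if e.1 = a then Z e + c * Z (b, e.2) else Z e

/-- The generic row operation `row a += T • row b`. -/
noncomputable def sweep (a b : Fin p) : MatRing p →ₐ[ℚ] Polynomial (MatRing p) :=
  aeval (rowAdd a b Polynomial.X fun e => Polynomial.C (X e))

/-- The generic row operation, with the parameter adjoined to the source. -/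
noncomputable def sweepPoly (a b : Fin p) : Polynomial (MatRing p) →+* Polynomial (MatRing p) :=
  Polynomial.eval₂RingHom (sweep a b : MatRing p →+* Polynomial (MatRing p)) Polynomial.X

lemma sweepPoly_C (a b : Fin p) (f : MatRing p) : sweepPoly a b (Polynomial.C f) = sweep a b f := by
  simp [sweepPoly]

lemma sweepPoly_X (a b : Fin p) : sweepPoly a b Polynomial.X = Polynomial.X := by
  simp [sweepPoly]

/-! ### The grading of polynomials over the matrix ring -/

/-- The degree of the parameter of the row operation `row a += T • row b`. -/
noncomputable def rootDeg (a b : Fin p) : Lab p → ℤ :=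
  Pi.single (Sum.inl a) 1 - Pi.single (Sum.inl b) 1

/-- Homogeneity of degree `n` when the parameter has degree `δ`. -/
def HomPoly (δ n : Lab p → ℤ) (F : Polynomial (MatRing p)) : Prop :=
  ∀ k, F.coeff k ∈ gradedPiece (n - k • δ)

namespace HomPoly

variable {δ n n' : Lab p → ℤ} {F G : Polynomial (MatRing p)}

lemma zero : HomPoly δ n 0 := fun k => by
  rw [Polynomial.coeff_zero]; exact Submodule.zero_mem _

lemma add (hF : HomPoly δ n F) (hG : HomPoly δ n G) : HomPoly δ n (F + G) := fun k => by
  rw [Polynomial.coeff_add]; exact Submodule.add_mem _ (hF k) (hG k)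

lemma mul (hF : HomPoly δ n F) (hG : HomPoly δ n' G) : HomPoly δ (n + n') (F * G) := fun k => by
  rw [Polynomial.coeff_mul]
  refine Submodule.sum_mem _ fun x hx => ?_
  have h := IsWeightedHomogeneous.mul (hF x.1) (hG x.2)
  rw [Finset.HasAntidiagonal.mem_antidiagonal] at hx
  have : n - x.1 • δ + (n' - x.2 • δ) = n + n' - k • δ := by
    rw [← hx, add_smul]; abel
  rwa [this] at h

lemma C {f : MatRing p} (hf : f ∈ gradedPiece n) : HomPoly δ n (Polynomial.C f) := fun k => by
  rw [Polynomial.coeff_C]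
  split_ifs with h
  · rwa [h, zero_smul, sub_zero]
  · exact Submodule.zero_mem _

lemma X : HomPoly δ δ (Polynomial.X : Polynomial (MatRing p)) := fun k => by
  rw [Polynomial.coeff_X]
  split_ifs with h
  · rw [← h, one_smul, sub_self]
    exact isWeightedHomogeneous_one ℚ _
  · exact Submodule.zero_mem _

lemma one : HomPoly δ 0 (1 : Polynomial (MatRing p)) := by
  rw [← Polynomial.C_1]
  exact C (isWeightedHomogeneous_one ℚ _)

lemma pow (hF : HomPoly δ n F) (k : ℕ) : HomPoly δ (k • n) (F ^ k) := by
  induction k with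
  | zero => simpa using one
  | succ k ih => rw [pow_succ, succ_nsmul]; exact ih.mul hF

lemma prod {ι : Type*} (s : Finset ι) (f : ι → Polynomial (MatRing p)) (m : ι → Lab p → ℤ)
    (h : ∀ i ∈ s, HomPoly δ (m i) (f i)) : HomPoly δ (∑ i ∈ s, m i) (∏ i ∈ s, f i) := by
  classical
  induction s using Finset.induction_on with
  | empty => simpa using one
  | insert i s hi ih =>
    rw [Finset.prod_insert hi, Finset.sum_insert hi]
    exact (h i (by simp)).mul (ih fun j hj => h j (by simp [hj]))

end HomPoly

lemma X_mem_gradedPiece (e : Cell p) : (X e : MatRing p) ∈ gradedPiece (wt e) :=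
  isWeightedHomogeneous_X ℚ wt e

lemma wt_apply_row (a : Fin p) (j : Fin p) : wt (a, j) =
    Pi.single (Sum.inl a) 1 + Pi.single (Sum.inr j) 1 := by
  ext v
  simp only [wt, cellWeight, Finsupp.coe_add, Pi.add_apply, Nat.cast_add, Finsupp.single_apply,
    Pi.single_apply]
  simp [eq_comm]

lemma homPoly_rowAdd (a b : Fin p) (e : Cell p) :
    HomPoly (rootDeg a b) (wt e) (rowAdd a b Polynomial.X (fun e => Polynomial.C (X e)) e) := by
  unfold rowAdd
  split_ifs with h
  · refine (HomPoly.C (X_mem_gradedPiece e)).add ?_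
    have := (HomPoly.X (δ := rootDeg a b)).mul
      (HomPoly.C (δ := rootDeg a b) (X_mem_gradedPiece (b, e.2)))
    convert this using 1
    obtain ⟨e1, e2⟩ := e
    simp only at h
    subst h
    rw [wt_apply_row, wt_apply_row, rootDeg]
    abel
  · exact HomPoly.C (X_mem_gradedPiece e)

lemma homPoly_sweep_monomial (a b : Fin p) (x : Cell p →₀ ℕ) (c : ℚ) :
    HomPoly (rootDeg a b) (Finsupp.weight wt x) (sweep a b (monomial x c)) := by
  rw [sweep, aeval_monomial]
  have h1 : HomPoly (rootDeg a b) 0 (algebraMap ℚ (Polynomial (MatRing p)) c) := by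
    rw [IsScalarTower.algebraMap_apply ℚ (MatRing p) (Polynomial (MatRing p)),
      Polynomial.algebraMap_eq]
    exact HomPoly.C (isWeightedHomogeneous_C wt c)
  have h2 := HomPoly.prod x.support _ _ fun e _ => (homPoly_rowAdd a b e).pow (x e)
  have h3 := h1.mul h2
  rw [zero_add] at h3
  exact h3

/-- The homogeneous component of degree `n` when the parameter has degree `δ`. -/
noncomputable def polyComp (δ n : Lab p → ℤ) (F : Polynomial (MatRing p)) :
    Polynomial (MatRing p) :=
  ∑ k ∈ F.support, Polynomial.monomial k (comp (n - k • δ) (F.coeff k))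

lemma coeff_polyComp (δ n : Lab p → ℤ) (F : Polynomial (MatRing p)) (k : ℕ) :
    (polyComp δ n F).coeff k = comp (n - k • δ) (F.coeff k) := by
  classical
  rw [polyComp, Polynomial.finsetSum_coeff]
  simp only [Polynomial.coeff_monomial]
  rw [Finset.sum_ite_eq']
  split_ifs with h
  · rfl
  · rw [Polynomial.notMem_support_iff.1 h, map_zero]

lemma homPoly_polyComp (δ n : Lab p → ℤ) (F : Polynomial (MatRing p)) :
    HomPoly δ n (polyComp δ n F) := fun k => by
  rw [coeff_polyComp]
  exact weightedHomogeneousComponent_mem _ _ _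

lemma polyComp_add (δ n : Lab p → ℤ) (F G : Polynomial (MatRing p)) :
    polyComp δ n (F + G) = polyComp δ n F + polyComp δ n G := by
  ext1 k
  simp only [coeff_polyComp, Polynomial.coeff_add, map_add]

lemma polyComp_of_homPoly {δ n m : Lab p → ℤ} {F : Polynomial (MatRing p)} (hF : HomPoly δ m F) :
    polyComp δ n F = if m = n then F else 0 := by
  split_ifs with h
  · subst h
    ext1 k
    rw [coeff_polyComp]
    exact IsWeightedHomogeneous.weightedHomogeneousComponent_same (hF k)
  · ext1 k
    rw [coeff_polyComp, Polynomial.coeff_zero]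
    exact IsWeightedHomogeneous.weightedHomogeneousComponent_ne _ (hF k)
      fun h' => h (sub_left_injective h').symm

lemma sweepPoly_polyComp (a b : Fin p) (n : Lab p → ℤ) (F : Polynomial (MatRing p)) :
    sweepPoly a b (polyComp (rootDeg a b) n F) = polyComp (rootDeg a b) n (sweepPoly a b F) := by
  induction F using Polynomial.induction_on' with
  | add F G hF hG => rw [polyComp_add, map_add, hF, hG, map_add, polyComp_add]
  | monomial k f =>
    induction f using MvPolynomial.induction_on' with
    | add f g hf hg => rw [map_add (Polynomial.monomial k), polyComp_add, map_add, hf, hg, map_add,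
        polyComp_add]
    | monomial x c =>
      have h1 : HomPoly (rootDeg a b) (Finsupp.weight wt x + k • rootDeg a b)
          (Polynomial.monomial k (monomial x c)) := by
        rw [← Polynomial.C_mul_X_pow_eq_monomial]
        exact (HomPoly.C (isWeightedHomogeneous_monomial _ _ _ rfl)).mul (HomPoly.X.pow k)
      have h2 : HomPoly (rootDeg a b) (Finsupp.weight wt x + k • rootDeg a b)
          (sweepPoly a b (Polynomial.monomial k (monomial x c))) := by
        rw [← Polynomial.C_mul_X_pow_eq_monomial, map_mul, map_pow, sweepPoly_C, sweepPoly_X]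
        exact (homPoly_sweep_monomial a b x c).mul (HomPoly.X.pow k)
      rw [polyComp_of_homPoly h1, polyComp_of_homPoly h2]
      split_ifs <;> simp

end SchubertSupport

namespace SchubertSupport

variable {p : ℕ}

/-! ### Slices of an ideal of polynomials in the parameter -/

/-- The ideal of coefficients of index `k` of the elements of `N` of degree at most `d`. -/
def slice (N : Ideal (Polynomial (MatRing p))) (d k : ℕ) : Ideal (MatRing p) where
  carrier := {f | ∃ F ∈ N, F.natDegree ≤ d ∧ F.coeff k = f}
  zero_mem' := ⟨0, N.zero_mem, by simp, by simp⟩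
  add_mem' := by
    rintro f g ⟨F, hF, hFd, rfl⟩ ⟨G, hG, hGd, rfl⟩
    exact ⟨F + G, N.add_mem hF hG, Polynomial.natDegree_add_le_of_degree_le hFd hGd, by simp⟩
  smul_mem' := by
    rintro r f ⟨F, hF, hFd, rfl⟩
    exact ⟨Polynomial.C r * F, N.mul_mem_left _ hF,
      (Polynomial.natDegree_C_mul_le r F).trans hFd, by simp⟩

variable {N : Ideal (Polynomial (MatRing p))} {δ : Lab p → ℤ}

lemma mem_slice {d k : ℕ} {f : MatRing p} :
    f ∈ slice N d k ↔ ∃ F ∈ N, F.natDegree ≤ d ∧ F.coeff k = f := Iff.rfl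

lemma natDegree_polyComp_le {n : Lab p → ℤ} {F : Polynomial (MatRing p)} {d : ℕ}
    (hF : F.natDegree ≤ d) : (polyComp δ n F).natDegree ≤ d := by
  rw [Polynomial.natDegree_le_iff_coeff_eq_zero] at hF ⊢
  intro k hk
  rw [coeff_polyComp, hF k hk, map_zero]

lemma isMultihomog_slice (hN : ∀ F ∈ N, ∀ n, polyComp δ n F ∈ N) (d k : ℕ) :
    IsMultihomog (slice N d k) := by
  rintro f ⟨F, hF, hFd, rfl⟩ n
  refine ⟨polyComp δ (n + k • δ) F, hN F hF _, natDegree_polyComp_le hFd, ?_⟩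
  rw [coeff_polyComp, add_sub_cancel_right]

/-- The polynomials of degree less than `d` in the parameter, homogeneous of degree `n`. -/
def homPolys (δ : Lab p → ℤ) (d : ℕ) (n : Lab p → ℤ) : Submodule ℚ (Polynomial (MatRing p)) where
  carrier := {F | HomPoly δ n F ∧ ∀ k, d ≤ k → F.coeff k = 0}
  zero_mem' := ⟨HomPoly.zero, by simp⟩
  add_mem' := by
    rintro F G ⟨hF, hF'⟩ ⟨hG, hG'⟩
    exact ⟨hF.add hG, fun k hk => by simp [hF' k hk, hG' k hk]⟩
  smul_mem' := by
    rintro c F ⟨hF, hF'⟩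
    exact ⟨fun k => by rw [Polynomial.coeff_smul]; exact Submodule.smul_mem _ c (hF k),
      fun k hk => by simp [hF' k hk]⟩

lemma mem_homPolys {d : ℕ} {n : Lab p → ℤ} {F : Polynomial (MatRing p)} :
    F ∈ homPolys δ d n ↔ HomPoly δ n F ∧ ∀ k, d ≤ k → F.coeff k = 0 := Iff.rfl

/-- A coefficient of a polynomial in the parameter. -/
noncomputable def coeffMap (k : ℕ) : Polynomial (MatRing p) →ₗ[ℚ] MatRing p :=
  (Polynomial.lcoeff (MatRing p) k).restrictScalars ℚ

@[simp] lemma coeffMap_apply (k : ℕ) (F : Polynomial (MatRing p)) : coeffMap k F = F.coeff k := rfl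

instance (d : ℕ) (n : Lab p → ℤ) : Module.Finite ℚ (homPolys δ d n) := by
  let φ : homPolys δ d n →ₗ[ℚ] ((k : Fin d) → gradedPiece (n - (k : ℕ) • δ)) :=
    LinearMap.pi fun k => ((coeffMap (k : ℕ)).comp (homPolys δ d n).subtype).codRestrict _
      fun F => F.2.1 k
  refine Module.Finite.of_injective φ ?_
  rw [injective_iff_map_eq_zero]
  rintro ⟨F, hF⟩ h
  rw [Subtype.ext_iff]
  change F = 0
  ext1 k
  rw [Polynomial.coeff_zero]
  by_cases hk : d ≤ k
  · exact hF.2 k hk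
  · exact congrArg Subtype.val (congrFun h ⟨k, by omega⟩)

lemma relDim_homPolys_top (hN : ∀ F ∈ N, ∀ n, polyComp δ n F ∈ N) (d : ℕ) (n : Lab p → ℤ) :
    relDim (homPolys δ (d + 1) n) (N.restrictScalars ℚ) =
      relDim (homPolys δ d n) (N.restrictScalars ℚ) + hilb (slice N d d) (n - d • δ) := by
  have hmap : (homPolys δ (d + 1) n).map (coeffMap d) = gradedPiece (n - d • δ) := by
    ext f
    constructor
    · rintro ⟨F, hF, rfl⟩
      exact hF.1 d
    · intro hf
      refine ⟨Polynomial.monomial d f, ⟨fun k => ?_, fun k hk => ?_⟩, by simp⟩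
      · rw [Polynomial.coeff_monomial]
        split_ifs with h
        · rwa [← h]
        · exact Submodule.zero_mem _
      · rw [Polynomial.coeff_monomial, if_neg (by omega)]
  have hker : homPolys δ (d + 1) n ⊓ LinearMap.ker (coeffMap d) = homPolys δ d n := by
    ext F
    simp only [Submodule.mem_inf, mem_homPolys, LinearMap.mem_ker, coeffMap_apply]
    constructor
    · rintro ⟨⟨h1, h2⟩, h3⟩
      refine ⟨h1, fun k hk => ?_⟩
      rcases hk.eq_or_lt with rfl | hk
      · exact h3
      · exact h2 k hk
    · rintro ⟨h1, h2⟩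
      exact ⟨⟨h1, fun k hk => h2 k (by omega)⟩, h2 d le_rfl⟩
  rw [relDim_eq_add_map _ _ (coeffMap d) ((slice N d d).restrictScalars ℚ), hker, hmap]
  · rfl
  · rw [hmap]
    ext f
    constructor
    · rintro ⟨F, ⟨hF, hFN⟩, rfl⟩
      refine ⟨hF.1 d, F, hFN, ?_, rfl⟩
      rw [Polynomial.natDegree_le_iff_coeff_eq_zero]
      exact fun k hk => hF.2 k hk
    · rintro ⟨hf, F, hFN, hFd, rfl⟩
      refine ⟨polyComp δ n F, ⟨⟨homPoly_polyComp _ _ _, fun k hk => ?_⟩, hN F hFN n⟩, ?_⟩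
      · exact (Polynomial.natDegree_le_iff_coeff_eq_zero.1 (natDegree_polyComp_le hFd)) k hk
      · rw [coeffMap_apply, coeff_polyComp]
        exact IsWeightedHomogeneous.weightedHomogeneousComponent_same hf

lemma relDim_homPolys_bot (hN : ∀ F ∈ N, ∀ n, polyComp δ n F ∈ N)
    (hX : ∀ F, Polynomial.X * F ∈ N → F ∈ N) (d : ℕ) (n : Lab p → ℤ) :
    relDim (homPolys δ (d + 1) n) (N.restrictScalars ℚ) =
      relDim (homPolys δ d (n - δ)) (N.restrictScalars ℚ) + hilb (slice N d 0) n := by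
  have hmap : (homPolys δ (d + 1) n).map (coeffMap 0) = gradedPiece n := by
    ext f
    constructor
    · rintro ⟨F, hF, rfl⟩
      simpa using hF.1 0
    · intro hf
      refine ⟨Polynomial.C f, ⟨HomPoly.C hf, fun k hk => ?_⟩, by simp⟩
      rw [Polynomial.coeff_C, if_neg (by omega)]
  let μ : Polynomial (MatRing p) →ₗ[ℚ] Polynomial (MatRing p) := LinearMap.mulLeft ℚ Polynomial.X
  have hker : homPolys δ (d + 1) n ⊓ LinearMap.ker (coeffMap 0) =
      (homPolys δ d (n - δ)).map μ := by
    ext F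
    simp only [Submodule.mem_inf, mem_homPolys, LinearMap.mem_ker, coeffMap_apply,
      Submodule.mem_map]
    constructor
    · rintro ⟨⟨h1, h2⟩, h3⟩
      obtain ⟨G, rfl⟩ := Polynomial.X_dvd_iff.2 h3
      refine ⟨G, ⟨fun k => ?_, fun k hk => ?_⟩, rfl⟩
      · have := h1 (k + 1)
        rw [Polynomial.coeff_X_mul] at this
        rwa [sub_sub, add_comm, ← succ_nsmul]
      · rw [← Polynomial.coeff_X_mul]
        exact h2 _ (by omega)
    · rintro ⟨G, ⟨h1, h2⟩, rfl⟩
      refine ⟨⟨?_, fun k hk => ?_⟩, by simp [μ]⟩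
      · have := HomPoly.X.mul h1
        rwa [add_sub_cancel] at this
      · obtain ⟨k, rfl⟩ : ∃ j, k = j + 1 := ⟨k - 1, by omega⟩
        simp only [μ, LinearMap.mulLeft_apply, Polynomial.coeff_X_mul]
        exact h2 k (by omega)
  rw [relDim_eq_add_map _ _ (coeffMap 0) ((slice N d 0).restrictScalars ℚ), hker, hmap,
    relDim_map (N := N.restrictScalars ℚ)]
  · rfl
  · intro F G h
    exact mul_left_cancel₀ Polynomial.X_ne_zero h
  · ext F
    exact ⟨hX F, fun h => N.mul_mem_left _ h⟩
  · rw [hmap]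
    ext f
    constructor
    · rintro ⟨F, ⟨hF, hFN⟩, rfl⟩
      refine ⟨by simpa using hF.1 0, F, hFN, ?_, rfl⟩
      rw [Polynomial.natDegree_le_iff_coeff_eq_zero]
      exact fun k hk => hF.2 k hk
    · rintro ⟨hf, F, hFN, hFd, rfl⟩
      refine ⟨polyComp δ n F, ⟨⟨homPoly_polyComp _ _ _, fun k hk => ?_⟩, hN F hFN n⟩, ?_⟩
      · exact (Polynomial.natDegree_le_iff_coeff_eq_zero.1 (natDegree_polyComp_le hFd)) k hk
      · rw [coeffMap_apply, coeff_polyComp, zero_smul, sub_zero]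
        exact IsWeightedHomogeneous.weightedHomogeneousComponent_same hf

lemma relDim_homPolys (hN : ∀ F ∈ N, ∀ n, polyComp δ n F ∈ N) (d : ℕ) (n : Lab p → ℤ) :
    relDim (homPolys δ d n) (N.restrictScalars ℚ) =
      ∑ k ∈ Finset.range d, hilb (slice N k k) (n - k • δ) := by
  induction d with
  | zero =>
    have : homPolys δ 0 n = ⊥ := by
      rw [eq_bot_iff]
      rintro F ⟨-, hF⟩
      rw [Submodule.mem_bot]
      ext1 k
      exact hF k (by omega)
    rw [this, relDim, bot_inf_eq]
    simp
  | succ d ih => rw [relDim_homPolys_top hN, Finset.sum_range_succ, ih]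

lemma sum_hilb_slice (hN : ∀ F ∈ N, ∀ n, polyComp δ n F ∈ N)
    (hX : ∀ F, Polynomial.X * F ∈ N → F ∈ N) (d : ℕ) (n : Lab p → ℤ) :
    ∑ k ∈ Finset.range (d + 1), hilb (slice N k k) (n - k • δ) =
      ∑ k ∈ Finset.range d, hilb (slice N k k) (n - (k + 1) • δ) + hilb (slice N d 0) n := by
  rw [← relDim_homPolys hN, relDim_homPolys_bot hN hX, relDim_homPolys hN]
  congr 1
  refine Finset.sum_congr rfl fun k _ => ?_
  rw [sub_sub, succ_nsmul']

lemma coeff_monomial_mul_hilbSeries (J : Ideal (MatRing p)) (m n : Lab p →₀ ℕ) :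
    MvPowerSeries.coeff n (MvPowerSeries.monomial m 1 * hilbSeries J) =
      hilb J (toInt n - toInt m) := by
  rw [MvPowerSeries.coeff_monomial_mul]
  split_ifs with h
  · rw [one_mul, coeff_hilbSeries]
    congr 1
    ext v
    simp [toInt, Nat.cast_sub (h v)]
  · obtain ⟨v, hv⟩ : ∃ v, n v < m v := by
      by_contra! h'
      exact h h'
    rw [hilb_eq_zero J (v := v)]
    simpa [toInt] using hv

/-- The exponent `j` on row `a` and `k` on row `b`. -/
noncomputable def rowPair (a b : Fin p) (j k : ℕ) : Lab p →₀ ℕ :=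
  Finsupp.single (Sum.inl a) j + Finsupp.single (Sum.inl b) k

lemma toInt_rowPair (a b : Fin p) (j k : ℕ) : toInt (rowPair a b j k) =
    j • Pi.single (Sum.inl a) 1 + k • Pi.single (Sum.inl b) 1 := by
  classical
  ext v
  simp [toInt, rowPair, Finsupp.single_apply, Pi.single_apply, eq_comm]

/-- The weighted sum of the Hilbert series of the first `d` top slices. -/
noncomputable def sliceSeries (N : Ideal (Polynomial (MatRing p))) (a b : Fin p) (d : ℕ) :
    MvPowerSeries (Lab p) ℤ :=
  ∑ k ∈ Finset.range d, MvPowerSeries.monomial (rowPair a b k (d - 1 - k)) 1 *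
    hilbSeries (slice N k k)

lemma sliceSeries_identity {a b : Fin p} (hN : ∀ F ∈ N, ∀ n, polyComp (rootDeg a b) n F ∈ N)
    (hX : ∀ F, Polynomial.X * F ∈ N → F ∈ N) (d : ℕ) :
    MvPowerSeries.monomial (rowPair a b 0 1) 1 * sliceSeries N a b d +
        MvPowerSeries.monomial (rowPair a b d 0) 1 * hilbSeries (slice N d d) =
      MvPowerSeries.monomial (rowPair a b 1 0) 1 * sliceSeries N a b d +
        MvPowerSeries.monomial (rowPair a b 0 d) 1 * hilbSeries (slice N d 0) := by
  ext n
  have h := sum_hilb_slice hN hX d (toInt n - toInt (rowPair a b 0 d))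
  rw [Finset.sum_range_succ] at h
  simp only [sliceSeries, Finset.mul_sum, ← mul_assoc, MvPowerSeries.monomial_mul_monomial,
    mul_one, map_add, map_sum, coeff_monomial_mul_hilbSeries]
  have e1 : ∀ k ≤ d, toInt n - toInt (rowPair a b 0 d) - k • rootDeg a b =
      toInt n - toInt (rowPair a b k (d - k)) := by
    intro k hk
    obtain ⟨l, rfl⟩ := exists_add_of_le hk
    simp only [toInt_rowPair, rootDeg, add_tsub_cancel_left, smul_sub, add_smul, zero_smul]
    abel
  have e2 : ∀ j k j' k', rowPair a b j k + rowPair a b j' k' = rowPair a b (j + j') (k + k') := by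
    intro j k j' k'
    simp only [rowPair, Finsupp.single_add]
    abel
  simp only [e2]
  rw [e1 d le_rfl, Nat.sub_self] at h
  convert h using 2
  · refine Finset.sum_congr rfl fun k hk => ?_
    have hk := Finset.mem_range.1 hk
    rw [e1 k hk.le, show 0 + k = k by omega, show 1 + (d - 1 - k) = d - k by omega]
  · refine Finset.sum_congr rfl fun k hk => ?_
    have hk := Finset.mem_range.1 hk
    rw [e1 (k + 1) hk, show 1 + k = k + 1 by omega, show 0 + (d - 1 - k) = d - (k + 1) by omega]

end SchubertSupport

namespace SchubertSupport

variable {p : ℕ}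

/-! ### Points of the variety of an ideal -/

/-- `Z` is a point of the variety of `P`. -/
def Kills {A : Type*} [CommRing A] [Algebra ℚ A] (Z : Cell p → A) (P : Ideal (MatRing p)) : Prop :=
  ∀ f ∈ P, aeval Z f = 0

/-- Evaluation at the point `Z` and the parameter `t`. -/
noncomputable def evalPt {A : Type*} [CommRing A] [Algebra ℚ A] (Z : Cell p → A) (t : A) :
    Polynomial (MatRing p) →+* A :=
  Polynomial.eval₂RingHom (aeval Z : MatRing p →ₐ[ℚ] A) t

section

variable {A B : Type*} [CommRing A] [Algebra ℚ A] [CommRing B] [Algebra ℚ B]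

@[simp] lemma evalPt_C (Z : Cell p → A) (t : A) (f : MatRing p) :
    evalPt Z t (Polynomial.C f) = aeval Z f := by
  simp [evalPt]

@[simp] lemma evalPt_X (Z : Cell p → A) (t : A) : evalPt Z t Polynomial.X = t := by
  simp [evalPt]

lemma map_rowAdd (φ : A →ₐ[ℚ] B) (a b : Fin p) (c : A) (Z : Cell p → A) (e : Cell p) :
    φ (rowAdd a b c Z e) = rowAdd a b (φ c) (fun e => φ (Z e)) e := by
  unfold rowAdd
  split_ifs <;> simp

lemma map_aeval_pt (φ : A →ₐ[ℚ] B) (Z : Cell p → A) (f : MatRing p) :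
    φ (aeval Z f) = aeval (fun e => φ (Z e)) f :=
  (MvPolynomial.comp_aeval_apply Z φ f)

lemma map_evalPt (φ : A →ₐ[ℚ] B) (Z : Cell p → A) (t : A) (F : Polynomial (MatRing p)) :
    φ (evalPt Z t F) = evalPt (fun e => φ (Z e)) (φ t) F := by
  have : (φ : A →+* B).comp (evalPt Z t) = evalPt (fun e => φ (Z e)) (φ t) := by
    refine Polynomial.ringHom_ext (fun f => ?_) ?_
    · simp [map_aeval_pt]
    · simp
  exact RingHom.congr_fun this F

/-- Evaluation at a point as an algebra homomorphism. -/
noncomputable def evalPtₐ (Z : Cell p → A) (t : A) : Polynomial (MatRing p) →ₐ[ℚ] A :=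
  { evalPt Z t with
    commutes' := fun q => by
      have : algebraMap ℚ (Polynomial (MatRing p)) q = Polynomial.C (C q) := by
        rw [IsScalarTower.algebraMap_apply ℚ (MatRing p) (Polynomial (MatRing p))]
        rfl
      change evalPt Z t _ = _
      rw [this]
      simp }

lemma evalPt_aeval (Z : Cell p → A) (t : A) (W : Cell p → Polynomial (MatRing p))
    (f : MatRing p) : evalPt Z t (aeval W f) = aeval (fun e => evalPt Z t (W e)) f :=
  map_aeval_pt (evalPtₐ Z t) W f

lemma evalPt_rowAdd (Z : Cell p → A) (t : A) (a b : Fin p) (F : Polynomial (MatRing p))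
    (e : Cell p) : evalPt Z t (rowAdd a b F (fun e => Polynomial.C (X e)) e) =
      rowAdd a b (evalPt Z t F) Z e := by
  refine (map_rowAdd (evalPtₐ Z t) a b F _ e).trans ?_
  congr 1
  funext e
  change evalPt Z t _ = _
  simp

lemma evalPt_sweep (Z : Cell p → A) (t : A) (a b : Fin p) (f : MatRing p) :
    evalPt Z t (sweep a b f) = aeval (rowAdd a b t Z) f := by
  rw [sweep, evalPt_aeval]
  congr 2
  funext e
  rw [evalPt_rowAdd, evalPt_X]

lemma evalPt_sweepPoly (Z : Cell p → A) (t : A) (a b : Fin p) (F : Polynomial (MatRing p)) :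
    evalPt Z t (sweepPoly a b F) = evalPt (rowAdd a b t Z) t F := by
  have : (evalPt Z t).comp (sweepPoly a b) = evalPt (rowAdd a b t Z) t := by
    refine Polynomial.ringHom_ext (fun f => ?_) ?_
    · simp [sweepPoly_C, evalPt_sweep]
    · simp [sweepPoly_X]
  exact RingHom.congr_fun this F

lemma evalPt_zero (Z : Cell p → A) (F : Polynomial (MatRing p)) :
    evalPt Z 0 F = aeval Z (F.coeff 0) := by
  simp [evalPt, Polynomial.eval₂_at_zero]

lemma Kills.map {P : Ideal (MatRing p)} {Z : Cell p → A} (h : Kills Z P) (φ : A →ₐ[ℚ] B) :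
    Kills (fun e => φ (Z e)) P := fun f hf => by
  rw [← map_aeval_pt, h f hf, map_zero]

lemma Kills.evalPt_eq_zero {P : Ideal (MatRing p)} {Z : Cell p → A} (h : Kills Z P) (t : A)
    {F : Polynomial (MatRing p)} (hF : F ∈ P.map Polynomial.C) : evalPt Z t F = 0 := by
  have : P.map Polynomial.C ≤ RingHom.ker (evalPt Z t) := by
    rw [Ideal.map_le_iff_le_comap]
    intro f hf
    rw [Ideal.mem_comap, RingHom.mem_ker, evalPt_C, h f hf]
  exact this hF

/-! ### Torus action -/

lemma prod_row_pow {R : Type*} [CommRing R] (ρ : Fin p → R) (x : Cell p →₀ ℕ) :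
    (x.prod fun e k => ρ e.1 ^ k) = ∏ i, ρ i ^ (mdeg x (Sum.inl i)) := by
  induction x using Finsupp.induction_linear with
  | zero => simp
  | add f g hf hg =>
    rw [Finsupp.prod_add_index' (by simp) (by intros; rw [pow_add]), hf, hg, map_add,
      ← Finset.prod_mul_distrib]
    exact Finset.prod_congr rfl fun i _ => by rw [Finsupp.add_apply, pow_add]
  | single e k =>
    rw [Finsupp.prod_single_index (by simp), mdeg_single, Finset.prod_eq_single e.1]
    · simp [cellWeight]
    · intro i _ hi
      simp [cellWeight, hi.symm]
    · simp

lemma aeval_scale {ρ : Fin p → A} {Z : Cell p → A} {f : MatRing p} {n : Lab p → ℤ}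
    (hf : f ∈ gradedPiece n) : aeval (fun e => ρ e.1 * Z e) f =
      (∏ i, ρ i ^ (n (Sum.inl i)).toNat) * aeval Z f := by
  rw [mem_gradedPiece_iff] at hf
  rw [aeval_def, aeval_def, eval₂_eq, eval₂_eq, Finset.mul_sum]
  refine Finset.sum_congr rfl fun x hx => ?_
  have h1 := prod_row_pow ρ x
  have h2 : ∀ i, (n (Sum.inl i)).toNat = mdeg x (Sum.inl i) := fun i => by
    rw [← hf x hx]; simp [toInt]
  simp only [h2, mul_pow, Finset.prod_mul_distrib]
  rw [← h1, Finsupp.prod]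
  ring

lemma Kills.scale {P : Ideal (MatRing p)} (hP : IsMultihomog P) {Z : Cell p → A} (h : Kills Z P)
    (ρ : Fin p → A) : Kills (fun e => ρ e.1 * Z e) P := by
  intro f hf
  rw [← sum_weightedHomogeneousComponent (w := wt) f,
    finsum_eq_sum _ (weightedHomogeneousComponent_finsupp f), map_sum]
  refine Finset.sum_eq_zero fun n _ => ?_
  rw [aeval_scale (n := n) (weightedHomogeneousComponent_mem _ _ _), h _ (hP f hf n), mul_zero]

end

/-! ### The generic point -/

section

variable (P : Ideal (MatRing p))

lemma kills_coord : Kills (coord P) P := fun f hf => by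
  rw [aeval_coord, Ideal.Quotient.eq_zero_iff_mem]
  exact hf

/-- The constant generic point. -/
noncomputable def genPt (e : Cell p) : Polynomial (MatRing p ⧸ P) := Polynomial.C (coord P e)

lemma kills_genPt : Kills (genPt P) P :=
  (kills_coord P).map (Polynomial.CAlgHom (R := ℚ))

lemma coeff_evalPt_C {A : Type*} [CommRing A] [Algebra ℚ A] (Z : Cell p → A)
    (F : Polynomial (MatRing p)) (k : ℕ) :
    (evalPt (fun e => Polynomial.C (Z e)) Polynomial.X F).coeff k = aeval Z (F.coeff k) := by
  have : evalPt (fun e => Polynomial.C (Z e)) Polynomial.X =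
      Polynomial.mapRingHom (aeval Z : MatRing p →ₐ[ℚ] A).toRingHom := by
    refine Polynomial.ringHom_ext (fun f => ?_) ?_
    · simp only [evalPt_C, Polynomial.coe_mapRingHom, Polynomial.map_C]
      exact (map_aeval_pt (Polynomial.CAlgHom (R := ℚ)) Z f).symm
    · simp
  rw [this]
  simp

lemma mem_map_C_iff_genPt (F : Polynomial (MatRing p)) :
    F ∈ P.map Polynomial.C ↔ evalPt (genPt P) Polynomial.X F = 0 := by
  rw [Ideal.mem_map_C_iff, Polynomial.ext_iff]
  refine forall_congr' fun k => ?_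
  rw [show genPt P = fun e => Polynomial.C (coord P e) from rfl, coeff_evalPt_C, aeval_coord,
    Polynomial.coeff_zero, Ideal.Quotient.eq_zero_iff_mem]

end

end SchubertSupport

namespace SchubertSupport

variable {p : ℕ}

/-! ### Sweeping an ideal -/

/-- The ideal of the union of the translates of the variety of `P`, together with the parameter. -/
noncomputable def graphIdeal (a b : Fin p) (P : Ideal (MatRing p)) :
    Ideal (Polynomial (MatRing p)) := (P.map Polynomial.C).comap (sweepPoly a b)

/-- The ideal of the union of the translates of the variety of `P`. -/
noncomputable def sweepIdeal (a b : Fin p) (P : Ideal (MatRing p)) : Ideal (MatRing p) :=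
  (P.map Polynomial.C).comap (sweep a b)

variable {P : Ideal (MatRing p)} {a b : Fin p}

lemma mem_graphIdeal {F : Polynomial (MatRing p)} :
    F ∈ graphIdeal a b P ↔ sweepPoly a b F ∈ P.map Polynomial.C := Iff.rfl

lemma mem_sweepIdeal {f : MatRing p} : f ∈ sweepIdeal a b P ↔ sweep a b f ∈ P.map Polynomial.C :=
  Iff.rfl

lemma mem_graphIdeal_iff (F : Polynomial (MatRing p)) : F ∈ graphIdeal a b P ↔
    evalPt (rowAdd a b Polynomial.X (genPt P)) Polynomial.X F = 0 := by
  rw [mem_graphIdeal, mem_map_C_iff_genPt, evalPt_sweepPoly]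

lemma mem_sweepIdeal_iff (f : MatRing p) : f ∈ sweepIdeal a b P ↔
    aeval (rowAdd a b Polynomial.X (genPt P)) f = 0 := by
  rw [mem_sweepIdeal, mem_map_C_iff_genPt, evalPt_sweep]

lemma Kills.rowAdd_sweepIdeal {A : Type*} [CommRing A] [Algebra ℚ A] {Z : Cell p → A}
    (h : Kills Z P) (t : A) : Kills (rowAdd a b t Z) (sweepIdeal a b P) := fun f hf => by
  rw [← evalPt_sweep]
  exact h.evalPt_eq_zero t hf

lemma evalPt_of_mem_graphIdeal {A : Type*} [CommRing A] [Algebra ℚ A] {Z : Cell p → A}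
    (h : Kills Z P) (t : A) {F : Polynomial (MatRing p)} (hF : F ∈ graphIdeal a b P) :
    evalPt (rowAdd a b t Z) t F = 0 := by
  rw [← evalPt_sweepPoly]
  exact h.evalPt_eq_zero t hF

instance [hP : P.IsPrime] : (sweepIdeal a b P).IsPrime := by
  have : (P.map Polynomial.C).IsPrime := Ideal.isPrime_map_C_of_isPrime
  exact Ideal.comap_isPrime _ _

lemma polyComp_mem_graphIdeal (hP : IsMultihomog P) (F : Polynomial (MatRing p))
    (hF : F ∈ graphIdeal a b P) (n : Lab p → ℤ) :
    polyComp (rootDeg a b) n F ∈ graphIdeal a b P := by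
  rw [mem_graphIdeal, Ideal.mem_map_C_iff] at hF ⊢
  intro k
  rw [sweepPoly_polyComp, coeff_polyComp]
  exact hP _ (hF k) _

lemma mem_graphIdeal_of_X_mul (F : Polynomial (MatRing p))
    (hF : Polynomial.X * F ∈ graphIdeal a b P) : F ∈ graphIdeal a b P := by
  rw [mem_graphIdeal, Ideal.mem_map_C_iff] at hF ⊢
  intro k
  have := hF (k + 1)
  rwa [map_mul, sweepPoly_X, Polynomial.coeff_X_mul] at this

lemma C_mem_graphIdeal {f : MatRing p} : Polynomial.C f ∈ graphIdeal a b P ↔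
    f ∈ sweepIdeal a b P := by
  rw [mem_graphIdeal, sweepPoly_C, mem_sweepIdeal]

lemma slice_graphIdeal_zero : slice (graphIdeal a b P) 0 0 = sweepIdeal a b P := by
  ext f
  rw [mem_slice]
  constructor
  · rintro ⟨F, hF, hFd, rfl⟩
    rw [Polynomial.eq_C_of_natDegree_le_zero hFd] at hF
    exact C_mem_graphIdeal.1 hF
  · intro hf
    exact ⟨Polynomial.C f, C_mem_graphIdeal.2 hf, by simp, by simp⟩

lemma isMultihomog_sweepIdeal (hP : IsMultihomog P) : IsMultihomog (sweepIdeal a b P) := by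
  rw [← slice_graphIdeal_zero]
  exact isMultihomog_slice (polyComp_mem_graphIdeal hP) 0 0

lemma sweepIdeal_le_slice (k : ℕ) : sweepIdeal a b P ≤ slice (graphIdeal a b P) k k := by
  intro f hf
  refine ⟨Polynomial.C f * Polynomial.X ^ k, ?_, Polynomial.natDegree_C_mul_X_pow_le f k, by simp⟩
  exact Ideal.mul_mem_right _ _ (C_mem_graphIdeal.2 hf)

lemma slice_bot_le (d : ℕ) : slice (graphIdeal a b P) d 0 ≤ P := by
  rintro f ⟨F, hF, -, rfl⟩
  have h := evalPt_of_mem_graphIdeal (kills_coord P) 0 hF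
  have : rowAdd a b 0 (coord P) = coord P := by
    funext e; simp [rowAdd]
  rwa [this, evalPt_zero, aeval_coord, Ideal.Quotient.eq_zero_iff_mem] at h

lemma slice_mono_bot {N : Ideal (Polynomial (MatRing p))} {d d' : ℕ} (h : d ≤ d') (k : ℕ) :
    slice N d k ≤ slice N d' k := by
  rintro f ⟨F, hF, hFd, rfl⟩
  exact ⟨F, hF, hFd.trans h, rfl⟩

lemma slice_mono_top {N : Ideal (Polynomial (MatRing p))} {d d' : ℕ} (h : d ≤ d') :
    slice N d d ≤ slice N d' d' := by
  rintro f ⟨F, hF, hFd, rfl⟩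
  obtain ⟨k, rfl⟩ := exists_add_of_le h
  refine ⟨F * Polynomial.X ^ k, N.mul_mem_right _ hF, ?_, ?_⟩
  · refine Polynomial.natDegree_mul_le.trans ?_
    rw [Polynomial.natDegree_X_pow]
    omega
  · rw [Polynomial.coeff_mul_X_pow]

lemma exists_le_of_monotone {J : ℕ → Ideal (MatRing p)} (hJ : Monotone J) (Q : Ideal (MatRing p))
    (h : ∀ f ∈ Q, ∃ d, f ∈ J d) : ∃ d, Q ≤ J d := by
  obtain ⟨d, hd⟩ := monotone_stabilizes_iff_noetherian.2 (inferInstance :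
    IsNoetherian (MatRing p) (MatRing p)) ⟨J, hJ⟩
  refine ⟨d, fun f hf => ?_⟩
  obtain ⟨d', hd'⟩ := h f hf
  have h1 := hJ (le_max_right d d') hd'
  have h2 : J d = J (max d d') := hd _ (le_max_left _ _)
  rwa [h2]

lemma rowAdd_neg {A : Type*} [CommRing A] (hab : a ≠ b) (t : A) (Z : Cell p → A) :
    rowAdd a b (-t) (rowAdd a b t Z) = Z := by
  funext e
  unfold rowAdd
  split_ifs <;> simp_all

lemma exists_slice_bot (hab : a ≠ b) : ∃ d, P ≤ slice (graphIdeal a b P) d 0 := by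
  refine exists_le_of_monotone (fun _ _ h => slice_mono_bot h 0) P fun f hf => ?_
  set G : Polynomial (MatRing p) :=
    aeval (rowAdd a b (-Polynomial.X) (fun e => Polynomial.C (X e : MatRing p))) f with hG
  have key : ∀ {A : Type} [CommRing A] [Algebra ℚ A] (Z : Cell p → A) (t : A),
      evalPt Z t G = aeval (rowAdd a b (-t) Z) f := by
    intro A _ _ Z t
    rw [hG, evalPt_aeval]
    congr 2
    funext e
    rw [evalPt_rowAdd, map_neg, evalPt_X]
  refine ⟨G.natDegree, G, ?_, le_rfl, ?_⟩
  · rw [mem_graphIdeal_iff, key, rowAdd_neg hab, kills_genPt P f hf]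
  · have h1 := key X (0 : MatRing p)
    rw [evalPt_zero, neg_zero, show rowAdd a b 0 (X : Cell p → MatRing p) = X by
      funext e; simp [rowAdd]] at h1
    simpa using h1

/-! ### Stable ideals -/

/-- The variety of `P` is stable under adding multiples of a row to the next one. -/
def Stable (P : Ideal (MatRing p)) : Prop :=
  ∀ (k : Fin p) (h : (k : ℕ) + 1 < p), P ≤ sweepIdeal ⟨k + 1, h⟩ k P

lemma Kills.of_le {A : Type*} [CommRing A] [Algebra ℚ A] {Z : Cell p → A}
    {Q : Ideal (MatRing p)} (h : Kills Z Q) (hPQ : P ≤ Q) : Kills Z P :=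
  fun f hf => h f (hPQ hf)

/-- Exchange two rows. -/
noncomputable def swapRows (a b : Fin p) : MatRing p →ₐ[ℚ] MatRing p :=
  rename (Prod.map (Equiv.swap a b) id)

lemma aeval_swapRows {A : Type*} [CommRing A] [Algebra ℚ A] (Z : Cell p → A) (f : MatRing p) :
    aeval Z (swapRows a b f) = aeval (fun e => Z (Equiv.swap a b e.1, e.2)) f := by
  rw [swapRows, aeval_rename]
  rfl

lemma mem_comap_swapRows {f : MatRing p} : f ∈ P.comap (swapRows a b) ↔
    aeval (fun e => coord P (Equiv.swap a b e.1, e.2)) f = 0 := by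
  rw [Ideal.mem_comap, ← Ideal.Quotient.eq_zero_iff_mem, ← aeval_coord, aeval_swapRows]

lemma exists_field_embedding (S : Type) [CommRing S] [IsDomain S] [Algebra ℚ S] :
    ∃ (K : Type) (_ : CommRing K) (_ : Algebra ℚ K) (φ : S →ₐ[ℚ] K), Function.Injective φ ∧
      ∀ x, x ≠ 0 → ∃ y, φ x * y = 1 :=
  ⟨FractionRing S, inferInstance, inferInstance, IsScalarTower.toAlgHom ℚ S (FractionRing S),
    IsFractionRing.injective S (FractionRing S), fun x hx => ⟨(algebraMap S (FractionRing S) x)⁻¹,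
      mul_inv_cancel₀ ((map_ne_zero_iff _ (IsFractionRing.injective S (FractionRing S))).2 hx)⟩⟩

/-- The point with rows `b` and `a + c • b` in positions `a` and `b`. -/
def swapPt {A : Type*} [Ring A] (a b : Fin p) (c : A) (Z : Cell p → A) : Cell p → A := fun e =>
  if e.1 = b then Z (a, e.2) + c * Z (b, e.2) else if e.1 = a then Z (b, e.2) else Z e

lemma swapPt_zero {A : Type*} [Ring A] (hab : a ≠ b) (Z : Cell p → A) :
    swapPt a b 0 Z = fun e => Z (Equiv.swap a b e.1, e.2) := by
  funext ⟨i, j⟩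
  unfold swapPt
  by_cases hia : i = a
  · simp [hia, hab]
  · by_cases hib : i = b
    · simp [hib]
    · simp [hia, hib, Equiv.swap_apply_of_ne_of_ne hia hib]

lemma map_swapPt {A B : Type*} [CommRing A] [Algebra ℚ A] [CommRing B] [Algebra ℚ B]
    (φ : A →ₐ[ℚ] B) (c : A) (Z : Cell p → A)
    (e : Cell p) : φ (swapPt a b c Z e) = swapPt a b (φ c) (fun e => φ (Z e)) e := by
  unfold swapPt
  split_ifs <;> simp

lemma swapPt_eq_rowAdd {K : Type*} [CommRing K] (hab : a ≠ b) {u v : K} (h : u * v = 1)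
    (Z : Cell p → K) :
    swapPt a b u Z = rowAdd a b v (fun e => (if e.1 = a then -v else
      if e.1 = b then u else 1) * rowAdd b a v Z e) := by
  funext ⟨i, j⟩
  simp only [swapPt, rowAdd]
  by_cases hia : i = a
  · subst hia
    simp only [hab, if_true, if_false, hab.symm]
    linear_combination (-Z (b, j) - v * Z (i, j)) * h
  · by_cases hib : i = b
    · subst hib
      simp only [if_true, if_false, hab.symm]
      linear_combination (-Z (a, j)) * h
    · simp [hia, hib]

lemma evalPt_reflect {K : Type*} [CommRing K] [Algebra ℚ K] {u v : K} (h : u * v = 1)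
    (Z : Cell p → K) {d : ℕ} {F : Polynomial (MatRing p)} (hFd : F.natDegree ≤ d) :
    evalPt Z v (F.reflect d) * u ^ d = evalPt Z u F := by
  let : Invertible u := ⟨v, by rw [mul_comm, h], h⟩
  exact Polynomial.eval₂_reflect_mul_pow
    ((aeval Z : MatRing p →ₐ[ℚ] K) : MatRing p →+* K) u d F hFd

lemma evalPt_reflect_eq_zero {K : Type*} [CommRing K] [Algebra ℚ K] {u v : K} (h : u * v = 1)
    (Z : Cell p → K) {d : ℕ} {F : Polynomial (MatRing p)} (hFd : F.natDegree ≤ d)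
    (h0 : evalPt Z u F = 0) : evalPt Z v (F.reflect d) = 0 := by
  have h1 := evalPt_reflect h Z hFd
  rw [h0] at h1
  have h2 : u ^ d * v ^ d = 1 := by rw [← mul_pow, h, one_pow]
  calc evalPt Z v (F.reflect d) = evalPt Z v (F.reflect d) * u ^ d * v ^ d := by
        rw [mul_assoc, h2, mul_one]
    _ = 0 := by rw [h1, zero_mul]

lemma evalPt_swapPt_reflect (hab : a ≠ b) (hP : IsMultihomog P) (hst : P ≤ sweepIdeal b a P)
    {S : Type} [CommRing S] [IsDomain S] [Algebra ℚ S] {Z : Cell p → S} (hZ : Kills Z P)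
    {u : S} (hu : u ≠ 0) {d : ℕ} {F : Polynomial (MatRing p)} (hF : F ∈ graphIdeal a b P)
    (hFd : F.natDegree ≤ d) : evalPt (swapPt a b u Z) u (F.reflect d) = 0 := by
  obtain ⟨K, _, _, φ, hinj, hinv⟩ := exists_field_embedding S
  obtain ⟨v, hv⟩ := hinv _ hu
  have hW := (((hZ.map φ).rowAdd_sweepIdeal (a := b) (b := a) v).of_le hst).scale hP
    fun i => if i = a then -v else if i = b then φ u else 1
  have h1 := evalPt_of_mem_graphIdeal hW v hF
  rw [← swapPt_eq_rowAdd hab hv] at h1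
  have h3 := evalPt_reflect_eq_zero ((mul_comm _ _).trans hv) _ hFd h1
  rwa [← funext (map_swapPt φ u Z), ← map_evalPt, map_eq_zero_iff _ hinj] at h3

lemma evalPt_swapPt_specialize (hab : a ≠ b) {S : Type} [CommRing S] [Algebra ℚ S]
    {Z : Cell p → S} {F : Polynomial (MatRing p)}
    (h : evalPt (swapPt a b Polynomial.X (fun e => Polynomial.C (Z e))) Polynomial.X F = 0) :
    aeval (fun e => Z (Equiv.swap a b e.1, e.2)) (F.coeff 0) = 0 := by
  let ψ : Polynomial S →ₐ[ℚ] S := (Polynomial.aeval (R := S) 0).restrictScalars ℚ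
  have h4 := map_evalPt ψ (swapPt a b Polynomial.X (fun e => Polynomial.C (Z e))) Polynomial.X F
  have h5 : (fun e => ψ (swapPt a b Polynomial.X (fun e => Polynomial.C (Z e)) e)) =
      fun e => Z (Equiv.swap a b e.1, e.2) := by
    rw [← swapPt_zero hab]
    funext e
    rw [map_swapPt]
    simp [ψ]
  rw [h, map_zero, h5, show ψ Polynomial.X = 0 by simp [ψ], evalPt_zero] at h4
  exact h4.symm

lemma slice_top_le [P.IsPrime] (hab : a ≠ b) (hP : IsMultihomog P)
    (hst : P ≤ sweepIdeal b a P) (d : ℕ) :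
    slice (graphIdeal a b P) d d ≤ P.comap (swapRows a b) := by
  rintro f ⟨F, hF, hFd, rfl⟩
  have h := evalPt_swapPt_specialize hab (Z := coord P)
    (evalPt_swapPt_reflect hab hP hst (kills_genPt P) Polynomial.X_ne_zero hF hFd)
  rwa [mem_comap_swapRows, ← Polynomial.revAt_zero d, ← Polynomial.coeff_reflect]

lemma swapPt_neg {K : Type*} [CommRing K] (hab : a ≠ b) {u v : K} (h : u * v = 1)
    (Z : Cell p → K) : rowAdd b a (-v) (rowAdd a b u Z) =
      fun e => (fun e => (if e.1 = a then -v else if e.1 = b then u else 1) * rowAdd b a v Z e)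
        (Equiv.swap a b e.1, e.2) := by
  funext ⟨i, j⟩
  simp only [rowAdd]
  by_cases hia : i = a
  · subst hia
    simp only [hab, if_true, if_false, hab.symm, Equiv.swap_apply_left]
    linear_combination (-Z (i, j)) * h
  · by_cases hib : i = b
    · subst hib
      simp only [if_true, if_false, hab.symm, Equiv.swap_apply_right, hab]
      linear_combination (-Z (i, j)) * h
    · simp [hia, hib, Equiv.swap_apply_of_ne_of_ne hia hib]

lemma evalPt_rowAdd_reflect {S : Type} [CommRing S] [IsDomain S] [Algebra ℚ S] {Z : Cell p → S}
    {u : S} (hu : u ≠ 0) {d : ℕ} {G : Polynomial (MatRing p)} (hGd : G.natDegree ≤ d)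
    (h : ∀ (K : Type) [CommRing K] [Algebra ℚ K] (φ : S →ₐ[ℚ] K) (v : K), φ u * v = 1 →
      evalPt (rowAdd a b (φ u) (fun e => φ (Z e))) v G = 0) :
    evalPt (rowAdd a b u Z) u (G.reflect d) = 0 := by
  obtain ⟨K, _, _, φ, hinj, hinv⟩ := exists_field_embedding S
  obtain ⟨v, hv⟩ := hinv _ hu
  rw [← map_eq_zero_iff _ hinj, map_evalPt, funext (map_rowAdd φ a b u Z)]
  exact evalPt_reflect_eq_zero ((mul_comm _ _).trans hv) _ hGd (h K φ v hv)

lemma exists_slice_top [P.IsPrime] (hab : a ≠ b) (hP : IsMultihomog P)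
    (hst : P ≤ sweepIdeal b a P) :
    ∃ d, P.comap (swapRows a b) ≤ slice (graphIdeal a b P) d d := by
  refine exists_le_of_monotone (fun _ _ h => slice_mono_top h) _ fun f hf => ?_
  set G : Polynomial (MatRing p) :=
    aeval (rowAdd b a (-Polynomial.X) (fun e => Polynomial.C (X e : MatRing p))) f with hG
  have key : ∀ {A : Type} [CommRing A] [Algebra ℚ A] (Z : Cell p → A) (t : A),
      evalPt Z t G = aeval (rowAdd b a (-t) Z) f := by
    intro A _ _ Z t
    rw [hG, evalPt_aeval]
    congr 2
    funext e
    rw [evalPt_rowAdd, map_neg, evalPt_X]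
  refine ⟨G.natDegree, G.reflect G.natDegree, ?_, ?_, ?_⟩
  · rw [mem_graphIdeal_iff]
    refine evalPt_rowAdd_reflect Polynomial.X_ne_zero le_rfl fun K _ _ φ v hv => ?_
    have hW := (((Kills.map (kills_genPt P) φ).rowAdd_sweepIdeal (a := b) (b := a) v).of_le
      hst).scale hP fun i => if i = a then -v else if i = b then φ Polynomial.X else 1
    have h1 := hW _ hf
    rw [aeval_swapRows] at h1
    rw [key, swapPt_neg hab hv]
    exact h1
  · exact Polynomial.natDegree_reflect_le.trans (by simp)
  · have h1 := key X (0 : MatRing p)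
    rw [evalPt_zero, neg_zero, show rowAdd b a 0 (X : Cell p → MatRing p) = X by
      funext e; simp [rowAdd]] at h1
    simpa using h1

end SchubertSupport

namespace SchubertSupport

variable {p : ℕ} {P : Ideal (MatRing p)} {a b : Fin p}

lemma mem_sweepIdeal_of_generic {Q : Ideal (MatRing p)} {S : Type} [CommRing S] [Algebra ℚ S]
    {Y : Cell p → S} (hY : ∀ g : MatRing p, aeval Y g = 0 → g ∈ Q) {f : MatRing p}
    (h : aeval (rowAdd a b Polynomial.X (fun e => Polynomial.C (Y e))) f = 0) :
    f ∈ sweepIdeal a b Q := by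
  rw [mem_sweepIdeal, Ideal.mem_map_C_iff]
  intro k
  apply hY
  rw [← coeff_evalPt_C, evalPt_sweep, h, Polynomial.coeff_zero]

lemma rowAdd_comm {A : Type*} [CommRing A] {a b c d : Fin p} (h1 : d ≠ a) (h2 : b ≠ c) (s t : A)
    (Z : Cell p → A) : rowAdd c d s (rowAdd a b t Z) = rowAdd a b t (rowAdd c d s Z) := by
  funext ⟨i, j⟩
  simp only [rowAdd]
  split_ifs <;> simp_all
  ring

lemma rowAdd_rowAdd_swap {A : Type*} [CommRing A] (hab : a ≠ b) {c t w : A}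
    (h : (1 + c * t) * w = 1) (Z : Cell p → A) : rowAdd b a c (rowAdd a b t Z) =
      rowAdd a b (t * w) (fun e => (if e.1 = a then w else if e.1 = b then 1 + c * t else 1) *
        rowAdd b a (c * w) Z e) := by
  funext ⟨i, j⟩
  simp only [rowAdd]
  by_cases hia : i = a
  · subst hia
    simp only [hab, if_true, if_false, hab.symm]
    linear_combination (-Z (i, j) - t * Z (b, j) - c * t * w * Z (i, j)) * h
  · by_cases hib : i = b
    · subst hib
      simp only [if_true, if_false, hab.symm]
      linear_combination (-c * Z (a, j)) * h
    · simp [hia, hib]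

lemma aeval_rowAdd_rowAdd_swap (hab : a ≠ b) (hP : IsMultihomog P) (hst : P ≤ sweepIdeal b a P)
    {S : Type} [CommRing S] [IsDomain S] [Algebra ℚ S] {Z : Cell p → S} (hZ : Kills Z P) {c t : S}
    (hct : 1 + c * t ≠ 0) {f : MatRing p} (hf : f ∈ sweepIdeal a b P) :
    aeval (rowAdd b a c (rowAdd a b t Z)) f = 0 := by
  obtain ⟨K, _, _, φ, hinj, hinv⟩ := exists_field_embedding S
  obtain ⟨w, hw⟩ := hinv _ hct
  rw [map_add, map_one, map_mul] at hw
  rw [← map_eq_zero_iff _ hinj, map_aeval_pt, funext (map_rowAdd φ b a c _),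
    funext (map_rowAdd φ a b t _), rowAdd_rowAdd_swap hab hw]
  have hW := (((hZ.map φ).rowAdd_sweepIdeal (a := b) (b := a) (φ c * w)).of_le hst).scale hP
    fun i => if i = a then w else if i = b then 1 + φ c * φ t else 1
  exact hW.rowAdd_sweepIdeal (φ t * w) f hf

lemma one_add_X_mul_C_ne_zero {S : Type} [CommRing S] [IsDomain S] (t : S) :
    (1 + Polynomial.X * Polynomial.C t : Polynomial S) ≠ 0 := fun h => by
  have := congrArg (Polynomial.coeff · 0) h
  simp at this

lemma rowAdd_C {S : Type} [CommRing S] [Algebra ℚ S] (t : S) (Z : Cell p → S) :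
    rowAdd a b (Polynomial.C t) (fun e => Polynomial.CAlgHom (R := ℚ) (Z e)) =
      fun e => Polynomial.C (rowAdd a b t Z e) :=
  funext fun e => (map_rowAdd (Polynomial.CAlgHom (R := ℚ) (A := S)) a b t Z e).symm

lemma aeval_generic_rowAdd_swap (hab : a ≠ b) (hP : IsMultihomog P) (hst : P ≤ sweepIdeal b a P)
    {S : Type} [CommRing S] [IsDomain S] [Algebra ℚ S] {Z : Cell p → S} (hZ : Kills Z P) (t : S)
    {f : MatRing p} (hf : f ∈ sweepIdeal a b P) :
    aeval (rowAdd b a Polynomial.X (fun e => Polynomial.C (rowAdd a b t Z e))) f = 0 := by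
  have h := aeval_rowAdd_rowAdd_swap hab hP hst (hZ.map (Polynomial.CAlgHom (R := ℚ) (A := S)))
    (one_add_X_mul_C_ne_zero t) hf
  rwa [rowAdd_C] at h

lemma aeval_generic_rowAdd_comm {c d : Fin p} (h1 : d ≠ a) (h2 : b ≠ c)
    (hst : P ≤ sweepIdeal c d P) {S : Type} [CommRing S] [Algebra ℚ S] {Z : Cell p → S}
    (hZ : Kills Z P) (t : S) {f : MatRing p} (hf : f ∈ sweepIdeal a b P) :
    aeval (rowAdd c d Polynomial.X (fun e => Polynomial.C (rowAdd a b t Z e))) f = 0 := by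
  have h := (((hZ.map (Polynomial.CAlgHom (R := ℚ) (A := S))).rowAdd_sweepIdeal (a := c) (b := d)
    Polynomial.X).of_le hst).rowAdd_sweepIdeal (a := a) (b := b) (Polynomial.C t) f hf
  rwa [← rowAdd_comm h1 h2, rowAdd_C] at h

lemma stable_sweepIdeal_of_generic (hP : IsMultihomog P) (hst : Stable P) (i : Fin p)
    (hi : (i : ℕ) + 1 < p) {S : Type} [CommRing S] [IsDomain S] [Algebra ℚ S] {Z : Cell p → S}
    (hZ : Kills Z P) (t : S) (hY : ∀ g : MatRing p, aeval (rowAdd i ⟨i + 1, hi⟩ t Z) g = 0 →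
      g ∈ sweepIdeal i ⟨i + 1, hi⟩ P) : Stable (sweepIdeal i ⟨i + 1, hi⟩ P) := by
  intro k hk f hf
  refine mem_sweepIdeal_of_generic hY ?_
  by_cases hki : k = i
  · subst hki
    exact aeval_generic_rowAdd_swap (fun h => by simp [Fin.ext_iff] at h) hP (hst k hk) hZ t hf
  · refine aeval_generic_rowAdd_comm hki (fun h => hki ?_) (hst k hk) hZ t hf
    simp only [Fin.mk.injEq, add_left_inj] at h
    exact Fin.ext h.symm

lemma stable_sweepIdeal [P.IsPrime] (hP : IsMultihomog P) (hst : Stable P) (i : Fin p)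
    (hi : (i : ℕ) + 1 < p) : Stable (sweepIdeal i ⟨i + 1, hi⟩ P) :=
  stable_sweepIdeal_of_generic hP hst i hi (kills_genPt P) Polynomial.X
    fun g => (mem_sweepIdeal_iff g).2

end SchubertSupport

namespace SchubertSupport

variable {p : ℕ} {P : Ideal (MatRing p)} {a b : Fin p}

/-! ### Row exchange and leading forms -/

/-- Exchange two row labels. -/
def swapLab (a b : Fin p) : Lab p ≃ Lab p := (Equiv.swap a b).sumCongr (Equiv.refl _)

/-- Exchange two rows of cells. -/
def swapCell (a b : Fin p) : Cell p ≃ Cell p := (Equiv.swap a b).prodCongr (Equiv.refl _)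

lemma swapRows_eq : swapRows a b = (rename (swapCell a b) : MatRing p →ₐ[ℚ] MatRing p) := rfl

lemma cellWeight_swapCell (e : Cell p) :
    cellWeight (swapCell a b e) = (cellWeight e).mapDomain (swapLab a b) := by
  simp only [cellWeight, Finsupp.mapDomain_add, Finsupp.mapDomain_single]
  rfl

lemma mdeg_mapDomain_swapCell (x : Cell p →₀ ℕ) :
    mdeg (x.mapDomain (swapCell a b)) = (mdeg x).mapDomain (swapLab a b) := by
  induction x using Finsupp.induction_linear with
  | zero => simp
  | add f g hf hg => rw [Finsupp.mapDomain_add, map_add, hf, hg, map_add, Finsupp.mapDomain_add]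
  | single e k =>
    rw [Finsupp.mapDomain_single, mdeg_single, mdeg_single, cellWeight_swapCell,
      Finsupp.mapDomain_smul]

lemma gradedPiece_map_swapRows (n : Lab p →₀ ℕ) :
    (gradedPiece (toInt n)).map (swapRows a b).toLinearMap =
      gradedPiece (toInt (n.mapDomain (swapLab a b))) := by
  have h1 : ∀ (m : Lab p →₀ ℕ) (f : MatRing p), f ∈ gradedPiece (toInt m) →
      swapRows a b f ∈ gradedPiece (toInt (m.mapDomain (swapLab a b))) := by
    intro m f hf
    rw [mem_gradedPiece_iff] at hf ⊢
    intro x hx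
    obtain ⟨y, rfl, hy⟩ := coeff_rename_ne_zero _ _ _ (mem_support_iff.1 hx)
    have := toInt_injective (hf y (mem_support_iff.2 hy))
    change toInt (mdeg (y.mapDomain (swapCell a b))) = _
    rw [mdeg_mapDomain_swapCell, this]
  apply le_antisymm
  · rintro _ ⟨f, hf, rfl⟩
    exact h1 n f hf
  · intro f hf
    refine ⟨swapRows a b f, ?_, ?_⟩
    · have := h1 _ f hf
      rwa [← Finsupp.mapDomain_comp, show (swapLab a b : Lab p → Lab p) ∘ swapLab a b = id by
        ext (v | v) <;> simp [swapLab], Finsupp.mapDomain_id] at this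
    · change swapRows a b (swapRows a b f) = f
      rw [swapRows_eq, rename_rename, show (swapCell a b : Cell p → Cell p) ∘ swapCell a b = id by
        ext v <;> simp [swapCell], rename_id_apply]

lemma hilbSeries_comap_swapRows : hilbSeries (P.comap (swapRows a b)) =
    MvPowerSeries.rename (swapLab a b) (hilbSeries P) := by
  ext n
  have hn : n = (n.mapDomain (swapLab a b)).mapDomain (swapLab a b) := by
    rw [← Finsupp.mapDomain_comp, show (swapLab a b : Lab p → Lab p) ∘ swapLab a b = id by
        ext (v | v) <;> simp [swapLab], Finsupp.mapDomain_id]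
  have h := MvPowerSeries.coeff_embDomain_rename (swapLab a b).toEmbedding (hilbSeries P)
    (n.mapDomain (swapLab a b))
  rw [Finsupp.embDomain_eq_mapDomain] at h
  change MvPowerSeries.coeff ((n.mapDomain (swapLab a b)).mapDomain (swapLab a b))
    (MvPowerSeries.rename (swapLab a b) _) = _ at h
  rw [← hn] at h
  rw [h, coeff_hilbSeries, coeff_hilbSeries, hilb, hilb, ← gradedPiece_map_swapRows]
  symm
  exact relDim_map _ _ _ (rename_injective _ (swapCell a b).injective) _ rfl

lemma HasLead.rename_swapLab {H : MvPowerSeries (Lab p) ℤ} {c : ℕ} {g : MvPolynomial (Lab p) ℤ}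
    (h : HasLead H c g) :
    HasLead (MvPowerSeries.rename (swapLab a b) H) c (rename (swapLab a b) g) := by
  obtain ⟨κ, hκ, F', hF, rfl⟩ := h
  refine ⟨rename (swapLab a b) κ, ?_, F'.map (rename (swapLab a b) : _ →ₐ[ℤ] _).toRingHom, ?_, ?_⟩
  · rw [← MvPowerSeries.rename_coe, hκ, map_mul, MvPowerSeries.rename_coe, map_prod]
    congr 2
    rw [← Equiv.prod_comp (swapCell a b) cellFactor]
    refine Finset.prod_congr rfl fun e _ => ?_
    rw [cellFactor, cellFactor, map_sub, map_one, rename_monomial, cellWeight_swapCell]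
  · have h1 : ∀ f : MvPolynomial (Lab p) ℤ, oneSub (rename (swapLab a b) f) =
        (oneSub f).map (rename (swapLab a b) : _ →ₐ[ℤ] _).toRingHom := by
      intro f
      induction f using MvPolynomial.induction_on with
      | C r => simp [oneSub]
      | add f g hf hg => simp only [map_add, hf, hg, Polynomial.map_add]
      | mul_X f v hf =>
        rw [map_mul, map_mul, hf, rename_X, map_mul, Polynomial.map_mul]
        simp [oneSub]
    rw [h1, hF]
    simp
  · simp

lemma IsLow.neg {A : Type*} [CommRing A] {c : ℕ} {F : Polynomial A} {g : A} (h : IsLow c F g) :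
    IsLow c (-F) (-g) := by
  obtain ⟨F', rfl, rfl⟩ := h
  exact ⟨-F', by ring, by simp⟩

lemma HasLead.compare {H H' S : MvPowerSeries (Lab p) ℤ} {c c' d : ℕ}
    {L L₂ L' : MvPolynomial (Lab p) ℤ} (hH : HasLead H c L) (hH' : HasLead H' c L₂)
    (hS : HasLead S c' L')
    (h : MvPowerSeries.monomial (rowPair a b 0 1) 1 * S +
        MvPowerSeries.monomial (rowPair a b d 0) 1 * H' =
      MvPowerSeries.monomial (rowPair a b 1 0) 1 * S +
        MvPowerSeries.monomial (rowPair a b 0 d) 1 * H) :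
    (c' + 1 = c → L - L₂ = (X (Sum.inl a) - X (Sum.inl b)) * L') ∧ (c < c' + 1 → L = L₂) ∧
      (c' + 1 < c → (X (Sum.inl a) - X (Sum.inl b)) * L' = 0) := by
  obtain ⟨κ, hκ, hl⟩ := hH
  obtain ⟨κ₂, hκ₂, hl₂⟩ := hH'
  obtain ⟨κ', hκ', hl'⟩ := hS
  have h1 : monomial (rowPair a b 0 1) 1 * κ' + monomial (rowPair a b d 0) 1 * κ₂ =
      monomial (rowPair a b 1 0) 1 * κ' + monomial (rowPair a b 0 d) 1 * κ := by
    apply MvPolynomial.coe_injective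
    simp only [MvPolynomial.coe_add, MvPolynomial.coe_mul, MvPolynomial.coe_monomial, hκ, hκ₂, hκ',
      ← mul_assoc, ← add_mul]
    rw [h]
  have h2 := congrArg oneSub h1
  have ha : (monomial (rowPair a b 1 0) 1 : MvPolynomial (Lab p) ℤ) = X (Sum.inl a) := by
    simp [rowPair, X]
  have hb : (monomial (rowPair a b 0 1) 1 : MvPolynomial (Lab p) ℤ) = X (Sum.inl b) := by
    simp [rowPair, X]
  rw [ha, hb, map_add, map_add, map_mul, map_mul, map_mul oneSub (X (Sum.inl a))] at h2
  have hA := ((isLow_oneSub_monomial (rowPair a b 0 d)).mul hl).add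
    ((isLow_oneSub_monomial (rowPair a b d 0)).mul hl₂).neg
  simp only [zero_add, one_mul, ← sub_eq_add_neg, ← map_mul] at hA
  have hB : IsLow (c' + 1) (Polynomial.X * Polynomial.C (X (Sum.inl a) - X (Sum.inl b)) *
      oneSub κ') ((X (Sum.inl a) - X (Sum.inl b)) * L') := by
    rw [add_comm]
    exact IsLow.mul ⟨Polynomial.C (X (Sum.inl a) - X (Sum.inl b)), by simp, by simp⟩ hl'
  have hAB : oneSub (monomial (rowPair a b 0 d) 1 * κ) - oneSub (monomial (rowPair a b d 0) 1 * κ₂)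
      = Polynomial.X * Polynomial.C (X (Sum.inl a) - X (Sum.inl b)) * oneSub κ' := by
    have e1 : ∀ v, oneSub (X v : MvPolynomial (Lab p) ℤ) =
      1 - Polynomial.X * Polynomial.C (MvPolynomial.X v) := fun v => by simp [oneSub]
    rw [e1, e1] at h2
    rw [map_sub, map_mul, map_mul]
    rw [map_mul] at h2
    linear_combination -h2
  rw [hAB] at hA
  refine ⟨?_, ?_, ?_⟩
  · rintro rfl
    exact hA.unique hB
  · intro hc
    exact sub_eq_zero.1 (hA.unique (hB.of_lt hc))
  · intro hc
    exact hB.unique (hA.of_lt hc)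

end SchubertSupport

namespace SchubertSupport

variable {p : ℕ} {P : Ideal (MatRing p)} {a b : Fin p}

/-- Evaluation of all variables at `1`. -/
noncomputable def evalOne : MvPolynomial (Lab p) ℤ →+* ℤ := eval fun _ => 1

lemma evalOne_cellsForm_pos (D : Finset (Cell p)) : 0 < evalOne (cellsForm D) := by
  rw [cellsForm, map_prod]
  refine Finset.prod_pos fun e _ => ?_
  simp [evalOne, cellForm]

lemma evalOne_sum_cellsForm_pos {ms : Multiset (Finset (Cell p))} (h : ms ≠ 0) :
    0 < evalOne (ms.map cellsForm).sum := by
  induction ms using Multiset.induction_on with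
  | empty => exact absurd rfl h
  | cons D ms ih =>
    rw [Multiset.map_cons, Multiset.sum_cons, map_add]
    have := evalOne_cellsForm_pos D
    rcases eq_or_ne ms 0 with rfl | h0
    · simpa using this
    · have := ih h0
      omega

lemma exists_hasLead_sliceSeries [P.IsPrime] (hP : IsMultihomog P) {B : Finset (Cell p)}
    (hB : (primeMatroid (sweepIdeal a b P)).IsBase (B : Set (Cell p)))
    {L : MvPolynomial (Lab p) ℤ} (hL : HasLead (hilbSeries (sweepIdeal a b P)) Bᶜ.card L)
    {d : ℕ} (hd : 0 < d) :
    ∃ r : ℤ, r ≠ 0 ∧ HasLead (sliceSeries (graphIdeal a b P) a b d) Bᶜ.card (C r * L) := by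
  classical
  set s := (Finset.range d).filter fun k => slice (graphIdeal a b P) k k = sweepIdeal a b P with hs
  refine ⟨s.card, ?_, ?_⟩
  · rw [Ne, Int.natCast_eq_zero, Finset.card_eq_zero]
    refine Finset.ne_empty_of_mem (a := 0) ?_
    rw [hs, Finset.mem_filter, Finset.mem_range]
    exact ⟨hd, slice_graphIdeal_zero⟩
  · have h := HasLead.sum (c := Bᶜ.card) (Finset.range d)
      (fun k => MvPowerSeries.monomial (rowPair a b k (d - 1 - k)) 1 *
        hilbSeries (slice (graphIdeal a b P) k k))
      (fun k => if slice (graphIdeal a b P) k k = sweepIdeal a b P then L else 0) fun k _ => by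
        refine HasLead.monomial_mul ?_ _
        split_ifs with hk
        · rwa [hk]
        · exact hasLead_of_lt (isMultihomog_slice (polyComp_mem_graphIdeal hP) k k)
            (lt_of_le_of_ne (sweepIdeal_le_slice k) (Ne.symm hk)) hB
    rw [← Finset.sum_filter, Finset.sum_const, ← hs] at h
    simpa [sliceSeries, nsmul_eq_mul] using h

/-- Up to nonzero scalars, `g` is zero or the leading form of a stable prime ideal. -/
def IsStableLead (g : MvPolynomial (Lab p) ℤ) : Prop :=
  g = 0 ∨ ∃ (P : Ideal (MatRing p)) (_ : P.IsPrime) (B : Finset (Cell p))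
    (L : MvPolynomial (Lab p) ℤ) (m n : ℤ), IsMultihomog P ∧ Stable P ∧
      (primeMatroid P).IsBase (B : Set (Cell p)) ∧ HasLead (hilbSeries P) Bᶜ.card L ∧
      m ≠ 0 ∧ n ≠ 0 ∧ C m * g = C n * L

lemma exists_large_slice [P.IsPrime] (hab : a ≠ b) (hP : IsMultihomog P)
    (hst : P ≤ sweepIdeal b a P) : ∃ d, 0 < d ∧ slice (graphIdeal a b P) d 0 = P ∧
      slice (graphIdeal a b P) d d = P.comap (swapRows a b) := by
  obtain ⟨d₁, h₁⟩ := exists_slice_bot (P := P) hab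
  obtain ⟨d₂, h₂⟩ := exists_slice_top hab hP hst
  refine ⟨d₁ + d₂ + 1, by omega, ?_, ?_⟩
  · exact le_antisymm (slice_bot_le _) (h₁.trans (slice_mono_bot (by omega) 0))
  · exact le_antisymm (slice_top_le hab hP hst _) (h₂.trans (slice_mono_top (by omega)))

lemma IsStableLead.divDiff {g g' : MvPolynomial (Lab p) ℤ} (hg : IsStableLead g) (i : Fin p)
    (hi : (i : ℕ) + 1 < p)
    (h : (X (Sum.inl i) - X (Sum.inl ⟨i + 1, hi⟩)) * g' =
      g - rename (swapLab i ⟨i + 1, hi⟩) g) : IsStableLead g' := by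
  have hab : i ≠ ⟨i + 1, hi⟩ := fun h => by simp [Fin.ext_iff] at h
  have hX : (X (Sum.inl i) - X (Sum.inl ⟨i + 1, hi⟩) : MvPolynomial (Lab p) ℤ) ≠ 0 := by
    rw [sub_ne_zero]
    exact fun h => hab (Sum.inl_injective (X_injective h))
  obtain rfl | ⟨P, hprime, B, L, m, n, hP, hst, hB, hL, hm, hn, hmn⟩ := hg
  · left
    simpa [hX] using h
  have hC : ∀ {k : ℤ}, k ≠ 0 → (C k : MvPolynomial (Lab p) ℤ) ≠ 0 := fun hk => by simpa using hk
  obtain ⟨d, hd, hbot, htop⟩ := exists_large_slice hab hP (hst i hi)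
  obtain ⟨B', hB'⟩ := exists_base_finset (sweepIdeal i ⟨i + 1, hi⟩ P)
  obtain ⟨ms, -, hms, hL'⟩ := hasLead_prime (isMultihomog_sweepIdeal hP) hB'
  have hL'0 : (ms.map cellsForm).sum ≠ 0 := fun h0 => by
    have := evalOne_sum_cellsForm_pos (ms := ms) (fun h => by simp [h] at hms)
    simp [h0] at this
  obtain ⟨r, hr, hlead⟩ := exists_hasLead_sliceSeries hP hB' hL' hd
  have hid := sliceSeries_identity (a := i) (b := ⟨i + 1, hi⟩) (polyComp_mem_graphIdeal hP)
    mem_graphIdeal_of_X_mul d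
  rw [hbot, htop, hilbSeries_comap_swapRows] at hid
  obtain ⟨h1, h2, h3⟩ := HasLead.compare hL hL.rename_swapLab hlead hid
  have hg' : (X (Sum.inl i) - X (Sum.inl ⟨i + 1, hi⟩)) * (C m * g') =
      C n * (L - rename (swapLab i ⟨i + 1, hi⟩) L) := by
    have h4 := congrArg (rename (swapLab i ⟨i + 1, hi⟩)) hmn
    rw [map_mul, map_mul, rename_C, rename_C] at h4
    linear_combination C m * h + hmn - h4
  rcases lt_trichotomy (B'ᶜ.card + 1) Bᶜ.card with hlt | heq | hgt
  · have := h3 hlt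
    exact absurd this (mul_ne_zero hX (mul_ne_zero (hC hr) hL'0))
  · right
    refine ⟨_, inferInstance, B', _, m, n * r, isMultihomog_sweepIdeal hP,
      stable_sweepIdeal hP hst i hi, hB', hL', hm, mul_ne_zero hn hr, ?_⟩
    rw [h1 heq] at hg'
    refine mul_left_cancel₀ hX ?_
    rw [hg', C_mul]
    ring
  · left
    rw [← h2 hgt, sub_self, mul_zero] at hg'
    simpa [hX, hm] using hg'

end SchubertSupport

namespace SchubertSupport

variable {p : ℕ}

/-! ### Coordinate subspaces -/

/-- The ideal generated by the variables in `D`. -/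
noncomputable def coordIdeal (D : Finset (Cell p)) : Ideal (MatRing p) :=
  Ideal.span (X '' (D : Set (Cell p)))

lemma mem_coordIdeal {D : Finset (Cell p)} {f : MatRing p} :
    f ∈ coordIdeal D ↔ ∀ x ∈ f.support, ∃ e ∈ D, x e ≠ 0 := by
  rw [coordIdeal, mem_ideal_span_X_image]
  rfl

lemma isMultihomog_coordIdeal (D : Finset (Cell p)) : IsMultihomog (coordIdeal D) := by
  classical
  intro f hf n
  rw [mem_coordIdeal] at hf ⊢
  intro x hx
  refine hf x ?_
  rw [mem_support_iff, coeff_weightedHomogeneousComponent] at hx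
  rw [mem_support_iff]
  exact fun h => hx (by simp [h])

instance (D : Finset (Cell p)) : (coordIdeal D).IsPrime := by
  classical
  let φ : MatRing p →ₐ[ℚ] MatRing p := aeval fun e => if e ∈ D then 0 else X e
  have h : coordIdeal D = RingHom.ker φ := by
    apply le_antisymm
    · rw [coordIdeal, Ideal.span_le]
      rintro _ ⟨e, he, rfl⟩
      simp [φ, RingHom.mem_ker, Finset.mem_coe.1 he]
    · intro f hf
      have hmk : (Ideal.Quotient.mkₐ ℚ (coordIdeal D)).comp φ =
          Ideal.Quotient.mkₐ ℚ (coordIdeal D) := by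
        ext e
        by_cases he : e ∈ D
        · have : (X e : MatRing p) ∈ coordIdeal D := Ideal.subset_span ⟨e, he, rfl⟩
          simp [φ, he, (Ideal.Quotient.eq_zero_iff_mem).2 this]
        · simp [φ, he]
      have := DFunLike.congr_fun hmk f
      rw [AlgHom.comp_apply, show φ f = 0 from hf, map_zero] at this
      exact Ideal.Quotient.eq_zero_iff_mem.1 this.symm
  rw [h]
  exact RingHom.ker_isPrime _

lemma isBase_coordIdeal_iff {D B : Finset (Cell p)} :
    (primeMatroid (coordIdeal D)).IsBase (B : Set (Cell p)) ↔ B = Dᶜ := by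
  classical
  have h1 : (primeMatroid (coordIdeal D)).Indep ((Dᶜ : Finset (Cell p)) : Set (Cell p)) := by
    rw [← indepMod_iff]
    intro f hf hv
    rw [← support_eq_empty, Finset.eq_empty_iff_forall_notMem]
    intro x hx
    obtain ⟨e, he, hxe⟩ := mem_coordIdeal.1 hf x hx
    have := hv ((mem_vars_iff_mem_support e).2 ⟨x, hx, Finsupp.mem_support_iff.2 hxe⟩)
    exact Finset.mem_compl.1 this he
  have h2 : ∀ {F : Finset (Cell p)}, (primeMatroid (coordIdeal D)).Indep (F : Set (Cell p)) →
      F ⊆ Dᶜ := by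
    intro F hF e he
    rw [← indepMod_iff] at hF
    rw [Finset.mem_compl]
    intro heD
    exact X_ne_zero e (hF (X e) (Ideal.subset_span ⟨e, heD, rfl⟩) (by simpa using he))
  constructor
  · intro hB
    exact Finset.coe_injective (hB.eq_of_subset_indep h1 (Finset.coe_subset.2 (h2 hB.indep)))
  · rintro rfl
    obtain ⟨B', hB'⟩ := exists_base_finset (coordIdeal D)
    exact isBase_of_indep_card h1 hB' (Finset.card_le_card (h2 hB'.indep))

/-- Sets of cells closed under moving to the previous row. -/
lemma stable_coordIdeal {D : Finset (Cell p)}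
    (hD : ∀ (k : Fin p) (h : (k : ℕ) + 1 < p) (j : Fin p), (⟨k + 1, h⟩, j) ∈ D → (k, j) ∈ D) :
    Stable (coordIdeal D) := by
  intro k hk
  rw [coordIdeal, Ideal.span_le]
  rintro _ ⟨⟨i, j⟩, he, rfl⟩
  rw [SetLike.mem_coe, mem_sweepIdeal]
  have hmem : ∀ e ∈ D, Polynomial.C (X e : MatRing p) ∈ (coordIdeal D).map Polynomial.C :=
    fun e he => Ideal.mem_map_of_mem _ (Ideal.subset_span ⟨e, he, rfl⟩)
  simp only [sweep, aeval_X, rowAdd]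
  split_ifs with h
  · subst h
    exact Ideal.add_mem _ (hmem _ he) (Ideal.mul_mem_left _ _ (hmem _ (hD k hk j he)))
  · exact hmem _ he

lemma isStableLead_cellsForm {D : Finset (Cell p)}
    (hD : ∀ (k : Fin p) (h : (k : ℕ) + 1 < p) (j : Fin p), (⟨k + 1, h⟩, j) ∈ D → (k, j) ∈ D) :
    IsStableLead (cellsForm D) := by
  classical
  right
  have hB := isBase_coordIdeal_iff.2 (rfl : (Dᶜ : Finset (Cell p)) = Dᶜ)
  obtain ⟨ms, h1, h2, h3⟩ := hasLead_prime (isMultihomog_coordIdeal D) hB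
  refine ⟨coordIdeal D, inferInstance, Dᶜ, _, ms.card, 1, isMultihomog_coordIdeal D,
    stable_coordIdeal hD, hB, h3, ?_, one_ne_zero, ?_⟩
  · rw [Ne, Int.natCast_eq_zero, Multiset.card_eq_zero]
    rintro rfl
    simp at h2
  · have : ms = Multiset.replicate ms.card D := Multiset.eq_replicate_card.2 fun E hE =>
      compl_injective (isBase_coordIdeal_iff.1 (h1 E hE))
    rw [this]
    simp [nsmul_eq_mul]

/-! ### Double Schubert polynomials as leading forms -/

/-- Change the sign of the column variables. -/
noncomputable def negCol : MvPolynomial (Lab p) ℤ →ₐ[ℤ] MvPolynomial (Lab p) ℤ :=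
  aeval (Sum.elim (fun i => X (Sum.inl i)) (fun j => -X (Sum.inr j)))

lemma swapLab_inl (a b v : Fin p) : swapLab a b (Sum.inl v) = Sum.inl (Equiv.swap a b v) := rfl

lemma swapLab_inr (a b v : Fin p) : swapLab a b (Sum.inr v) = Sum.inr v := rfl

lemma negCol_rename_swapLab (a b : Fin p) (f : MvPolynomial (Lab p) ℤ) :
    negCol (rename (swapLab a b) f) = rename (swapLab a b) (negCol f) := by
  induction f using MvPolynomial.induction_on with
  | C r => simp [negCol]
  | add f g hf hg => simp only [map_add, hf, hg]
  | mul_X f v hf =>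
    simp only [map_mul, hf, rename_X]
    congr 1
    rcases v with v | v <;> simp [negCol, swapLab_inl, swapLab_inr]

lemma swap_lt_swap {i j : Fin p} (hij : (j : ℕ) = i + 1) {x y : Fin p} (hxy : x < y)
    (h : ¬ (x = i ∧ y = j)) : Equiv.swap i j x < Equiv.swap i j y := by
  simp only [Equiv.swap_apply_def, Fin.ext_iff, Fin.lt_def] at *
  split_ifs <;> omega

lemma permLength_lt_swap_mul {π : Equiv.Perm (Fin p)} {i j : Fin p} (hij : (j : ℕ) = i + 1)
    (h : π⁻¹ i < π⁻¹ j) : permLength π < permLength (Equiv.swap i j * π) := by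
  unfold permLength
  refine Finset.card_lt_card (Finset.ssubset_iff_of_subset ?_ |>.2 ⟨(π⁻¹ i, π⁻¹ j), ?_, ?_⟩)
  · intro q hq
    rw [Finset.mem_filter] at hq ⊢
    refine ⟨Finset.mem_univ _, hq.2.1, swap_lt_swap hij hq.2.2 ?_⟩
    rintro ⟨hi, hj⟩
    rw [← hi, ← hj, Equiv.Perm.inv_def, Equiv.symm_apply_apply, Equiv.symm_apply_apply] at h
    exact hq.2.1.asymm h
  · have : i < j := by rw [Fin.lt_def]; omega
    rw [Finset.mem_filter]
    exact ⟨Finset.mem_univ _, h, by simpa using this⟩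
  · have : i < j := by rw [Fin.lt_def]; omega
    simpa using fun _ => this.le

lemma eq_revPerm_of_antitone {π : Equiv.Perm (Fin p)}
    (h : ∀ (i : Fin p) (hi : (i : ℕ) + 1 < p), π⁻¹ ⟨i + 1, hi⟩ < π⁻¹ i) : π = Fin.revPerm := by
  cases p with
  | zero => exact Subsingleton.elim _ _
  | succ n =>
    have hanti : StrictAnti (π⁻¹ : Equiv.Perm (Fin (n + 1))) :=
      Fin.strictAnti_iff_succ_lt.2 fun i =>
      h i.castSucc (by simp)
    have hmono : StrictMono fun i => π⁻¹ (Fin.rev i) := fun i j hij =>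
      hanti (Fin.rev_lt_rev.2 hij)
    have hid : ∀ i, π⁻¹ (Fin.rev i) = i := by
      intro i
      have := Subsingleton.elim (StrictMono.orderIsoOfSurjective _ hmono fun x =>
        ⟨Fin.rev (π x), by simp⟩) (OrderIso.refl _)
      exact DFunLike.congr_fun this i
    exact Equiv.ext fun i => (Equiv.Perm.inv_eq_iff_eq.1 (hid i)).symm

theorem isStableLead_doubleSchubert {𝔖 : Equiv.Perm (Fin p) → MvPolynomial (Fin p ⊕ Fin p) ℤ}
    (h𝔖 : IsDoubleSchubertFamily p 𝔖) (π : Equiv.Perm (Fin p)) : IsStableLead (negCol (𝔖 π)) := by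
  have hle : ∀ π : Equiv.Perm (Fin p), permLength π ≤ Fintype.card (Fin p × Fin p) :=
    fun π => Finset.card_le_univ _
  induction hn : Fintype.card (Fin p × Fin p) - permLength π using Nat.strong_induction_on
    generalizing π with
  | _ n ih =>
    by_cases hπ : ∀ (i : Fin p) (hi : (i : ℕ) + 1 < p), π⁻¹ ⟨i + 1, hi⟩ < π⁻¹ i
    · rw [eq_revPerm_of_antitone hπ, h𝔖.1, map_prod]
      have hD := isStableLead_cellsForm (p := p)
        (D := Finset.univ.filter fun q => (q.1 : ℕ) + (q.2 : ℕ) + 2 ≤ p) (by simp; omega)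
      convert hD using 1
      refine Finset.prod_congr rfl fun e _ => ?_
      simp [negCol, cellForm]
    · push Not at hπ
      obtain ⟨i, hi, hlt⟩ := hπ
      have hlt' : π⁻¹ i < π⁻¹ ⟨i + 1, hi⟩ := lt_of_le_of_ne hlt fun h => by
        have := π⁻¹.injective h
        simp [Fin.ext_iff] at this
      have hlen := permLength_lt_swap_mul (i := i) (j := ⟨i + 1, hi⟩) rfl hlt'
      have hσ := ih _ (by have := hle (Equiv.swap i ⟨i + 1, hi⟩ * π); omega)
        (Equiv.swap i ⟨i + 1, hi⟩ * π) rfl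
      have hrec := h𝔖.2 (Equiv.swap i ⟨i + 1, hi⟩ * π) i hi
      rw [← mul_assoc, Equiv.swap_mul_self, one_mul] at hrec
      have hneg := congrArg negCol (hrec hlen)
      change _ = negCol (_ - rename (swapLab i ⟨i + 1, hi⟩) _) at hneg
      rw [map_mul, map_sub, map_sub, negCol_rename_swapLab] at hneg
      refine hσ.divDiff i hi (Eq.trans ?_ hneg)
      simp [negCol]

end SchubertSupport

namespace SchubertSupport

variable {p : ℕ}

/-! ### Supports of leading forms -/

/-- The label of a cell together with the choice of its row or of its column. -/
def choiceLabel : Cell p ⊕ Cell p → Lab p := Sum.map Prod.fst Prod.snd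

/-- The vector counting the labels in a finite set. -/
noncomputable def labelCount {α σ : Type*} (lab : α → σ) (S : Finset α) : σ →₀ ℕ :=
  ∑ x ∈ S, Finsupp.single (lab x) 1

lemma degree_labelCount {α σ : Type*} (lab : α → σ) (S : Finset α) :
    (labelCount lab S).degree = S.card := by
  simp [labelCount]

lemma exists_mem_sdiff_of_labelCount_lt {α σ : Type*} [DecidableEq α] {lab : α → σ}
    {A B : Finset α} {i : σ} (h : labelCount lab B i < labelCount lab A i) :
    ∃ x ∈ A, x ∉ B ∧ lab x = i := by
  classical
  by_contra! hno
  refine h.not_ge ?_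
  simp only [labelCount, Finsupp.finsetSum_apply, Finsupp.single_apply, Finset.sum_boole,
    Nat.cast_id]
  refine Finset.card_le_card fun x hx => ?_
  rw [Finset.mem_filter] at hx ⊢
  exact ⟨by_contra fun hB => hno x hx.1 hB hx.2, hx.2⟩

/-- Label counts of the bases of a matroid satisfy the exchange property. -/
lemma exists_isBase_labelCount_exchange {α σ : Type*} [DecidableEq α] (N : Matroid α)
    (lab : α → σ) {A B : Finset α} (hA : N.IsBase (A : Set α)) (hB : N.IsBase (B : Set α)) {i : σ}
    (h : labelCount lab B i < labelCount lab A i) :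
    ∃ (A' : Finset α) (j : σ), N.IsBase (A' : Set α) ∧ labelCount lab A j < labelCount lab B j ∧
      labelCount lab A' + Finsupp.single i 1 = labelCount lab A + Finsupp.single j 1 := by
  classical
  induction hn : (B \ A).card using Nat.strong_induction_on generalizing A i with
  | _ n ih =>
    obtain ⟨x, hxA, hxB, rfl⟩ := exists_mem_sdiff_of_labelCount_lt h
    obtain ⟨y, ⟨hyB, hyA⟩, hbase⟩ := hA.exchange hB
      (e := x) ⟨Finset.mem_coe.2 hxA, fun h => hxB (Finset.mem_coe.1 h)⟩
    rw [Finset.mem_coe] at hyB hyA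
    have hyE : y ∉ A.erase x := fun h => hyA (Finset.mem_of_mem_erase h)
    have hA' : N.IsBase ((insert y (A.erase x) : Finset α) : Set α) := by
      simpa using hbase
    have hcount : labelCount lab (insert y (A.erase x)) + Finsupp.single (lab x) 1 =
        labelCount lab A + Finsupp.single (lab y) 1 := by
      rw [labelCount, Finset.sum_insert hyE, add_assoc, Finset.sum_erase_add _ _ hxA, add_comm]
      rfl
    by_cases hy : labelCount lab A (lab y) < labelCount lab B (lab y)
    · exact ⟨_, _, hA', hy, hcount⟩
    · have happ : ∀ k, labelCount lab (insert y (A.erase x)) k + (if lab x = k then 1 else 0) =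
          labelCount lab A k + if lab y = k then 1 else 0 := fun k => by
        have := DFunLike.congr_fun hcount k
        simpa [Finsupp.single_apply] using this
      have hlt : labelCount lab B (lab y) < labelCount lab (insert y (A.erase x)) (lab y) := by
        have := happ (lab y)
        rw [if_pos rfl] at this
        split_ifs at this with hxy
        · rw [hxy] at h
          omega
        · omega
      obtain ⟨A'', k, hA'', hk, hcount'⟩ := ih _ (by
        rw [← hn]
        refine Finset.card_lt_card (Finset.ssubset_iff_of_subset ?_ |>.2 ⟨y, ?_, ?_⟩)
        · intro z hz
          rw [Finset.mem_sdiff, Finset.mem_insert, Finset.mem_erase] at hz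
          rw [Finset.mem_sdiff]
          refine ⟨hz.1, fun hzA => hz.2 (Or.inr ⟨?_, hzA⟩)⟩
          rintro rfl
          exact hxB hz.1
        · simp [hyA, hyB]
        · simp) hA' hlt rfl
      refine ⟨A'', k, hA'', ?_, ?_⟩
      · have := happ k
        split_ifs at this with h1 h2 h2
        · omega
        · subst h1
          omega
        · subst h2
          omega
        · omega
      · refine add_right_cancel (b := Finsupp.single (lab y) 1) ?_
        rw [add_right_comm, hcount', add_right_comm, hcount, add_right_comm]

lemma cellsForm_eq_sum (D : Finset (Cell p)) :
    cellsForm D = ∑ t ∈ D.powerset, monomial (labelCount choiceLabel (t.disjSum (D \ t))) 1 := by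
  classical
  rw [cellsForm]
  simp only [cellForm]
  rw [Finset.prod_add]
  refine Finset.sum_congr rfl fun t _ => ?_
  rw [labelCount, Finset.sum_disjSum, ← mul_one (1 : ℤ), ← monomial_mul, monomial_sum_one,
    monomial_sum_one]
  rfl

lemma coeff_cellsForm_nonneg (D : Finset (Cell p)) (x : Lab p →₀ ℕ) :
    0 ≤ coeff x (cellsForm D) := by
  classical
  rw [cellsForm_eq_sum, coeff_sum]
  refine Finset.sum_nonneg fun t _ => ?_
  rw [coeff_monomial]
  split_ifs <;> simp

lemma mem_support_cellsForm {D : Finset (Cell p)} {x : Lab p →₀ ℕ} :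
    x ∈ (cellsForm D).support ↔
      ∃ t u, Disjoint t u ∧ t ∪ u = D ∧ labelCount choiceLabel (t.disjSum u) = x := by
  classical
  rw [mem_support_iff, cellsForm_eq_sum, coeff_sum]
  constructor
  · intro h
    obtain ⟨t, ht, htx⟩ := Finset.exists_ne_zero_of_sum_ne_zero h
    rw [coeff_monomial] at htx
    exact ⟨t, D \ t, Finset.disjoint_sdiff, Finset.union_sdiff_of_subset (Finset.mem_powerset.1 ht),
      by_contra fun hne => htx (if_neg hne)⟩
  · rintro ⟨t, u, hd, rfl, hx⟩
    refine (Finset.sum_pos' (fun s _ => ?_) ⟨t, Finset.mem_powerset.2 Finset.subset_union_left,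
      ?_⟩).ne'
    · rw [coeff_monomial]
      split_ifs <;> simp
    · rw [Finset.union_sdiff_cancel_left hd, hx, coeff_monomial, if_pos rfl]
      exact one_pos

lemma mem_support_sum_cellsForm {ms : Multiset (Finset (Cell p))} {x : Lab p →₀ ℕ} :
    x ∈ (ms.map cellsForm).sum.support ↔ ∃ D ∈ ms, x ∈ (cellsForm D).support := by
  classical
  have hnn : ∀ ms : Multiset (Finset (Cell p)), 0 ≤ coeff x (ms.map cellsForm).sum := by
    intro ms
    induction ms using Multiset.induction_on with
    | empty => simp
    | cons D ms ih =>
      rw [Multiset.map_cons, Multiset.sum_cons, coeff_add]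
      exact add_nonneg (coeff_cellsForm_nonneg D x) ih
  induction ms using Multiset.induction_on with
  | empty => simp
  | cons D ms ih =>
    rw [Multiset.map_cons, Multiset.sum_cons]
    simp only [Multiset.mem_cons, exists_eq_or_imp]
    refine Iff.trans ?_ (or_congr_right ih)
    simp only [mem_support_iff, coeff_add]
    have := hnn ms
    have := coeff_cellsForm_nonneg D x
    omega

/-- The matroid of complements of bases, each of whose cells is labelled by its row or column. -/
noncomputable def choiceMatroid (P : Ideal (MatRing p)) [P.IsPrime] : Matroid (Cell p ⊕ Cell p) :=
  ((primeMatroid P)✶).comap (Sum.elim id id)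

variable {P : Ideal (MatRing p)} [P.IsPrime]

lemma isBase_choiceMatroid_iff {t u : Finset (Cell p)} :
    (choiceMatroid P).IsBase ((t.disjSum u : Finset _) : Set (Cell p ⊕ Cell p)) ↔
      Disjoint t u ∧ (primeMatroid P).IsBase (((t ∪ u)ᶜ : Finset (Cell p)) : Set (Cell p)) := by
  classical
  have himg : Sum.elim id id '' ((t.disjSum u : Finset _) : Set (Cell p ⊕ Cell p)) =
      ((t ∪ u : Finset (Cell p)) : Set (Cell p)) := by
    ext e
    simp
  have hinj : Set.InjOn (Sum.elim id id) ((t.disjSum u : Finset _) : Set (Cell p ⊕ Cell p)) ↔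
      Disjoint t u := by
    rw [Finset.disjoint_left]
    constructor
    · intro h e ht hu
      have := h (x₁ := Sum.inl e) (x₂ := Sum.inr e) (by simpa using ht) (by simpa using hu) rfl
      simp at this
    · rintro h (a | a) ha (b | b) hb hab <;> simp at ha hb hab <;> subst hab
      · rfl
      · exact absurd hb (h ha)
      · exact absurd ha (h hb)
      · rfl
  rw [choiceMatroid, Matroid.comap_isBase_iff, himg, hinj]
  have hE : Sum.elim id id '' (Sum.elim id id ⁻¹' (primeMatroid P)✶.E) = (primeMatroid P)✶.E := by
    rw [Set.image_preimage_eq]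
    exact fun e => ⟨Sum.inl e, rfl⟩
  rw [hE, Matroid.isBasis_ground_iff, Matroid.dual_ground, primeMatroid_ground, Set.preimage_univ,
    Matroid.dual_isBase_iff', primeMatroid_ground, ← Set.compl_eq_univ_sdiff, ← Finset.coe_compl]
  simp [and_comm]

/-- The support of the leading form of a prime ideal. -/
lemma mem_support_lead_iff (hP : IsMultihomog P) {B : Finset (Cell p)}
    (hB : (primeMatroid P).IsBase (B : Set (Cell p))) {L : MvPolynomial (Lab p) ℤ}
    (hL : HasLead (hilbSeries P) Bᶜ.card L) {x : Lab p →₀ ℕ} :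
    x ∈ L.support ↔ ∃ S : Finset (Cell p ⊕ Cell p),
      (choiceMatroid P).IsBase (S : Set (Cell p ⊕ Cell p)) ∧ labelCount choiceLabel S = x := by
  classical
  constructor
  · obtain ⟨ms, h1, h2, h3⟩ := hasLead_prime hP hB
    rw [hL.unique h3, mem_support_sum_cellsForm]
    rintro ⟨D, hD, hx⟩
    obtain ⟨t, u, hd, rfl, hcount⟩ := mem_support_cellsForm.1 hx
    exact ⟨_, isBase_choiceMatroid_iff.2 ⟨hd, h1 _ hD⟩, hcount⟩
  · rintro ⟨S, hS, hx⟩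
    rw [← Finset.toLeft_disjSum_toRight (u := S)] at hS hx
    obtain ⟨hd, hS⟩ := isBase_choiceMatroid_iff.1 hS
    obtain ⟨ms, h1, h2, h3⟩ := hasLead_prime hP hS
    have hcard := hS.ncard_eq_ncard_of_isBase hB
    rw [Set.ncard_coe_finset, Set.ncard_coe_finset] at hcard
    rw [Finset.card_compl, hcard, ← Finset.card_compl] at h3
    rw [compl_compl] at h2
    rw [hL.unique h3, mem_support_sum_cellsForm]
    exact ⟨_, h2, mem_support_cellsForm.2 ⟨_, _, hd, rfl, hx⟩⟩

lemma support_negCol (f : MvPolynomial (Lab p) ℤ) : (negCol f).support = f.support := by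
  classical
  have key : ∀ x, ∃ r : ℤ, r ≠ 0 ∧ coeff x (negCol f) = r * coeff x f := by
    intro x
    refine ⟨∏ v, (Sum.elim (fun _ => 1) (fun _ => -1) v : ℤ) ^ x v, ?_, ?_⟩
    · refine Finset.prod_ne_zero_iff.2 fun v _ => pow_ne_zero _ ?_
      rcases v with v | v <;> simp
    · induction f using MvPolynomial.induction_on' with
      | add f g hf hg => rw [map_add, coeff_add, coeff_add, hf, hg, mul_add]
      | monomial y c =>
        have : negCol (monomial y c) =
            C (∏ v, (Sum.elim (fun _ => 1) (fun _ => -1) v : ℤ) ^ y v) * monomial y c := by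
          rw [negCol, aeval_monomial, monomial_eq (a := c), mul_left_comm]
          congr 1
          rw [Finsupp.prod_fintype _ _ (by simp), Finsupp.prod_fintype _ _ (by simp), map_prod,
            ← Finset.prod_mul_distrib]
          refine Finset.prod_congr rfl fun v _ => ?_
          rw [map_pow, ← mul_pow]
          rcases v with v | v <;> simp
        rw [this, coeff_C_mul, coeff_monomial]
        split_ifs with h
        · rw [h]
        · simp
  ext x
  obtain ⟨r, hr, hx⟩ := key x
  rw [mem_support_iff, mem_support_iff, hx, mul_ne_zero_iff]
  exact and_iff_right hr

/-- Supports of leading forms of prime ideals are discrete polymatroids. -/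
lemma IsStableLead.support_exchange {g : MvPolynomial (Lab p) ℤ} (hg : IsStableLead g)
    {a b : Lab p →₀ ℕ} (ha : a ∈ g.support) (hb : b ∈ g.support) :
    a.degree = b.degree ∧ ∀ i, b i < a i →
      ∃ j, a j < b j ∧ a - Finsupp.single i 1 + Finsupp.single j 1 ∈ g.support := by
  classical
  rcases hg with rfl | ⟨P, _, B, L, m, n, hP, -, hB, hL, hm, hn, heq⟩
  · simp at ha
  have hsupp : ∀ x, x ∈ g.support ↔ ∃ S : Finset (Cell p ⊕ Cell p),
      (choiceMatroid P).IsBase (S : Set (Cell p ⊕ Cell p)) ∧ labelCount choiceLabel S = x := by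
    intro x
    rw [← mem_support_lead_iff hP hB hL, mem_support_iff, mem_support_iff]
    have := congrArg (coeff x) heq
    rw [coeff_C_mul, coeff_C_mul] at this
    rw [← mul_ne_zero_iff_left hm, this, mul_ne_zero_iff_left hn]
  obtain ⟨A, hA, rfl⟩ := (hsupp a).1 ha
  obtain ⟨B', hB', rfl⟩ := (hsupp b).1 hb
  constructor
  · rw [degree_labelCount, degree_labelCount]
    simpa using hA.ncard_eq_ncard_of_isBase hB'
  · intro i hi
    obtain ⟨A', j, hA', hj, hc⟩ := exists_isBase_labelCount_exchange _ choiceLabel hA hB' hi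
    refine ⟨j, hj, (hsupp _).2 ⟨A', hA', ?_⟩⟩
    refine add_right_cancel (b := Finsupp.single i 1) ?_
    rw [hc, add_right_comm, tsub_add_cancel_of_le]
    rw [Finsupp.single_le_iff]
    omega

end SchubertSupport

/-- The support of a double Schubert polynomial consists of points with constant
coordinate sum and satisfies the exchange property (M-convexity) of discrete polymatroids. -/
theorem support_doubleSchubert_exchangeProperty
    (p : ℕ) (hp : 1 ≤ p)
    (𝔖 : Equiv.Perm (Fin p) → MvPolynomial (Fin p ⊕ Fin p) ℤ)
    (h𝔖 : IsDoubleSchubertFamily p 𝔖) (π : Equiv.Perm (Fin p)) :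
    (∀ a ∈ (𝔖 π).support, ∀ b ∈ (𝔖 π).support,
        (∑ v : Fin p ⊕ Fin p, a v) = ∑ v : Fin p ⊕ Fin p, b v) ∧
    (∀ a ∈ (𝔖 π).support, ∀ b ∈ (𝔖 π).support, ∀ i : Fin p ⊕ Fin p, b i < a i →
        ∃ j : Fin p ⊕ Fin p, a j < b j ∧
          a - Finsupp.single i 1 + Finsupp.single j 1 ∈ (𝔖 π).support) := by
  have h := SchubertSupport.isStableLead_doubleSchubert h𝔖 π
  have key := fun a ha b hb => h.support_exchange (a := a) (b := b) ha hb
  rw [SchubertSupport.support_negCol] at key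
  refine ⟨fun a ha b hb => ?_, fun a ha b hb => (key a ha b hb).2⟩
  rw [← Finsupp.degree_eq_sum, ← Finsupp.degree_eq_sum]
  exact (key a ha b hb).1
end

section
/- Let I ⊆ R be an R-homogeneous ideal and let J = φ(I)S be its standardization. Then codim(I) = codim(J), i.e., the height of I in R equals the height of J in S. -/
open MvPolynomial

/-- The standardization map `φ : R = k[x_{ij}] → S = k[w_{ij}, z_{ij}]`, `x_{ij} ↦ w_{ij}z_{ij}`.
Here the variables of `S` are indexed by `(Fin p × Fin p) ⊕ (Fin p × Fin p)`, where
`Sum.inl (i,j)` is `w_{ij}` and `Sum.inr (i,j)` is `z_{ij}`. -/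
noncomputable def stdMap (k : Type*) [CommSemiring k] (p : ℕ) :
    MvPolynomial (Fin p × Fin p) k →ₐ[k]
      MvPolynomial ((Fin p × Fin p) ⊕ (Fin p × Fin p)) k :=
  MvPolynomial.aeval fun q : Fin p × Fin p => X (Sum.inl q) * X (Sum.inr q)

/-- The weight function giving the `ℤ^p ⊕ ℤ^p`-grading of `R = k[x_{ij}]`,
where `deg (x_{ij}) = e_i ⊕ e_j`. -/
def wtR (p : ℕ) : Fin p × Fin p → (Fin p → ℕ) × (Fin p → ℕ) :=
  fun q => (Pi.single q.1 1, Pi.single q.2 1)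

/-- An ideal `I ⊆ R = k[x_{ij}]` is homogeneous with respect to the `ℤ^p ⊕ ℤ^p`-grading
with `deg (x_{ij}) = e_i ⊕ e_j` iff it contains all the multihomogeneous components of
each of its elements. -/
def IsMultigradedHomogeneous {k : Type*} [CommSemiring k] {p : ℕ}
    (I : Ideal (MvPolynomial (Fin p × Fin p) k)) : Prop :=
  ∀ f ∈ I, ∀ d : (Fin p → ℕ) × (Fin p → ℕ),
    MvPolynomial.weightedHomogeneousComponent (wtR p) d f ∈ I

/-- An integral homomorphism inducing a surjection on spectra preserves the Krull dimension. -/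
lemma RingHom.IsIntegral.ringKrullDim_eq {A B : Type*} [CommRing A] [CommRing B] {f : A →+* B}
    (hf : f.IsIntegral) (hs : Function.Surjective (PrimeSpectrum.comap f)) :
    ringKrullDim B = ringKrullDim A := by
  algebraize [f]
  refine le_antisymm (Order.krullDim_le_of_strictMono (PrimeSpectrum.comap f) fun P Q h ↦ ?_)
    (iSup_le fun l ↦ ?_)
  · exact Ideal.IsIntegral.comap_lt_comap (R := A) (I := P.asIdeal) (J := Q.asIdeal) h
  · obtain ⟨P, hP⟩ := hs l.head
    have : P.asIdeal.LiesOver (RelSeries.head l).asIdeal :=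
      ⟨(congrArg PrimeSpectrum.asIdeal hP).symm⟩
    obtain ⟨L, hL, -⟩ := Ideal.exists_ltSeries_of_hasGoingUp l P.asIdeal
    exact hL ▸ Order.LTSeries.length_le_krullDim L

/-- If `f : A → B` is integral and `I` contains the kernel of `f`, then `dim B/IB = dim A/I`. -/
lemma RingHom.IsIntegral.ringKrullDim_quotient_map {A B : Type*} [CommRing A] [CommRing B]
    {f : A →+* B} (hf : f.IsIntegral) {I : Ideal A} (hI : RingHom.ker f ≤ I) :
    ringKrullDim (B ⧸ I.map f) = ringKrullDim (A ⧸ I) := by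
  algebraize [f]
  refine RingHom.IsIntegral.ringKrullDim_eq
    (f := Ideal.quotientMap (I.map f) f Ideal.le_comap_map) ?_ fun p ↦ ?_
  · intro x
    obtain ⟨x, rfl⟩ := Ideal.Quotient.mk_surjective x
    obtain ⟨q, hq, hx⟩ := hf x
    refine ⟨q.map (Ideal.Quotient.mk I), hq.map _, ?_⟩
    rw [Polynomial.eval₂_map, Ideal.quotientMap_comp_mk, ← Polynomial.hom_eval₂, hx, map_zero]
  · have hp : I ≤ p.asIdeal.comap (Ideal.Quotient.mk I) := fun x hx ↦ by
      simp [Ideal.Quotient.eq_zero_iff_mem.mpr hx]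
    obtain ⟨Q, -, hQ, hQp⟩ := Ideal.exists_ideal_over_prime_of_isIntegral (S := B)
      (p.asIdeal.comap (Ideal.Quotient.mk I)) ⊥ (hI.trans hp)
    have hJ : I.map f ≤ Q := Ideal.map_le_iff_le_comap.mpr (hQp ▸ hp)
    have hJ' : RingHom.ker (Ideal.Quotient.mk (I.map f)) ≤ Q := by rwa [Ideal.mk_ker]
    refine ⟨⟨Q.map (Ideal.Quotient.mk _),
      Ideal.map_isPrime_of_surjective Ideal.Quotient.mk_surjective hJ'⟩, ?_⟩
    ext x
    obtain ⟨x, rfl⟩ := Ideal.Quotient.mk_surjective x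
    have hx := SetLike.ext_iff.mp hQp x
    have h : Ideal.Quotient.mk (I.map f) (f x) ∈ Q.map (Ideal.Quotient.mk (I.map f)) ↔ f x ∈ Q := by
      rw [← Ideal.mem_comap, Ideal.comap_map_mk hJ]
    simpa [h, RingHom.algebraMap_toAlgebra] using hx

/-- An integral homomorphism out of a domain into a ring of the same finite Krull dimension is
injective. -/
lemma RingHom.IsIntegral.injective_of_ringKrullDim_eq {A B : Type*} [CommRing A] [IsDomain A]
    [CommRing B] {f : A →+* B} (hf : f.IsIntegral) {n : ℕ} (hA : ringKrullDim A = n)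
    (hB : ringKrullDim B = n) : Function.Injective f := by
  refine (injective_iff_map_eq_zero f).mpr fun r hr ↦ by_contra fun hr0 ↦ ?_
  have hdim : ringKrullDim (A ⧸ RingHom.ker f) = n := by
    rw [← hf.ringKrullDim_quotient_map le_rfl, (Ideal.map_eq_bot_iff_le_ker f).mpr le_rfl, ← hB]
    exact ringKrullDim_eq_of_ringEquiv (RingEquiv.quotientBot B)
  have h := ringKrullDim_succ_le_of_surjective (Ideal.Quotient.mk (RingHom.ker f))
    Ideal.Quotient.mk_surjective (mem_nonZeroDivisors_of_ne_zero hr0)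
    (Ideal.Quotient.eq_zero_iff_mem.mpr hr)
  rw [hdim, hA] at h
  exact absurd (by exact_mod_cast h) (Nat.not_succ_le_self n)

/-- If `B` is integral over a polynomial ring `A[t_σ]` contained in it, then
`dim B/IB = dim A/I + #σ` for every ideal `I` of `A`. -/
lemma RingHom.IsIntegral.ringKrullDim_quotient_map_comp_C {A B σ : Type*} [CommRing A]
    [IsNoetherianRing A] [CommRing B] [_root_.Finite σ] {f : MvPolynomial σ A →+* B} (hf : f.IsIntegral)
    (hinj : Function.Injective f) (I : Ideal A) :
    ringKrullDim (B ⧸ I.map (f.comp C)) = ringKrullDim (A ⧸ I) + Nat.card σ := by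
  rw [← Ideal.map_map, hf.ringKrullDim_quotient_map
      (((RingHom.injective_iff_ker_eq_bot f).mp hinj).trans_le bot_le),
    ← ringKrullDim_eq_of_ringEquiv (quotientEquivQuotientMvPolynomial (σ := σ) I).toRingEquiv,
    MvPolynomial.ringKrullDim_of_isNoetherianRing]

/-- The extension of `stdMap` to `R[t_{ij}]` sending `t_{ij}` to `w_{ij} + z_{ij}`. -/
noncomputable def stdMapExt (k : Type*) [CommSemiring k] (p : ℕ) :
    MvPolynomial (Fin p × Fin p) (MvPolynomial (Fin p × Fin p) k) →+*
      MvPolynomial ((Fin p × Fin p) ⊕ (Fin p × Fin p)) k :=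
  eval₂Hom (stdMap k p).toRingHom fun q ↦ X (Sum.inl q) + X (Sum.inr q)

lemma stdMapExt_comp_C (k : Type*) [CommSemiring k] (p : ℕ) :
    (stdMapExt k p).comp C = (stdMap k p).toRingHom :=
  eval₂Hom_comp_C _ _

/-- Both `w_{ij}` and `z_{ij}` are roots of `T² - (w_{ij} + z_{ij}) T + w_{ij} z_{ij}`. -/
lemma stdMapExt_isIntegral (k : Type*) [Field k] (p : ℕ) : (stdMapExt k p).IsIntegral := by
  have hroot (a : (Fin p × Fin p) ⊕ (Fin p × Fin p)) (q : Fin p × Fin p)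
      (ha : a = Sum.inl q ∨ a = Sum.inr q) : (stdMapExt k p).IsIntegralElem (X a) := by
    refine ⟨Polynomial.X ^ 2 +
      (Polynomial.C (-X q : MvPolynomial _ (MvPolynomial _ k)) * Polynomial.X +
      Polynomial.C (C (X q))), ?_, ?_⟩
    · monicity!
    · rcases ha with rfl | rfl <;> simp [stdMapExt, stdMap] <;> ring
  intro f
  induction f using MvPolynomial.induction_on with
  | C a =>
    convert (stdMapExt k p).isIntegralElem_map (x := C (C a)) using 1
    simp [stdMapExt, stdMap]
  | add f g hf hg => exact hf.add _ hg
  | mul_X f a hf =>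
    refine hf.mul _ ?_
    rcases a with q | q
    · exact hroot _ q (Or.inl rfl)
    · exact hroot _ q (Or.inr rfl)

lemma stdMapExt_injective (k : Type*) [Field k] (p : ℕ) : Function.Injective (stdMapExt k p) :=
  (stdMapExt_isIntegral k p).injective_of_ringKrullDim_eq (n := p * p + p * p)
    (by simp) (by simp)

/-- Standardization preserves codimension: `codim I = codim J` where `J = φ(I)S`,
i.e. `dim R - dim R/I = dim S - dim S/J` (stated additively). -/
theorem codim_standardization (p : ℕ) (hp : 1 ≤ p) (k : Type*) [Field k]
    (I : Ideal (MvPolynomial (Fin p × Fin p) k))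
    (hI : IsMultigradedHomogeneous I) :
    ringKrullDim (MvPolynomial (Fin p × Fin p) k ⧸ I) +
        ringKrullDim (MvPolynomial ((Fin p × Fin p) ⊕ (Fin p × Fin p)) k) =
      ringKrullDim (MvPolynomial ((Fin p × Fin p) ⊕ (Fin p × Fin p)) k ⧸
          Ideal.map (stdMap k p) I) +
        ringKrullDim (MvPolynomial (Fin p × Fin p) k) := by
  have hdim := (stdMapExt_isIntegral k p).ringKrullDim_quotient_map_comp_C
    (stdMapExt_injective k p) I
  rw [stdMapExt_comp_C] at hdim
  change _ = ringKrullDim (_ ⧸ Ideal.map (stdMap k p).toRingHom I) + _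
  rw [hdim]
  simp [add_assoc]
end

section
/- Let I ⊆ R be an R-homogeneous ideal and let J = φ(I)S be its standardization. If R/I is a Cohen–Macaulay ring, then S/J is a Cohen–Macaulay ring. -/
open MvPolynomial

/-- The depth of a local ring: the supremum of the lengths of regular sequences
contained in the maximal ideal. -/
noncomputable def localRingDepth (A : Type*) [CommRing A] [IsLocalRing A] : ℕ∞ :=
  sSup {n : ℕ∞ | ∃ rs : List A, (rs.length : ℕ∞) = n ∧
    (∀ a ∈ rs, a ∈ IsLocalRing.maximalIdeal A) ∧ RingTheory.Sequence.IsRegular A rs}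

/-- A (Noetherian) ring `A` is Cohen–Macaulay if for every prime ideal `P` of `A` the
localization `A_P` is a Cohen–Macaulay local ring, i.e. `depth A_P = dim A_P`. -/
def IsCohenMacaulayRing (A : Type*) [CommRing A] : Prop :=
  ∀ (P : Ideal A) (_ : P.IsPrime),
    (localRingDepth (Localization.AtPrime P) : WithBot ℕ∞) =
      ringKrullDim (Localization.AtPrime P)

open RingTheory.Sequence IsLocalRing
open scoped Polynomial

/-- A local ring whose Krull dimension is the length of some regular sequence. -/
def HasMaximalLengthRegularSequence (A : Type*) [CommRing A] : Prop :=
  ∃ rs : List A, IsRegular A rs ∧ (rs.length : WithBot ℕ∞) = ringKrullDim A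

section Module

variable {A : Type*} [CommRing A] [IsLocalRing A] {M N : Type*} [AddCommGroup M] [Module A M]
  [AddCommGroup N] [Module A N]

/-- An element of a regular sequence over a local ring lies in the maximal ideal. -/
theorem mem_maximalIdeal_of_isRegular {rs : List A} (h : IsRegular M rs) {a : A} (ha : a ∈ rs) :
    a ∈ maximalIdeal A := by
  refine le_maximalIdeal (J := Ideal.ofList rs) (fun e => ?_) (Ideal.subset_span ha)
  exact h.2 (by rw [e, Submodule.top_smul])

/-- A finite module over a Noetherian local ring either admits a regular element in the maximal
ideal or has a nonzero element killed by the maximal ideal. -/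
theorem exists_isSMulRegular_or_exists_ne_zero_smul_eq_zero [IsNoetherianRing A]
    [Module.Finite A N] :
    (∃ y ∈ maximalIdeal A, IsSMulRegular N y) ∨
      ∃ u : N, u ≠ 0 ∧ ∀ a ∈ maximalIdeal A, a • u = 0 := by
  by_cases h : ∃ y ∈ maximalIdeal A, IsSMulRegular N y
  · exact .inl h
  right
  push Not at h
  have hsub : (maximalIdeal A : Set A) ⊆ ⋃ p ∈ associatedPrimes A N, (p : Set A) := by
    rw [biUnion_associatedPrimes_eq_compl_regular]
    exact fun y hy => h y hy
  obtain ⟨p, hp, hle⟩ := ((maximalIdeal A).subset_union_prime_finite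
    (associatedPrimes.finite A N) (f := id) 0 0 fun _ h _ _ => h.1).1 hsub
  obtain ⟨hprime, u, hu⟩ := isAssociatedPrime_iff.1 hp
  have hu' : ∀ a, a ∈ p ↔ a • u = 0 := fun a => by
    rw [hu, Submodule.mem_colon_singleton, Submodule.mem_bot]
  refine ⟨u, fun h0 => hprime.ne_top ?_, fun a ha => (hu' a).1 (hle ha)⟩
  rw [Ideal.eq_top_iff_one, hu', h0, smul_zero]

/-- If `x`, `y` is a regular sequence on `M` and `f` is regular on `M`, then no nonzero element
of `M / fM` is killed by both `x` and `y`. -/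
theorem QuotSMulTop.eq_zero_of_smul_eq_zero {A M : Type*} [CommRing A] [AddCommGroup M]
    [Module A M] {x f y : A} (hx : IsSMulRegular M x)
    (hf : IsSMulRegular M f) (hy : IsSMulRegular (QuotSMulTop x M) y)
    {u : QuotSMulTop f M} (hxu : x • u = 0) (hyu : y • u = 0) : u = 0 := by
  obtain ⟨u, rfl⟩ := Submodule.Quotient.mk_surjective _ u
  rw [← Submodule.Quotient.mk_smul, Submodule.Quotient.mk_eq_zero,
    Submodule.mem_smul_pointwise_iff_exists] at hxu hyu
  obtain ⟨v, -, hv⟩ := hxu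
  obtain ⟨w, -, hw⟩ := hyu
  have hyv : y • v = x • w := hf <| by
    change f • y • v = f • x • w
    rw [smul_comm f y, hv, smul_comm f x, hw, smul_comm]
  have hv0 : (Submodule.Quotient.mk v : QuotSMulTop x M) = 0 := by
    apply hy.right_eq_zero_of_smul
    rw [← Submodule.Quotient.mk_smul, hyv, Submodule.Quotient.mk_eq_zero]
    exact Submodule.smul_mem_pointwise_smul _ _ _ trivial
  rw [Submodule.Quotient.mk_eq_zero, Submodule.mem_smul_pointwise_iff_exists] at hv0 ⊢
  obtain ⟨t, -, ht⟩ := hv0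
  refine ⟨t, trivial, hx ?_⟩
  change x • f • t = x • u
  rw [smul_comm, ht, hv]

/-- Over a Noetherian local ring, if a finite module admits a regular sequence of length `n + 1`,
then its quotient by any regular element of the maximal ideal admits one of length `n`. -/
theorem exists_isRegular_quotSMulTop [IsNoetherianRing A] {f : A} (hfm : f ∈ maximalIdeal A)
    (n : ℕ) {M : Type*} [AddCommGroup M] [Module A M] [Module.Finite A M]
    (hf : IsSMulRegular M f) {rs : List A} (hrs : IsRegular M rs) (hn : rs.length = n + 1) :
    ∃ rs' : List A, IsRegular (QuotSMulTop f M) rs' ∧ rs'.length = n := by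
  induction n generalizing f M rs with
  | zero =>
    have := hrs.nontrivial
    have := nontrivial_quotSMulTop_of_mem_maximalIdeal M hfm
    exact ⟨[], .nil A _, rfl⟩
  | succ n ih =>
    obtain _ | ⟨x, _ | ⟨z, rest⟩⟩ := rs
    · simp at hn
    · simp at hn
    have hxm := mem_maximalIdeal_of_isRegular hrs (a := x) (by simp)
    have hzm := mem_maximalIdeal_of_isRegular hrs (a := z) (by simp)
    obtain ⟨hx, hzrest⟩ := (isRegular_cons_iff M x (z :: rest)).1 hrs
    have hz := ((isRegular_cons_iff _ z rest).1 hzrest).1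
    have hn' : (z :: rest).length = n + 1 := by simpa using hn
    obtain ⟨y, hym, hy⟩ : ∃ y ∈ maximalIdeal A,
        IsSMulRegular (QuotSMulTop x M × QuotSMulTop f M) y := by
      refine exists_isSMulRegular_or_exists_ne_zero_smul_eq_zero.resolve_right ?_
      rintro ⟨⟨u₁, u₂⟩, hu, hkill⟩
      refine hu (Prod.ext ?_ ?_)
      · exact hz.right_eq_zero_of_smul (congrArg Prod.fst (hkill z hzm))
      · exact QuotSMulTop.eq_zero_of_smul_eq_zero hx hf hz (congrArg Prod.snd (hkill x hxm))
          (congrArg Prod.snd (hkill z hzm))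
    have hyx : IsSMulRegular (QuotSMulTop x M) y := fun a b h =>
      congrArg Prod.fst (@hy (a, 0) (b, 0) (Prod.ext h rfl))
    have hyf : IsSMulRegular (QuotSMulTop f M) y := fun a b h =>
      congrArg Prod.snd (@hy (0, a) (0, b) (Prod.ext rfl h))
    obtain ⟨t, ht, htn⟩ := ih hym hyx hzrest hn'
    have hyxt : IsRegular M (y :: x :: t) :=
      IsLocalRing.isRegular_of_perm (.cons hx (.cons hyx ht)) (List.Perm.swap _ _ _)
    obtain ⟨hyM, hxt⟩ := (isRegular_cons_iff M y _).1 hyxt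
    have hfy : IsSMulRegular (QuotSMulTop y M) f := by
      have : IsWeaklyRegular M [y, f] :=
        IsLocalRing.isWeaklyRegular_of_perm_of_subset_maximalIdeal (rs := [f, y])
          (.cons hf (.cons hyf (.nil A _))) (List.Perm.swap _ _ _) (by
            rintro r hr
            rcases List.mem_pair.1 hr with rfl | rfl <;> assumption)
      exact ((isWeaklyRegular_cons_iff _ _ _).1 ((isWeaklyRegular_cons_iff _ _ _).1 this).2).1
    obtain ⟨s, hs, hsn⟩ := ih hfm hfy hxt (by simp [htn])
    have hfys : IsRegular M (f :: y :: s) :=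
      IsLocalRing.isRegular_of_perm (.cons hyM (.cons hfy hs)) (List.Perm.swap _ _ _)
    exact ⟨y :: s, ((isRegular_cons_iff M f _).1 hfys).2, by simp [hsn]⟩

end Module

section Local

variable {A B : Type*} [CommRing A] [CommRing B]

theorem HasMaximalLengthRegularSequence.of_ringEquiv (h : HasMaximalLengthRegularSequence A)
    (e : A ≃+* B) : HasMaximalLengthRegularSequence B := by
  obtain ⟨rs, hrs, hlen⟩ := h
  refine ⟨rs.map e, ?_, ?_⟩
  · refine (AddEquiv.isRegular_congr (e := e.toAddEquiv) (as := rs) ?_).1 hrs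
    rw [List.forall₂_map_right_iff]
    exact List.forall₂_same.2 fun r _ x => map_mul e r x
  · rw [List.length_map, hlen, ringKrullDim_eq_of_ringEquiv e]

theorem localRingDepth_eq_ringKrullDim_iff [IsLocalRing A] [IsNoetherianRing A] :
    (localRingDepth A : WithBot ℕ∞) = ringKrullDim A ↔ HasMaximalLengthRegularSequence A := by
  constructor
  · intro h
    have hlt : localRingDepth A < ⊤ := by
      rw [← WithBot.coe_lt_coe, h]
      exact ringKrullDim_lt_top
    have : Nonempty {n : ℕ∞ | ∃ rs : List A, (rs.length : ℕ∞) = n ∧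
        (∀ a ∈ rs, a ∈ maximalIdeal A) ∧ IsRegular A rs} :=
      ⟨0, [], by simp, by simp, .nil A A⟩
    obtain ⟨rs, hlen, -, hrs⟩ := ENat.sSup_mem_of_nonempty_of_lt_top hlt
    refine ⟨rs, hrs, ?_⟩
    rw [← h, localRingDepth, ← hlen]
    rfl
  · rintro ⟨rs, hrs, hlen⟩
    refine le_antisymm ?_ ?_
    · rw [← maximalIdeal_height_eq_ringKrullDim, WithBot.coe_le_coe]
      refine sSup_le ?_
      rintro _ ⟨ss, rfl, -, hss⟩
      rw [← WithBot.coe_le_coe, maximalIdeal_height_eq_ringKrullDim,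
        ← ringKrullDim_add_length_eq_ringKrullDim_of_isRegular ss hss]
      have : Nontrivial (A ⧸ Ideal.ofList ss) := by
        refine Ideal.Quotient.nontrivial_iff.2 fun e => hss.2 ?_
        rw [e, Submodule.top_smul]
      exact le_add_of_nonneg_left ringKrullDim_nonneg_of_nontrivial
    · rw [← hlen]
      exact WithBot.coe_le_coe.2 <|
        le_sSup ⟨rs, rfl, fun a ha => mem_maximalIdeal_of_isRegular hrs ha, hrs⟩

/-- In a Noetherian local ring, being Cohen–Macaulay passes to the quotient by a regular element. -/
theorem HasMaximalLengthRegularSequence.quotient_span_singleton [IsLocalRing A]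
    [IsNoetherianRing A] (h : HasMaximalLengthRegularSequence A) {f : A}
    (hf : IsSMulRegular A f) (hfm : f ∈ maximalIdeal A) :
    HasMaximalLengthRegularSequence (A ⧸ Ideal.span {f}) := by
  obtain ⟨rs, hrs, hlen⟩ := h
  have hdim := ringKrullDim_quotient_span_singleton_succ_eq_ringKrullDim hf hfm
  have : Nontrivial (A ⧸ Ideal.span {f}) :=
    Ideal.Quotient.nontrivial_iff.2 fun e => hfm (Ideal.span_singleton_eq_top.1 e)
  obtain ⟨n, hn⟩ : ∃ n, rs.length = n + 1 := by
    refine Nat.exists_eq_succ_of_ne_zero fun h0 => ?_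
    have h1 : (1 : WithBot ℕ∞) ≤ ringKrullDim A :=
      hdim ▸ le_add_of_nonneg_left ringKrullDim_nonneg_of_nontrivial
    rw [← hlen, h0] at h1
    exact absurd h1 (by decide)
  obtain ⟨ss, hss, hssn⟩ := exists_isRegular_quotSMulTop hfm n hf hrs hn
  refine ⟨ss.map (Ideal.Quotient.mk _), ?_, ?_⟩
  · have e : QuotSMulTop f A ≃ₗ[A] A ⧸ Ideal.span {f} :=
      Submodule.quotEquivOfEq _ _ (by simp [← Submodule.ideal_span_singleton_smul])
    refine (AddEquiv.isRegular_congr (e := e.toAddEquiv) ?_).1 hss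
    rw [List.forall₂_map_right_iff]
    exact List.forall₂_same.2 fun r _ x => map_smul e r x
  · rw [List.length_map, hssn]
    rw [← hlen, hn, Nat.cast_add, Nat.cast_one, ENat.WithBot.add_one_cancel] at hdim
    exact hdim.symm

/-- The localization of `A[X]`, for a Cohen–Macaulay Noetherian local ring `A`, at a prime lying
over the maximal ideal is Cohen–Macaulay. -/
theorem HasMaximalLengthRegularSequence.polynomial_localization [IsLocalRing A]
    [IsNoetherianRing A] (h : HasMaximalLengthRegularSequence A) (p : Ideal A[X]) [p.IsPrime]
    (hp : p.comap Polynomial.C = maximalIdeal A) :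
    HasMaximalLengthRegularSequence (Localization.AtPrime p) := by
  obtain ⟨rs, hrs, hlen⟩ := h
  have hle : (maximalIdeal A).map Polynomial.C ≤ p := by simpa [← hp] using Ideal.map_comap_le
  have hrsC : IsWeaklyRegular A[X] (rs.map Polynomial.C) := hrs.1.of_flat
  have hmem : ∀ r ∈ rs.map Polynomial.C, r ∈ p := by
    simp only [List.mem_map]
    rintro _ ⟨a, ha, rfl⟩
    exact hle (Ideal.mem_map_of_mem _ (mem_maximalIdeal_of_isRegular hrs ha))
  have hdim : ringKrullDim (Localization.AtPrime p) = p.height :=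
    IsLocalization.AtPrime.ringKrullDim_eq_height p _
  have hht : ((maximalIdeal A).map Polynomial.C).height = (rs.length : ℕ∞) := by
    rw [Polynomial.height_map_C, ← WithBot.coe_inj, maximalIdeal_height_eq_ringKrullDim, ← hlen]
    rfl
  have hlen' : (((maximalIdeal A).map Polynomial.C).height : WithBot ℕ∞) = rs.length := by rw [hht]; rfl
  by_cases heq : p = (maximalIdeal A).map Polynomial.C
  · refine ⟨_, hrsC.isRegular_of_isLocalization_of_mem (Localization.AtPrime p) p hmem, ?_⟩
    rw [hdim, List.length_map, List.length_map, ← hlen', ← heq]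
  · have hlt := lt_of_le_of_ne hle (Ne.symm heq)
    obtain ⟨y, hy, hpy⟩ := Polynomial.exists_monic_span_sup_map_eq A p
      (hp ▸ maximalIdeal.isMaximal A) (by rwa [hp])
    have hyp : y ∈ p := hpy ▸ Ideal.mem_sup_right (Ideal.mem_span_singleton_self y)
    have hreg : IsWeaklyRegular A[X] (rs.map Polynomial.C ++ [y]) := by
      rw [isWeaklyRegular_append_iff]
      refine ⟨hrsC, (isWeaklyRegular_singleton_iff _ _).2 ?_⟩
      rw [isSMulRegular_quotient_iff_mem_of_smul_mem]
      intro g hg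
      rw [smul_eq_mul, Ideal.mul_top, ← Ideal.map_ofList, smul_eq_mul] at *
      rw [← Ideal.mk_ker (I := Ideal.ofList rs), ← Polynomial.ker_mapRingHom, RingHom.mem_ker] at *
      rw [map_mul] at hg
      have := (hy.map (Ideal.Quotient.mk (Ideal.ofList rs))).mem_nonZeroDivisors
      exact (mul_right_mem_nonZeroDivisors_eq_zero_iff this).1 (by rwa [mul_comm])
    refine ⟨_, hreg.isRegular_of_isLocalization_of_mem (Localization.AtPrime p) p ?_, ?_⟩
    · intro r hr
      rcases List.mem_append.1 hr with hr | hr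
      · exact hmem r hr
      · rwa [List.mem_singleton.1 hr]
    · rw [hdim]
      refine le_antisymm ?_ ?_
      · have := Ideal.height_add_one_le_of_lt_of_isPrime hlt
        rw [hht] at this
        simpa using WithBot.coe_le_coe.2 this
      · refine (Ideal.height_le_ringKrullDim_of_ne_top Ideal.IsPrime.ne_top').trans ?_
        rw [Polynomial.ringKrullDim_of_isNoetherianRing, ← hlen]
        simp

end Local

section Ring

variable {A B : Type*} [CommRing A] [CommRing B]

theorem isCohenMacaulayRing_iff [IsNoetherianRing A] :
    IsCohenMacaulayRing A ↔ ∀ (P : Ideal A) [P.IsPrime],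
      HasMaximalLengthRegularSequence (Localization.AtPrime P) := by
  have (P : Ideal A) [P.IsPrime] : IsNoetherianRing (Localization.AtPrime P) :=
    IsLocalization.isNoetherianRing P.primeCompl _ inferInstance
  exact forall₂_congr fun P _ => localRingDepth_eq_ringKrullDim_iff

theorem IsCohenMacaulayRing.of_ringEquiv [IsNoetherianRing A] (h : IsCohenMacaulayRing A)
    (e : A ≃+* B) : IsCohenMacaulayRing B := by
  have : IsNoetherianRing B := isNoetherianRing_of_ringEquiv A e
  rw [isCohenMacaulayRing_iff] at h ⊢
  intro Q _
  refine (h (Q.comap (e : A →+* B))).of_ringEquiv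
    (IsLocalization.ringEquivOfRingEquiv (M := (Q.comap (e : A →+* B)).primeCompl)
      (T := Q.primeCompl) _ _ e ?_)
  ext b
  obtain ⟨a, rfl⟩ := e.surjective b
  simp [Ideal.primeCompl, Submonoid.mem_map]

/-- The quotient of a Noetherian Cohen–Macaulay ring by a regular element is Cohen–Macaulay. -/
theorem IsCohenMacaulayRing.quotient_span_singleton [IsNoetherianRing A]
    (h : IsCohenMacaulayRing A) {f : A} (hf : IsSMulRegular A f) :
    IsCohenMacaulayRing (A ⧸ Ideal.span {f}) := by
  rw [isCohenMacaulayRing_iff] at h ⊢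
  intro Q _
  let P := Q.comap (Ideal.Quotient.mk (Ideal.span {f}))
  have hfP : f ∈ P := by
    rw [Ideal.mem_comap, Ideal.Quotient.eq_zero_iff_mem.2 (Ideal.mem_span_singleton_self f)]
    exact Q.zero_mem
  let AP := Localization.AtPrime P
  have : IsNoetherianRing AP := IsLocalization.isNoetherianRing P.primeCompl _ inferInstance
  have hsub : Algebra.algebraMapSubmonoid (A ⧸ Ideal.span {f}) P.primeCompl = Q.primeCompl := by
    ext b
    obtain ⟨a, rfl⟩ := Ideal.Quotient.mk_surjective b
    constructor
    · rintro ⟨c, hc, hca⟩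
      rw [← hca]
      exact hc
    · exact fun ha => ⟨a, ha, rfl⟩
  have : IsLocalization.AtPrime (AP ⧸ (Ideal.span {f}).map (algebraMap A AP)) Q := by
    rw [IsLocalization.AtPrime, ← hsub]
    infer_instance
  have hloc : HasMaximalLengthRegularSequence (AP ⧸ (Ideal.span {f}).map (algebraMap A AP)) := by
    rw [Ideal.map_span, Set.image_singleton]
    refine (h P).quotient_span_singleton ?_ ?_
    · rw [← isWeaklyRegular_singleton_iff] at hf ⊢
      exact hf.of_isLocalization AP P.primeCompl
    · exact (IsLocalization.AtPrime.to_map_mem_maximal_iff AP P f).2 hfP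
  exact hloc.of_ringEquiv (IsLocalization.algEquiv Q.primeCompl _ _).toRingEquiv

/-- The polynomial ring over a Noetherian Cohen–Macaulay ring is Cohen–Macaulay. -/
theorem IsCohenMacaulayRing.polynomial [IsNoetherianRing A] (h : IsCohenMacaulayRing A) :
    IsCohenMacaulayRing A[X] := by
  rw [isCohenMacaulayRing_iff] at h ⊢
  intro p hp
  let q := p.comap Polynomial.C
  let S := (Localization.AtPrime q)[X]
  have : IsNoetherianRing (Localization.AtPrime q) :=
    IsLocalization.isNoetherianRing q.primeCompl _ inferInstance
  let pc := Submonoid.map Polynomial.C.toMonoidHom q.primeCompl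
  let : Algebra A[X] S := Polynomial.algebra A (Localization.AtPrime q)
  have : IsLocalization pc S := Polynomial.isLocalization _ _
  let pS := p.map (algebraMap A[X] S)
  have disj : Disjoint (pc : Set A[X]) (p : Set A[X]) := by
    simpa [pc, q] using! Set.disjoint_image_left.mpr
      (Set.disjoint_compl_left_iff_subset.mpr (fun _ a ↦ a))
  have : pS.IsPrime := IsLocalization.isPrime_of_isPrime_disjoint pc _ _ hp disj
  have : IsLocalization.AtPrime (Localization.AtPrime pS) p := by
    convert IsLocalization.isLocalization_isLocalization_atPrime_isLocalization pc
      (Localization.AtPrime pS) pS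
    exact (IsLocalization.under_map_of_isPrime_disjoint pc _ hp disj).symm
  have eq : pS.comap Polynomial.C = maximalIdeal (Localization.AtPrime q) := by
    rw [← IsLocalization.map_under q.primeCompl _ (pS.comap Polynomial.C),
      ← IsLocalization.map_under q.primeCompl _ (maximalIdeal (Localization.AtPrime q))]
    simp only [Ideal.under, Ideal.comap_comap, S, pS]
    rw [← Polynomial.algebraMap_eq (R := Localization.AtPrime q),
      ← IsScalarTower.algebraMap_eq A (Localization.AtPrime q) (Localization.AtPrime q)[X],
      IsScalarTower.algebraMap_eq A A[X] (Localization.AtPrime q)[X], ← Ideal.comap_comap,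
      ← Ideal.under_def A[X], IsLocalization.under_map_of_isPrime_disjoint pc _ hp disj,
      ← Ideal.under_def A (maximalIdeal _),
      IsLocalization.AtPrime.under_maximalIdeal (Localization.AtPrime q) q]
    rfl
  exact ((h q).polynomial_localization pS eq).of_ringEquiv
    (IsLocalization.algEquiv p.primeCompl
      (Localization.AtPrime pS) (Localization.AtPrime p)).toRingEquiv

end Ring

section Factorization

universe u

/-- The ideal of `A[w_i, z_i : i ∈ ι]` generated by the elements `w_i z_i - x_i`. -/
noncomputable def factorizationIdeal {A ι : Type*} [CommRing A] (x : ι → A) :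
    Ideal (MvPolynomial (ι ⊕ ι) A) :=
  Ideal.span (Set.range fun i => X (Sum.inl i) * X (Sum.inr i) - C (x i))

/-- The ring `A[w_i, z_i : i ∈ ι] / (w_i z_i - x_i : i ∈ ι)`, universal among the `A`-algebras
with a chosen factorization of each `x_i` into two factors. -/
def FactorizationRing {A ι : Type*} [CommRing A] (x : ι → A) : Type _ :=
  MvPolynomial (ι ⊕ ι) A ⧸ factorizationIdeal x

noncomputable instance {A ι : Type*} [CommRing A] (x : ι → A) : CommRing (FactorizationRing x) :=
  inferInstanceAs (CommRing (MvPolynomial (ι ⊕ ι) A ⧸ factorizationIdeal x))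

instance {A ι : Type*} [CommRing A] [IsNoetherianRing A] [Finite ι] (x : ι → A) :
    IsNoetherianRing (FactorizationRing x) :=
  inferInstanceAs (IsNoetherianRing (MvPolynomial (ι ⊕ ι) A ⧸ factorizationIdeal x))

/-- The ideal of `A[w, z]` generated by `wz - x`. -/
noncomputable def singleFactorizationIdeal {A : Type*} [CommRing A] (x : A) : Ideal A[X][X] :=
  Ideal.span {Polynomial.C Polynomial.X * Polynomial.X - Polynomial.C (Polynomial.C x)}

/-- The ring `A[w, z] / (wz - x)`, presented by iterated polynomial rings in one variable. -/
def SingleFactorizationRing {A : Type*} [CommRing A] (x : A) : Type _ :=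
  A[X][X] ⧸ singleFactorizationIdeal x

noncomputable instance {A : Type*} [CommRing A] (x : A) : CommRing (SingleFactorizationRing x) :=
  inferInstanceAs (CommRing (A[X][X] ⧸ singleFactorizationIdeal x))

instance {A : Type*} [CommRing A] [IsNoetherianRing A] (x : A) :
    IsNoetherianRing (SingleFactorizationRing x) :=
  inferInstanceAs (IsNoetherianRing (A[X][X] ⧸ singleFactorizationIdeal x))

namespace FactorizationRing

variable {A B ι : Type*} [CommRing A] [CommRing B]

/-- The structure homomorphism of `FactorizationRing x`. -/
noncomputable def of (x : ι → A) : A →+* FactorizationRing x :=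
  (Ideal.Quotient.mk (factorizationIdeal x)).comp C

/-- The classes of the variables `w_i` and `z_i` in `FactorizationRing x`. -/
noncomputable def var (x : ι → A) (s : ι ⊕ ι) : FactorizationRing x :=
  Ideal.Quotient.mk (factorizationIdeal x) (X s)

theorem var_mul_var (x : ι → A) (i : ι) :
    var x (Sum.inl i) * var x (Sum.inr i) = of x (x i) := by
  refine (map_mul _ _ _).symm.trans (Ideal.Quotient.eq.2 (Ideal.subset_span ⟨i, rfl⟩))

/-- The ring homomorphism out of `FactorizationRing x` given by a ring homomorphism out of the
base ring and factorizations of the images of the `x i`. -/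
noncomputable def lift (x : ι → A) (g : A →+* B) (w : ι ⊕ ι → B)
    (h : ∀ i, w (Sum.inl i) * w (Sum.inr i) = g (x i)) : FactorizationRing x →+* B :=
  Ideal.Quotient.lift (factorizationIdeal x) (eval₂Hom g w) fun a ha => by
    refine (Ideal.span_le (I := RingHom.ker (eval₂Hom g w))).2 ?_ ha
    rintro _ ⟨i, rfl⟩
    simp [RingHom.mem_ker, h]

variable (x : ι → A) (g : A →+* B) (w : ι ⊕ ι → B)
  (h : ∀ i, w (Sum.inl i) * w (Sum.inr i) = g (x i))

@[simp]
theorem lift_of (a : A) : lift x g w h (of x a) = g a :=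
  (Ideal.Quotient.lift_mk _ _ _).trans (eval₂Hom_C g w a)

@[simp]
theorem lift_var (s : ι ⊕ ι) : lift x g w h (var x s) = w s :=
  (Ideal.Quotient.lift_mk _ _ _).trans (eval₂Hom_X' g w s)

variable {x} in
theorem hom_ext {f₁ f₂ : FactorizationRing x →+* B} (hof : ∀ a, f₁ (of x a) = f₂ (of x a))
    (hvar : ∀ s, f₁ (var x s) = f₂ (var x s)) : f₁ = f₂ :=
  Ideal.Quotient.ringHom_ext (MvPolynomial.ringHom_ext hof hvar)

end FactorizationRing

namespace SingleFactorizationRing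

variable {A B : Type*} [CommRing A] [CommRing B]

/-- The structure homomorphism of `SingleFactorizationRing x`. -/
noncomputable def of (x : A) : A →+* SingleFactorizationRing x :=
  (Ideal.Quotient.mk (singleFactorizationIdeal x)).comp (Polynomial.C.comp Polynomial.C)

/-- The class of `w` in `A[w, z] / (wz - x)`. -/
noncomputable def left (x : A) : SingleFactorizationRing x :=
  Ideal.Quotient.mk (singleFactorizationIdeal x) (Polynomial.C Polynomial.X)

/-- The class of `z` in `A[w, z] / (wz - x)`. -/
noncomputable def right (x : A) : SingleFactorizationRing x :=
  Ideal.Quotient.mk (singleFactorizationIdeal x) Polynomial.X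

theorem left_mul_right (x : A) : left x * right x = of x x := by
  refine (map_mul _ _ _).symm.trans (Ideal.Quotient.eq.2 (Ideal.mem_span_singleton_self _))

/-- The ring homomorphism out of `SingleFactorizationRing x` given by a ring homomorphism out of
the base ring and a factorization of the image of `x`. -/
noncomputable def lift (x : A) (g : A →+* B) (w z : B) (h : w * z = g x) :
    SingleFactorizationRing x →+* B :=
  Ideal.Quotient.lift (singleFactorizationIdeal x) (Polynomial.eval₂RingHom (Polynomial.eval₂RingHom g w) z)
      fun a ha => by
    refine (Ideal.span_le
      (I := RingHom.ker (Polynomial.eval₂RingHom (Polynomial.eval₂RingHom g w) z))).2 ?_ ha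
    rintro _ rfl
    simp [RingHom.mem_ker, h]

variable (x : A) (g : A →+* B) (w z : B) (h : w * z = g x)

@[simp]
theorem lift_of (a : A) : lift x g w z h (of x a) = g a := by
  refine (Ideal.Quotient.lift_mk _ _ _).trans ?_
  simp

@[simp]
theorem lift_left : lift x g w z h (left x) = w := by
  refine (Ideal.Quotient.lift_mk _ _ _).trans ?_
  simp

@[simp]
theorem lift_right : lift x g w z h (right x) = z := by
  refine (Ideal.Quotient.lift_mk _ _ _).trans ?_
  simp

variable {x} in
theorem hom_ext {f₁ f₂ : SingleFactorizationRing x →+* B} (hof : ∀ a, f₁ (of x a) = f₂ (of x a))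
    (hleft : f₁ (left x) = f₂ (left x)) (hright : f₁ (right x) = f₂ (right x)) : f₁ = f₂ :=
  Ideal.Quotient.ringHom_ext
    (Polynomial.ringHom_ext' (Polynomial.ringHom_ext hof hleft) hright)

end SingleFactorizationRing

theorem IsCohenMacaulayRing.singleFactorizationRing {A : Type*} [CommRing A] [IsNoetherianRing A]
    (h : IsCohenMacaulayRing A) (x : A) : IsCohenMacaulayRing (SingleFactorizationRing x) := by
  refine h.polynomial.polynomial.quotient_span_singleton ?_
  cases subsingleton_or_nontrivial A
  · exact fun a b _ => Subsingleton.elim a b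
  refine Module.Flat.isSMulRegular_of_nonZeroDivisors
    (Polynomial.mem_nonZeroDivisors_of_leadingCoeff ?_)
  rw [sub_eq_add_neg, ← map_neg, Polynomial.leadingCoeff_linear Polynomial.X_ne_zero]
  exact Polynomial.monic_X.mem_nonZeroDivisors

namespace FactorizationRing

variable {A ι κ : Type*} [CommRing A]

/-- Reindexing of `FactorizationRing`. -/
noncomputable def reindex (e : ι ≃ κ) (x : κ → A) :
    FactorizationRing (x ∘ e) ≃+* FactorizationRing x :=
  RingEquiv.ofRingHom
    (lift _ (of x) (fun s => var x (s.map e e)) fun i => by simpa using var_mul_var x (e i))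
    (lift _ (of _) (fun s => var _ (s.map e.symm e.symm))
      fun i => by simpa using var_mul_var (x ∘ e) (e.symm i))
    (hom_ext (by simp) fun s => by cases s <;> simp)
    (hom_ext (by simp) fun s => by cases s <;> simp)

/-- With no elements to factor, `FactorizationRing` is the base ring. -/
noncomputable def equivOfIsEmpty [IsEmpty ι] (x : ι → A) : A ≃+* FactorizationRing x :=
  RingEquiv.ofRingHom (of x) (lift x (RingHom.id A) isEmptyElim isEmptyElim)
    (hom_ext (by simp) isEmptyElim) (by ext; simp)

/-- A factorization of every `x i` restricts to a factorization of `x none` and one of the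
`x (some i)`. -/
noncomputable def ofOption (x : Option ι → A) :
    FactorizationRing (fun i => SingleFactorizationRing.of (x none) (x (some i))) →+*
      FactorizationRing x :=
  lift _ (SingleFactorizationRing.lift _ (of x) (var x (Sum.inl none)) (var x (Sum.inr none))
      (var_mul_var x none))
    (fun s => var x (s.map some some))
    fun i => by simpa using var_mul_var x (some i)

/-- Factorizations of `x none` and of the `x (some i)` combine to a factorization of every
`x i`. -/
noncomputable def toOption (x : Option ι → A) :
    FactorizationRing x →+*
      FactorizationRing (fun i => SingleFactorizationRing.of (x none) (x (some i))) :=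
  lift _ ((of _).comp (SingleFactorizationRing.of _))
    (Sum.elim
      (fun o => o.elim (of _ (SingleFactorizationRing.left _)) fun i => var _ (Sum.inl i))
      (fun o => o.elim (of _ (SingleFactorizationRing.right _)) fun i => var _ (Sum.inr i)))
    fun
      | none => by simp [← map_mul, SingleFactorizationRing.left_mul_right]
      | some i => by simpa using var_mul_var _ i

/-- Factoring a family indexed by `Option ι` amounts to factoring first the element at `none` and
then the others. -/
noncomputable def optionEquiv (x : Option ι → A) :
    FactorizationRing (fun i => SingleFactorizationRing.of (x none) (x (some i))) ≃+*
      FactorizationRing x :=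
  RingEquiv.ofRingHom (ofOption x) (toOption x)
    (hom_ext (by simp [ofOption, toOption])
      fun s => by rcases s with (_ | i) | (_ | i) <;> simp [ofOption, toOption])
    (by
      have hof : ((toOption x).comp (ofOption x)).comp (of _) = of _ :=
        SingleFactorizationRing.hom_ext (by simp [ofOption, toOption])
          (by simp [ofOption, toOption]) (by simp [ofOption, toOption])
      exact hom_ext (RingHom.congr_fun hof)
        fun s => by cases s <;> simp [ofOption, toOption])

end FactorizationRing

theorem IsCohenMacaulayRing.factorizationRing {ι : Type*} [Finite ι] {A : Type u} [CommRing A]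
    [IsNoetherianRing A] (h : IsCohenMacaulayRing A) (x : ι → A) :
    IsCohenMacaulayRing (FactorizationRing x) := by
  refine Finite.induction_empty_option (P := fun ι => ∀ [Finite ι] {A : Type u} [CommRing A]
    [IsNoetherianRing A] (_ : IsCohenMacaulayRing A) (x : ι → A),
      IsCohenMacaulayRing (FactorizationRing x)) ?_ ?_ ?_ ι h x
  · intro α β e ih _ A _ _ h x
    have := Finite.of_equiv β e.symm
    exact (ih h (x ∘ e)).of_ringEquiv (FactorizationRing.reindex e x)
  · intro _ A _ _ h x
    exact h.of_ringEquiv (FactorizationRing.equivOfIsEmpty x)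
  · intro α _ ih _ A _ _ h x
    exact (ih (h.singleFactorizationRing (x none)) _).of_ringEquiv
      (FactorizationRing.optionEquiv x)

end Factorization

section Standardization

variable {k : Type*} [Field k] {p : ℕ} (I : Ideal (MvPolynomial (Fin p × Fin p) k))

/-- The homomorphism from `S` to the factorization ring of the `x_{ij}` in `R/I` that preserves
the variables. -/
noncomputable def toFactorizationRing :
    MvPolynomial ((Fin p × Fin p) ⊕ (Fin p × Fin p)) k →+*
      FactorizationRing (fun q => Ideal.Quotient.mk I (X q)) :=
  eval₂Hom ((FactorizationRing.of _).comp ((Ideal.Quotient.mk I).comp C))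
    (FactorizationRing.var fun q => Ideal.Quotient.mk I (X q))

theorem toFactorizationRing_stdMap (a : MvPolynomial (Fin p × Fin p) k) :
    toFactorizationRing I (stdMap k p a) = FactorizationRing.of _ (Ideal.Quotient.mk I a) := by
  have h : (toFactorizationRing I).comp (stdMap k p).toRingHom =
      (FactorizationRing.of _).comp (Ideal.Quotient.mk I) := by
    refine MvPolynomial.ringHom_ext (fun c => ?_) fun q => ?_
    · simp [stdMap, toFactorizationRing]
    · simpa [stdMap, toFactorizationRing] using FactorizationRing.var_mul_var _ q
  exact RingHom.congr_fun h a

theorem toFactorizationRing_eq_zero (a : MvPolynomial ((Fin p × Fin p) ⊕ (Fin p × Fin p)) k)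
    (ha : a ∈ Ideal.map (stdMap k p) I) : toFactorizationRing I a = 0 := by
  refine (Ideal.map_le_iff_le_comap (K := RingHom.ker (toFactorizationRing I))).2 (fun b hb => ?_)
    ha
  rw [Ideal.mem_comap, RingHom.mem_ker, toFactorizationRing_stdMap,
    Ideal.Quotient.eq_zero_iff_mem.2 hb, map_zero]

/-- The homomorphism from the factorization ring of the `x_{ij}` in `R/I` to `S/J` that preserves
the variables. -/
noncomputable def ofFactorizationRing :
    FactorizationRing (fun q => Ideal.Quotient.mk I (X q)) →+*
      MvPolynomial ((Fin p × Fin p) ⊕ (Fin p × Fin p)) k ⧸ Ideal.map (stdMap k p) I :=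
  FactorizationRing.lift _
    (Ideal.Quotient.lift I ((Ideal.Quotient.mk _).comp (stdMap k p).toRingHom)
      fun _ ha => Ideal.Quotient.eq_zero_iff_mem.2 (Ideal.mem_map_of_mem (stdMap k p) ha))
    (fun s => Ideal.Quotient.mk _ (X s))
    fun q => by
      refine (map_mul _ _ _).symm.trans (congrArg (Ideal.Quotient.mk _) ?_)
      simp [stdMap]

theorem ofFactorizationRing_of (a : MvPolynomial (Fin p × Fin p) k) :
    ofFactorizationRing I (FactorizationRing.of _ (Ideal.Quotient.mk I a)) =
      Ideal.Quotient.mk _ (stdMap k p a) :=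
  FactorizationRing.lift_of ..

theorem ofFactorizationRing_var (s : (Fin p × Fin p) ⊕ (Fin p × Fin p)) :
    ofFactorizationRing I (FactorizationRing.var _ s) = Ideal.Quotient.mk _ (X s) :=
  FactorizationRing.lift_var ..

/-- The standardization `S/J` of `R/I` is the universal `R/I`-algebra in which every variable
`x_{ij}` acquires a factorization `w_{ij} z_{ij}`. -/
noncomputable def factorizationRingEquivStandardization :
    FactorizationRing (fun q => Ideal.Quotient.mk I (X q)) ≃+*
      MvPolynomial ((Fin p × Fin p) ⊕ (Fin p × Fin p)) k ⧸ Ideal.map (stdMap k p) I :=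
  RingEquiv.ofRingHom (ofFactorizationRing I)
    (Ideal.Quotient.lift _ (toFactorizationRing I) (toFactorizationRing_eq_zero I))
    (by
      have h : (ofFactorizationRing I).comp (toFactorizationRing I) = Ideal.Quotient.mk _ := by
        refine MvPolynomial.ringHom_ext (fun c => ?_) fun s => ?_
        · rw [RingHom.comp_apply, toFactorizationRing, eval₂Hom_C, RingHom.comp_apply,
            RingHom.comp_apply, ofFactorizationRing_of, ← algebraMap_eq, AlgHom.commutes]
          rfl
        · simp [toFactorizationRing, ofFactorizationRing_var]
      exact Ideal.Quotient.ringHom_ext h)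
    (by
      refine FactorizationRing.hom_ext (fun a => ?_) fun s => ?_
      · obtain ⟨a, rfl⟩ := Ideal.Quotient.mk_surjective a
        rw [RingHom.comp_apply, ofFactorizationRing_of]
        exact toFactorizationRing_stdMap I a
      · rw [RingHom.comp_apply, ofFactorizationRing_var]
        exact eval₂Hom_X' _ _ s)

end Standardization

/-- If `R/I` is Cohen–Macaulay, then so is `S/J`, where `J = φ(I)S` is the
standardization of the `R`-homogeneous ideal `I`. -/
theorem cohenMacaulay_standardization (p : ℕ) (hp : 1 ≤ p) (k : Type*) [Field k]
    (I : Ideal (MvPolynomial (Fin p × Fin p) k))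
    (hI : IsMultigradedHomogeneous I)
    (hCM : IsCohenMacaulayRing (MvPolynomial (Fin p × Fin p) k ⧸ I)) :
    IsCohenMacaulayRing (MvPolynomial ((Fin p × Fin p) ⊕ (Fin p × Fin p)) k ⧸
      Ideal.map (stdMap k p) I) := by
  exact (hCM.factorizationRing fun q => Ideal.Quotient.mk I (X q)).of_ringEquiv
    (factorizationRingEquivStandardization I)
end
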